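/- There exist absolute constants C > 0 and N_0 such that the following holds for all n ≥ N_0. Let (d_1,…,d_n) be positive integers with even sum such that d_max^4 ≤ (d−2)n, where d_max = max_j d_j and d = (1/n)·Σ_{j=1}^n d_j. Then the set Γ_d of simple graphs on vertex set {1,…,n} with degree sequence (d_1,…,d_n) is nonempty, and the expected number E τ_d of spanning trees of a uniformly random graph in Γ_d satisfies E τ_d = H_d · exp( (6d²−14d+7)/(4(d−1)²) + R/(2(d−1)³) + (2d²−4d+1)R²/(4(d−1)⁴ d²) + E ), where |E| ≤ C·( d_max^4/((d−2)n) + η ) and η = min{ d_max^4/((d−2)² n), d_max³ (log n)/((d−2)n), d_max (d−2) }. -/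

import Mathlib

attribute [local instance] Classical.propDecidable

/-- The number of spanning trees of a simple graph on `Fin n`. -/
noncomputable def spanningTreeCount {n : ℕ} (G : SimpleGraph (Fin n)) : ℕ :=
  (Finset.univ.filter (fun T : SimpleGraph (Fin n) => T ≤ G ∧ T.IsTree)).card

lemma abs_log_one_sub_add_le {u : ℝ} (h1 : u ≤ 1 / 2) :
    |Real.log (1 - u) + u| ≤ 2 * u ^ 2 := by
  have h2 : 0 < 1 - u := by linarith
  have hup := Real.log_le_sub_one_of_pos h2
  have hlow := Real.one_sub_inv_le_log_of_pos h2
  have h3 : (1 - u)⁻¹ ≤ 1 + u + 2 * u ^ 2 := by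
    rw [inv_le_iff_one_le_mul₀ h2]
    nlinarith [mul_nonneg (sq_nonneg u) (sub_nonneg.2 h1)]
  rw [abs_le]
  constructor <;> nlinarith [sq_nonneg u]

/-- Sequentially imposing soft constraints `A i` of strength `t i`: if each constraint has
conditional probability close to `p i` whatever constraints were imposed before, then the total
weight drops by the factor `exp (-∑ t i * p i)` up to a controlled error. -/
lemma sum_mul_prod_eq_exp {ι Ω : Type*} (s : Finset Ω) (w : Ω → ℝ) (A : ι → Ω → Prop)
    [∀ i ω, Decidable (A i ω)]
    (t p ε : ι → ℝ) (J : Finset ι) (hw : ∀ ω ∈ s, 0 ≤ w ω)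
    (hε : ∀ i ∈ J, 0 ≤ ε i)
    (ht0 : ∀ i ∈ J, 0 ≤ t i) (ht1 : ∀ i ∈ J, t i ≤ 1)
    (hsmall : ∀ i ∈ J, t i ≤ 1 / 2 ∨ t i * (p i + ε i) ≤ 1 / 2)
    (hA : ∀ I ⊆ J, ∀ i ∈ J, i ∉ I →
      |∑ ω ∈ s.filter (A i), w ω * ∏ k ∈ I, (if A k ω then 1 - t k else 1)
        - p i * ∑ ω ∈ s, w ω * ∏ k ∈ I, (if A k ω then 1 - t k else 1)|
      ≤ ε i * ∑ ω ∈ s, w ω * ∏ k ∈ I, (if A k ω then 1 - t k else 1)) :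
    ∃ E : ℝ, |E| ≤ ∑ i ∈ J, (t i * ε i + 2 * (t i * (p i + ε i)) ^ 2) ∧
      ∑ ω ∈ s, w ω * ∏ k ∈ J, (if A k ω then 1 - t k else 1)
        = (∑ ω ∈ s, w ω) * Real.exp (-∑ i ∈ J, t i * p i + E) := by
  induction J using Finset.induction_on with
  | empty => exact ⟨0, by simp, by simp⟩
  | insert i I hi ih =>
    obtain ⟨E, hE, hsum⟩ := ih (fun j hj => hε j (Finset.mem_insert_of_mem hj))
      (fun j hj => ht0 j (Finset.mem_insert_of_mem hj))
      (fun j hj => ht1 j (Finset.mem_insert_of_mem hj))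
      (fun j hj => hsmall j (Finset.mem_insert_of_mem hj))
      (fun K hK j hj hjK => hA K (hK.trans (Finset.subset_insert _ _)) j
        (Finset.mem_insert_of_mem hj) hjK)
    have hi' := hA I (Finset.subset_insert _ _) i (Finset.mem_insert_self _ _) hi
    have hti := ht0 i (Finset.mem_insert_self _ _)
    have hti1 := ht1 i (Finset.mem_insert_self _ _)
    have hsm := hsmall i (Finset.mem_insert_self _ _)
    set W : Ω → ℝ := fun ω => w ω * ∏ k ∈ I, (if A k ω then 1 - t k else 1) with hW
    have hWnn : ∀ ω ∈ s, 0 ≤ W ω := fun ω hω => mul_nonneg (hw ω hω)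
      (Finset.prod_nonneg fun k hk => by
        have := ht1 k (Finset.mem_insert_of_mem hk)
        split_ifs <;> linarith)
    have hstep : ∑ ω ∈ s, w ω * ∏ k ∈ insert i I, (if A k ω then 1 - t k else 1)
        = ∑ ω ∈ s, W ω - t i * ∑ ω ∈ s.filter (A i), W ω := by
      rw [Finset.sum_filter, Finset.mul_sum, ← Finset.sum_sub_distrib]
      refine Finset.sum_congr rfl fun ω _ => ?_
      rw [Finset.prod_insert hi, hW]
      dsimp only
      split_ifs <;> ring
    rcases (Finset.sum_nonneg hWnn).eq_or_lt with h0 | hpos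
    · refine ⟨0, ?_, ?_⟩
      · rw [abs_zero]
        exact Finset.sum_nonneg fun j hj =>
          add_nonneg (mul_nonneg (ht0 j hj) (hε j hj)) (by positivity)
      · rw [← h0] at hsum
        rw [hstep, ← h0]
        have hw0 : ∑ ω ∈ s, w ω = 0 :=
          (mul_eq_zero.1 hsum.symm).resolve_right (Real.exp_pos _).ne'
        have hB0 : ∑ ω ∈ s.filter (A i), W ω = 0 := by
          have h1 := hi'
          rw [show (∑ ω ∈ s, w ω * ∏ k ∈ I, if A k ω then 1 - t k else 1) = 0 from h0.symm,
            mul_zero, mul_zero, sub_zero] at h1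
          exact abs_nonpos_iff.1 h1
        rw [hB0, hw0]
        ring
    · set S := ∑ ω ∈ s, W ω
      set B := ∑ ω ∈ s.filter (A i), W ω
      have hB0 : 0 ≤ B := Finset.sum_nonneg fun ω hω => hWnn ω (Finset.mem_filter.1 hω).1
      have hq : |B / S - p i| ≤ ε i := by
        rw [show B / S - p i = (B - p i * S) / S by field_simp, abs_div, abs_of_pos hpos,
          div_le_iff₀ hpos]
        exact hi'
      set q := B / S
      have hBq : B = q * S := by simp only [q]; field_simp
      have hq0 : 0 ≤ q := div_nonneg hB0 hpos.le
      have hq1 : q ≤ 1 := (div_le_one hpos).2 (Finset.sum_le_sum_of_subset_of_nonneg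
        (Finset.filter_subset _ _) fun ω hω _ => hWnn ω hω)
      rw [abs_le] at hq
      have hu0 : 0 ≤ t i * q := mul_nonneg hti hq0
      have hule : t i * q ≤ t i * (p i + ε i) := mul_le_mul_of_nonneg_left (by linarith) hti
      have huhalf : t i * q ≤ 1 / 2 :=
        hsm.elim (fun h => (mul_le_of_le_one_right hti hq1).trans h) hule.trans
      have hlog := abs_log_one_sub_add_le huhalf
      have hsq : (t i * q) ^ 2 ≤ (t i * (p i + ε i)) ^ 2 := pow_le_pow_left₀ hu0 hule 2
      refine ⟨E + (Real.log (1 - t i * q) + t i * p i), ?_, ?_⟩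
      · rw [Finset.sum_insert hi, add_comm]
        have h5 : |t i * p i - t i * q| ≤ t i * ε i := by
          rw [← mul_sub, abs_mul, abs_of_nonneg hti]
          exact mul_le_mul_of_nonneg_left (abs_le.2 ⟨by linarith, by linarith⟩) hti
        rw [abs_le] at *
        constructor <;> linarith
      · rw [hstep, hBq]
        have hexp : Real.exp (Real.log (1 - t i * q)) = 1 - t i * q :=
          Real.exp_log (by linarith)
        rw [Finset.sum_insert hi, show -(t i * p i + ∑ j ∈ I, t j * p j) +
          (E + (Real.log (1 - t i * q) + t i * p i)) = (-∑ j ∈ I, t j * p j + E)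
            + Real.log (1 - t i * q) by ring, Real.exp_add, hexp, ← mul_assoc]
        linear_combination (1 - t i * q) * hsum

/-- A partition function `∑ exp (-∑ τ i * 1[A i])` is `exp` of minus the mean of the exponent when
every event `A i` keeps its probability `p i`, up to a factor `exp (±Λ)`, under every partial
tilt. -/
lemma exists_sum_exp_neg_eq (c : ℝ) : ∃ C : ℝ, 0 < C ∧
    ∀ {ι Ω : Type} [Fintype ι] (s : Finset Ω) (A : ι → Ω → Prop) [∀ i ω, Decidable (A i ω)]
      (τ p : ι → ℝ) (Λ : ℝ),
      (∀ i, 0 ≤ τ i) → (∀ i, τ i ≤ 1 / 2) → (∀ i, τ i ≤ Λ) → (∀ i, 0 ≤ p i) → (∀ i, p i ≤ 1) →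
      0 ≤ Λ → Λ ≤ c →
      (∀ (I : Finset ι) (i : ι),
        Real.exp (-Λ) * (p i * ∑ ω ∈ s, Real.exp (-∑ k ∈ I, if A k ω then τ k else 0))
          ≤ ∑ ω ∈ s.filter (A i), Real.exp (-∑ k ∈ I, if A k ω then τ k else 0) ∧
        ∑ ω ∈ s.filter (A i), Real.exp (-∑ k ∈ I, if A k ω then τ k else 0)
          ≤ Real.exp Λ * (p i * ∑ ω ∈ s, Real.exp (-∑ k ∈ I, if A k ω then τ k else 0))) →
      ∃ E : ℝ, |E| ≤ C * Λ * ∑ i, τ i * p i ∧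
        ∑ ω ∈ s, Real.exp (-∑ k, if A k ω then τ k else 0)
          = s.card * Real.exp (-∑ i, τ i * p i + E) := by
  set κ := Real.exp c with hκ
  have hκ0 : 0 < κ := Real.exp_pos c
  refine ⟨1 + κ + 2 * (1 + |c| * κ) ^ 2, by positivity, ?_⟩
  intro ι Ω _ s A _ τ p Λ hτ0 hτ2 hτΛ hp0 hp1 hΛ0 hΛc hA
  have hup : Real.exp Λ - 1 ≤ Λ * κ := by
    have h1 : Real.exp Λ ≤ κ := Real.exp_le_exp.2 hΛc
    have h2 := Real.add_one_le_exp (-Λ)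
    have h3 : Real.exp Λ * Real.exp (-Λ) = 1 := by rw [← Real.exp_add]; simp
    nlinarith [Real.exp_pos Λ]
  have hlow : 1 - Real.exp (-Λ) ≤ Λ * κ := by
    have h2 := Real.add_one_le_exp (-Λ)
    have h1 : (1 : ℝ) ≤ κ := Real.one_le_exp (hΛ0.trans hΛc)
    nlinarith
  have hfac : ∀ (I : Finset ι) (ω : Ω), Real.exp (-∑ k ∈ I, if A k ω then τ k else 0)
      = 1 * ∏ k ∈ I, (if A k ω then 1 - (1 - Real.exp (-τ k)) else 1) := by
    intro I ω
    rw [one_mul, ← Finset.sum_neg_distrib, Real.exp_sum]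
    refine Finset.prod_congr rfl fun k _ => ?_
    split_ifs <;> simp
  have ht0 : ∀ i, 0 ≤ 1 - Real.exp (-τ i) := fun i => by
    have := Real.exp_le_one_iff.2 (neg_nonpos.2 (hτ0 i))
    linarith
  have htτ : ∀ i, 1 - Real.exp (-τ i) ≤ τ i := fun i => by
    have := Real.add_one_le_exp (-τ i)
    linarith
  have hτt : ∀ i, τ i - τ i ^ 2 ≤ 1 - Real.exp (-τ i) := fun i => by
    have h1 := Real.add_one_le_exp (τ i)
    have h3 : Real.exp (τ i) * Real.exp (-τ i) = 1 := by rw [← Real.exp_add]; simp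
    have h4 : (1 + τ i) * Real.exp (-τ i) ≤ 1 := by nlinarith [Real.exp_pos (-τ i)]
    have h5 := hτ0 i
    have h6 : 0 ≤ τ i ^ 3 := by positivity
    have h7 : (1 + τ i) * (1 - τ i + τ i ^ 2) ≥ 1 := by nlinarith
    nlinarith
  obtain ⟨E, hE, hsum⟩ := sum_mul_prod_eq_exp s (fun _ => (1 : ℝ)) A
    (fun i => 1 - Real.exp (-τ i)) p (fun i => Λ * κ * p i) Finset.univ
    (fun _ _ => zero_le_one) (fun i _ => mul_nonneg (by positivity) (hp0 i)) (fun i _ => ht0 i)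
    (fun i _ => (htτ i).trans ((hτ2 i).trans (by norm_num)))
    (fun i _ => Or.inl ((htτ i).trans (hτ2 i)))
    (fun I _ i _ _ => by
      simp only [← hfac]
      obtain ⟨h1, h2⟩ := hA I i
      have hS : 0 ≤ ∑ ω ∈ s, Real.exp (-∑ k ∈ I, if A k ω then τ k else 0) :=
        Finset.sum_nonneg fun _ _ => (Real.exp_pos _).le
      have hpS := mul_nonneg (hp0 i) hS
      rw [abs_le]
      constructor <;> nlinarith)
  simp only [← hfac] at hsum
  refine ⟨E + ∑ i, (τ i - (1 - Real.exp (-τ i))) * p i, ?_, ?_⟩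
  · have hbound : ∀ i, (1 - Real.exp (-τ i)) * (Λ * κ * p i)
        + 2 * ((1 - Real.exp (-τ i)) * (p i + Λ * κ * p i)) ^ 2
        + (τ i - (1 - Real.exp (-τ i))) * p i
        ≤ (1 + κ + 2 * (1 + |c| * κ) ^ 2) * Λ * (τ i * p i) := by
      intro i
      have a1 : (1 - Real.exp (-τ i)) * (Λ * κ * p i) ≤ κ * Λ * (τ i * p i) := by
        calc _ ≤ τ i * (Λ * κ * p i) :=
              mul_le_mul_of_nonneg_right (htτ i) (mul_nonneg (by positivity) (hp0 i))
          _ = _ := by ring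
      have a2 : (τ i - (1 - Real.exp (-τ i))) * p i ≤ Λ * (τ i * p i) := by
        calc _ ≤ τ i ^ 2 * p i := mul_le_mul_of_nonneg_right (by linarith [hτt i]) (hp0 i)
          _ = τ i * (τ i * p i) := by ring
          _ ≤ _ := mul_le_mul_of_nonneg_right (hτΛ i) (mul_nonneg (hτ0 i) (hp0 i))
      have a3 : ((1 - Real.exp (-τ i)) * (p i + Λ * κ * p i)) ^ 2
          ≤ (1 + |c| * κ) ^ 2 * Λ * (τ i * p i) := by
        have hΛ' : Λ ≤ |c| := hΛc.trans (le_abs_self c)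
        have b1 : (1 - Real.exp (-τ i)) * (p i + Λ * κ * p i) ≤ τ i * (p i * (1 + |c| * κ)) := by
          refine mul_le_mul (htτ i) ?_
            (add_nonneg (hp0 i) (mul_nonneg (by positivity) (hp0 i))) (hτ0 i)
          have := mul_le_mul_of_nonneg_right (mul_le_mul_of_nonneg_right hΛ' hκ0.le) (hp0 i)
          linarith
        have b2 := pow_le_pow_left₀ (mul_nonneg (ht0 i)
          (add_nonneg (hp0 i) (mul_nonneg (by positivity) (hp0 i)))) b1 2
        refine b2.trans ?_
        have b3 : τ i * p i * (τ i * p i) ≤ Λ * 1 * (τ i * p i) :=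
          mul_le_mul_of_nonneg_right (mul_le_mul (hτΛ i) (hp1 i) (hp0 i) hΛ0)
            (mul_nonneg (hτ0 i) (hp0 i))
        calc _ = (1 + |c| * κ) ^ 2 * (τ i * p i * (τ i * p i)) := by ring
          _ ≤ (1 + |c| * κ) ^ 2 * (Λ * 1 * (τ i * p i)) :=
            mul_le_mul_of_nonneg_left b3 (by positivity)
          _ = _ := by ring
      linarith
    have hnn : 0 ≤ ∑ i, (τ i - (1 - Real.exp (-τ i))) * p i :=
      Finset.sum_nonneg fun i _ => mul_nonneg (by linarith [htτ i]) (hp0 i)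
    refine (abs_add_le _ _).trans ?_
    rw [abs_of_nonneg hnn, Finset.mul_sum]
    refine (add_le_add_left hE _).trans ?_
    rw [← Finset.sum_add_distrib]
    exact Finset.sum_le_sum fun i _ => hbound i
  · rw [hsum]
    simp only [Finset.sum_const, nsmul_eq_mul, mul_one]
    congr 2
    simp only [sub_mul, Finset.sum_sub_distrib]
    ring

section SubsetExchange

lemma map_swap_map_swap {Y : Type} (y z : Y) (B : Finset Y) :
    (B.map (Equiv.swap y z).toEmbedding).map (Equiv.swap y z).toEmbedding = B := by
  ext a; simp [Finset.mem_map_equiv]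

lemma swap_apply_eq_self_of_notMem {Y : Type} {y z a : Y} {K : Finset Y} (hy : y ∉ K) (hz : z ∉ K)
    (ha : a ∈ K) : Equiv.swap y z a = a :=
  Equiv.swap_apply_of_ne_of_ne (fun h => hy (h ▸ ha)) (fun h => hz (h ▸ ha))

variable {Y : Type} [Fintype Y]

/-- The `b`-subsets of `Y` that contain `K₁` and avoid `K₂`. -/
noncomputable def subsetsContainingAvoiding (b : ℕ) (K₁ K₂ : Finset Y) : Finset (Finset Y) :=
  (Finset.powersetCard b Finset.univ).filter fun B => K₁ ⊆ B ∧ Disjoint K₂ B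

lemma mem_subsetsContainingAvoiding {b : ℕ} {K₁ K₂ B : Finset Y} :
    B ∈ subsetsContainingAvoiding b K₁ K₂ ↔ B.card = b ∧ K₁ ⊆ B ∧ Disjoint K₂ B := by
  simp [subsetsContainingAvoiding, Finset.mem_powersetCard]

lemma sum_le_exp_mul_sum_of_swap {b : ℕ} {W : Finset Y → ℝ} {Δ : ℝ}
    (hW : ∀ B : Finset Y, B.card = b → ∀ y z,
      W B ≤ Real.exp Δ * W (B.map (Equiv.swap y z).toEmbedding))
    (y z : Y) (Q R : Finset (Finset Y)) (hQ : ∀ B ∈ Q, B.card = b)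
    (hQR : ∀ B ∈ Q, B.map (Equiv.swap y z).toEmbedding ∈ R)
    (hRQ : ∀ B ∈ R, B.map (Equiv.swap y z).toEmbedding ∈ Q) :
    ∑ B ∈ Q, W B ≤ Real.exp Δ * ∑ B ∈ R, W B := by
  calc ∑ B ∈ Q, W B ≤ ∑ B ∈ Q, Real.exp Δ * W (B.map (Equiv.swap y z).toEmbedding) :=
        Finset.sum_le_sum fun B hB => hW B (hQ B hB) y z
    _ = Real.exp Δ * ∑ B ∈ R, W B := by
      rw [← Finset.mul_sum]
      congr 1
      exact Finset.sum_nbij' (fun B => B.map (Equiv.swap y z).toEmbedding)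
        (fun B => B.map (Equiv.swap y z).toEmbedding) hQR hRQ
        (fun B _ => map_swap_map_swap y z B) (fun B _ => map_swap_map_swap y z B)
        (fun B _ => rfl)

lemma card_mul_sum_bounds {b k : ℕ} {W : Finset Y → ℝ} {Δ : ℝ}
    (hW : ∀ B : Finset Y, B.card = b → ∀ y z,
      W B ≤ Real.exp Δ * W (B.map (Equiv.swap y z).toEmbedding))
    (F : Finset Y) (Q : Y → Finset (Finset Y)) (N : Finset (Finset Y))
    (hQ : ∀ y ∈ F, ∀ B ∈ Q y, B.card = b)
    (hswap : ∀ y ∈ F, ∀ z ∈ F, ∀ B ∈ Q y, B.map (Equiv.swap y z).toEmbedding ∈ Q z)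
    (hsub : ∀ y ∈ F, ∀ B ∈ Q y, B ∈ N)
    (hcount : ∀ B ∈ N, (F.filter fun y => B ∈ Q y).card = k) {y : Y} (hy : y ∈ F) :
    Real.exp (-Δ) * (k * ∑ B ∈ N, W B) ≤ F.card * ∑ B ∈ Q y, W B ∧
      F.card * ∑ B ∈ Q y, W B ≤ Real.exp Δ * (k * ∑ B ∈ N, W B) := by
  have htotal : ∑ z ∈ F, ∑ B ∈ Q z, W B = k * ∑ B ∈ N, W B := by
    have h1 : ∀ z ∈ F, ∑ B ∈ Q z, W B = ∑ B ∈ N, if B ∈ Q z then W B else 0 := by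
      intro z hz
      rw [← Finset.sum_filter]
      refine Finset.sum_congr ?_ fun _ _ => rfl
      ext B
      simp only [Finset.mem_filter]
      exact ⟨fun h => ⟨hsub z hz B h, h⟩, fun h => h.2⟩
    rw [Finset.sum_congr rfl h1, Finset.sum_comm, Finset.mul_sum]
    refine Finset.sum_congr rfl fun B hB => ?_
    rw [← Finset.sum_filter, Finset.sum_const, hcount B hB, nsmul_eq_mul]
  have hcomm : ∀ y z : Y, Equiv.swap y z = Equiv.swap z y := Equiv.swap_comm
  rw [← htotal]
  constructor
  · have h2 : ∑ z ∈ F, ∑ B ∈ Q z, W B ≤ ∑ z ∈ F, Real.exp Δ * ∑ B ∈ Q y, W B :=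
      Finset.sum_le_sum fun z hz => sum_le_exp_mul_sum_of_swap hW z y _ _ (hQ z hz)
        (hswap z hz y hy) (by rw [hcomm]; exact hswap y hy z hz)
    rw [Finset.sum_const, nsmul_eq_mul] at h2
    calc _ ≤ Real.exp (-Δ) * (F.card * (Real.exp Δ * ∑ B ∈ Q y, W B)) :=
          mul_le_mul_of_nonneg_left h2 (Real.exp_pos _).le
      _ = (Real.exp (-Δ) * Real.exp Δ) * (F.card * ∑ B ∈ Q y, W B) := by ring
      _ = _ := by rw [← Real.exp_add]; simp
  · rw [Finset.mul_sum (s := F), ← nsmul_eq_mul, ← Finset.sum_const]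
    exact Finset.sum_le_sum fun z hz => sum_le_exp_mul_sum_of_swap hW y z _ _ (hQ y hy)
      (hswap y hy z hz) (by rw [hcomm]; exact hswap z hz y hy)

lemma sum_insert_containing_bounds {b : ℕ} {W : Finset Y → ℝ} {Δ : ℝ}
    (hW : ∀ B : Finset Y, B.card = b → ∀ y z,
      W B ≤ Real.exp Δ * W (B.map (Equiv.swap y z).toEmbedding))
    {K₁ K₂ : Finset Y} (hd : Disjoint K₁ K₂) {y : Y} (hy₁ : y ∉ K₁) (hy₂ : y ∉ K₂) :
    Real.exp (-Δ) * ((b - K₁.card : ℕ) * ∑ B ∈ subsetsContainingAvoiding b K₁ K₂, W B)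
        ≤ (Fintype.card Y - (K₁.card + K₂.card) : ℕ)
          * ∑ B ∈ subsetsContainingAvoiding b (insert y K₁) K₂, W B ∧
      (Fintype.card Y - (K₁.card + K₂.card) : ℕ)
          * ∑ B ∈ subsetsContainingAvoiding b (insert y K₁) K₂, W B
        ≤ Real.exp Δ * ((b - K₁.card : ℕ) * ∑ B ∈ subsetsContainingAvoiding b K₁ K₂, W B) := by
  have hF : ((K₁ ∪ K₂)ᶜ).card = Fintype.card Y - (K₁.card + K₂.card) := by
    rw [Finset.card_compl, Finset.card_union_of_disjoint hd]
  rw [← hF]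
  refine card_mul_sum_bounds hW _ (fun y => subsetsContainingAvoiding b (insert y K₁) K₂) _
    ?_ ?_ ?_ ?_ (by simp [hy₁, hy₂])
  · exact fun y _ B hB => (mem_subsetsContainingAvoiding.1 hB).1
  · intro y hy z hz B hB
    simp only [Finset.mem_compl, Finset.mem_union, not_or] at hy hz
    rw [mem_subsetsContainingAvoiding] at hB ⊢
    obtain ⟨h1, h2, h3⟩ := hB
    refine ⟨by simpa using h1, ?_, ?_⟩
    · intro a ha
      rw [Finset.mem_map_equiv, Equiv.symm_swap]
      rcases Finset.mem_insert.1 ha with rfl | ha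
      · rw [Equiv.swap_apply_right]; exact h2 (Finset.mem_insert_self _ _)
      · rw [swap_apply_eq_self_of_notMem hy.1 hz.1 ha]
        exact h2 (Finset.mem_insert_of_mem ha)
    · rw [Finset.disjoint_left] at h3 ⊢
      intro a ha
      rw [Finset.mem_map_equiv, Equiv.symm_swap, swap_apply_eq_self_of_notMem hy.2 hz.2 ha]
      exact h3 ha
  · intro y _ B hB
    rw [mem_subsetsContainingAvoiding] at hB ⊢
    exact ⟨hB.1, (Finset.subset_insert _ _).trans hB.2.1, hB.2.2⟩
  · intro B hB
    obtain ⟨h1, h2, h3⟩ := mem_subsetsContainingAvoiding.1 hB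
    rw [← h1, ← Finset.card_sdiff_of_subset h2]
    congr 1
    ext z
    simp only [Finset.mem_filter, Finset.mem_compl, Finset.mem_union, Finset.mem_sdiff,
      mem_subsetsContainingAvoiding, Finset.insert_subset_iff, not_or]
    rw [Finset.disjoint_left] at h3
    constructor
    · rintro ⟨⟨a, _⟩, _, ⟨b, _⟩, _⟩; exact ⟨b, a⟩
    · rintro ⟨a, b⟩
      exact ⟨⟨b, fun h => h3 h a⟩, trivial, ⟨a, h2⟩, Finset.disjoint_left.2 h3⟩

lemma sum_insert_avoiding_bounds {b : ℕ} {W : Finset Y → ℝ} {Δ : ℝ}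
    (hW : ∀ B : Finset Y, B.card = b → ∀ y z,
      W B ≤ Real.exp Δ * W (B.map (Equiv.swap y z).toEmbedding))
    {K₁ K₂ : Finset Y} (hd : Disjoint K₁ K₂) {y : Y} (hy₁ : y ∉ K₁) (hy₂ : y ∉ K₂) :
    Real.exp (-Δ) * ((Fintype.card Y - b - K₂.card : ℕ)
          * ∑ B ∈ subsetsContainingAvoiding b K₁ K₂, W B)
        ≤ (Fintype.card Y - (K₁.card + K₂.card) : ℕ)
          * ∑ B ∈ subsetsContainingAvoiding b K₁ (insert y K₂), W B ∧
      (Fintype.card Y - (K₁.card + K₂.card) : ℕ)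
          * ∑ B ∈ subsetsContainingAvoiding b K₁ (insert y K₂), W B
        ≤ Real.exp Δ * ((Fintype.card Y - b - K₂.card : ℕ)
          * ∑ B ∈ subsetsContainingAvoiding b K₁ K₂, W B) := by
  have hF : ((K₁ ∪ K₂)ᶜ).card = Fintype.card Y - (K₁.card + K₂.card) := by
    rw [Finset.card_compl, Finset.card_union_of_disjoint hd]
  rw [← hF]
  refine card_mul_sum_bounds hW _ (fun y => subsetsContainingAvoiding b K₁ (insert y K₂)) _
    ?_ ?_ ?_ ?_ (by simp [hy₁, hy₂])
  · exact fun y _ B hB => (mem_subsetsContainingAvoiding.1 hB).1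
  · intro y hy z hz B hB
    simp only [Finset.mem_compl, Finset.mem_union, not_or] at hy hz
    rw [mem_subsetsContainingAvoiding] at hB ⊢
    obtain ⟨h1, h2, h3⟩ := hB
    refine ⟨by simpa using h1, ?_, ?_⟩
    · intro a ha
      rw [Finset.mem_map_equiv, Equiv.symm_swap, swap_apply_eq_self_of_notMem hy.1 hz.1 ha]
      exact h2 ha
    · rw [Finset.disjoint_left] at h3 ⊢
      intro a ha
      rw [Finset.mem_map_equiv, Equiv.symm_swap]
      rcases Finset.mem_insert.1 ha with rfl | ha
      · rw [Equiv.swap_apply_right]; exact h3 (Finset.mem_insert_self _ _)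
      · rw [swap_apply_eq_self_of_notMem hy.2 hz.2 ha]
        exact h3 (Finset.mem_insert_of_mem ha)
  · intro y _ B hB
    rw [mem_subsetsContainingAvoiding] at hB ⊢
    exact ⟨hB.1, hB.2.1, hB.2.2.mono_left (Finset.subset_insert _ _)⟩
  · intro B hB
    obtain ⟨h1, h2, h3⟩ := mem_subsetsContainingAvoiding.1 hB
    have hsub : K₂ ⊆ Bᶜ := fun a ha => Finset.mem_compl.2 (Finset.disjoint_left.1 h3 ha)
    rw [← h1, ← Finset.card_compl, ← Finset.card_sdiff_of_subset hsub]
    congr 1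
    ext z
    simp only [Finset.mem_filter, Finset.mem_compl, Finset.mem_union, Finset.mem_sdiff,
      mem_subsetsContainingAvoiding, Finset.disjoint_insert_left, not_or]
    constructor
    · rintro ⟨⟨_, a⟩, _, _, b, _⟩; exact ⟨b, a⟩
    · rintro ⟨a, b⟩
      exact ⟨⟨fun h => a (h2 h), b⟩, trivial, h2, a, h3⟩

lemma descFactorial_mul_sum_bounds {b : ℕ} {W : Finset Y → ℝ} {Δ : ℝ}
    (hW : ∀ B : Finset Y, B.card = b → ∀ y z,
      W B ≤ Real.exp Δ * W (B.map (Equiv.swap y z).toEmbedding))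
    (K₁ K₂ : Finset Y) (hd : Disjoint K₁ K₂) :
    Real.exp (-((K₁.card + K₂.card : ℕ) * Δ)) * (b.descFactorial K₁.card
        * (Fintype.card Y - b).descFactorial K₂.card * ∑ B ∈ subsetsContainingAvoiding b ∅ ∅, W B)
      ≤ (Fintype.card Y).descFactorial (K₁.card + K₂.card)
        * ∑ B ∈ subsetsContainingAvoiding b K₁ K₂, W B ∧
    (Fintype.card Y).descFactorial (K₁.card + K₂.card)
        * ∑ B ∈ subsetsContainingAvoiding b K₁ K₂, W B
      ≤ Real.exp ((K₁.card + K₂.card : ℕ) * Δ) * (b.descFactorial K₁.card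
        * (Fintype.card Y - b).descFactorial K₂.card
        * ∑ B ∈ subsetsContainingAvoiding b ∅ ∅, W B) := by
  induction K₂ using Finset.induction_on with
  | empty =>
    clear hd
    induction K₁ using Finset.induction_on with
    | empty => simp
    | insert y K hy ih =>
      obtain ⟨h1, h2⟩ := ih
      obtain ⟨h3, h4⟩ := sum_insert_containing_bounds hW (Finset.disjoint_empty_right K) hy
        (Finset.notMem_empty y)
      simp only [Finset.card_insert_of_notMem hy, Finset.card_empty, add_zero,
        Nat.descFactorial_succ, Nat.descFactorial_zero, Nat.cast_mul, Nat.cast_one, mul_one,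
        Nat.cast_add] at h1 h2 h3 h4 ⊢
      have e1 : ((K.card : ℝ) + 1) * Δ = Δ + K.card * Δ := by ring
      rw [e1, neg_add, Real.exp_add, Real.exp_add]
      constructor
      · have := mul_le_mul_of_nonneg_left h1
          (mul_nonneg (Real.exp_pos (-Δ)).le (Nat.cast_nonneg (α := ℝ) (b - K.card)))
        have h5 := mul_le_mul_of_nonneg_left h3
          (Nat.cast_nonneg (α := ℝ) ((Fintype.card Y).descFactorial K.card))
        linarith
      · have := mul_le_mul_of_nonneg_left h2
          (mul_nonneg (Real.exp_pos Δ).le (Nat.cast_nonneg (α := ℝ) (b - K.card)))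
        have h5 := mul_le_mul_of_nonneg_left h4
          (Nat.cast_nonneg (α := ℝ) ((Fintype.card Y).descFactorial K.card))
        linarith
  | insert y K hy ih =>
    rw [Finset.disjoint_insert_right] at hd
    obtain ⟨h1, h2⟩ := ih hd.2
    obtain ⟨h3, h4⟩ := sum_insert_avoiding_bounds hW hd.2 hd.1 hy
    simp only [Finset.card_insert_of_notMem hy, ← add_assoc,
      Nat.descFactorial_succ, Nat.cast_mul, Nat.cast_one,
      Nat.cast_add] at h1 h2 h3 h4 ⊢
    have e1 : ((K₁.card : ℝ) + K.card + 1) * Δ = Δ + (K₁.card + K.card) * Δ := by ring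
    rw [e1, neg_add, Real.exp_add, Real.exp_add]
    constructor
    · have := mul_le_mul_of_nonneg_left h1
        (mul_nonneg (Real.exp_pos (-Δ)).le (Nat.cast_nonneg (α := ℝ) (Fintype.card Y - b - K.card)))
      have h5 := mul_le_mul_of_nonneg_left h3
        (Nat.cast_nonneg (α := ℝ) ((Fintype.card Y).descFactorial (K₁.card + K.card)))
      linarith
    · have := mul_le_mul_of_nonneg_left h2
        (mul_nonneg (Real.exp_pos Δ).le (Nat.cast_nonneg (α := ℝ) (Fintype.card Y - b - K.card)))
      have h5 := mul_le_mul_of_nonneg_left h4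
        (Nat.cast_nonneg (α := ℝ) ((Fintype.card Y).descFactorial (K₁.card + K.card)))
      linarith

/-- The mean of `exp (-F)` over the `b`-subsets of `Y`, where `F` is a combination of indicators of
containing and avoiding small sets and `F` changes little under transpositions. -/
lemma exists_sum_powersetCard_exp_neg_eq (c : ℝ) : ∃ C : ℝ, 0 < C ∧
    ∀ {ι Y : Type} [Fintype ι] [Fintype Y] (b : ℕ) (K₁ K₂ : ι → Finset Y) (τ : ι → ℝ) (Δ : ℝ),
      b ≤ Fintype.card Y →
      (∀ i, Disjoint (K₁ i) (K₂ i)) → (∀ i, (K₁ i).card + (K₂ i).card ≤ 4) →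
      (∀ i, 0 ≤ τ i) → (∀ i, τ i ≤ 1 / 2) → (∀ i, τ i ≤ Δ) → 0 ≤ Δ → Δ ≤ c →
      (∀ (B : Finset Y) (y : Y), B.card = b →
        ∑ i, (if (K₁ i ⊆ B ∧ Disjoint (K₂ i) B) ∧ y ∈ K₁ i ∪ K₂ i then τ i else 0) ≤ Δ) →
      ∃ E : ℝ, |E| ≤ C * Δ * ∑ i, τ i * (b.descFactorial (K₁ i).card
            * (Fintype.card Y - b).descFactorial (K₂ i).card
            / (Fintype.card Y).descFactorial ((K₁ i).card + (K₂ i).card)) ∧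
        ∑ B ∈ Finset.powersetCard b (Finset.univ : Finset Y),
            Real.exp (-∑ i, if K₁ i ⊆ B ∧ Disjoint (K₂ i) B then τ i else 0)
          = (Fintype.card Y).choose b * Real.exp (-∑ i, τ i * (b.descFactorial (K₁ i).card
            * (Fintype.card Y - b).descFactorial (K₂ i).card
            / (Fintype.card Y).descFactorial ((K₁ i).card + (K₂ i).card)) + E) := by
  obtain ⟨C, hC, h⟩ := exists_sum_exp_neg_eq (8 * c)
  refine ⟨8 * C, by positivity, ?_⟩
  intro ι Y _ _ b K₁ K₂ τ Δ hb hd h4 hτ0 hτ2 hτΔ hΔ0 hΔc hloc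
  have hle : ∀ i, (K₁ i).card + (K₂ i).card ≤ Fintype.card Y := fun i => by
    rw [← Finset.card_union_of_disjoint (hd i)]; exact Finset.card_le_univ _
  have hD : ∀ i, (0 : ℝ) < (Fintype.card Y).descFactorial ((K₁ i).card + (K₂ i).card) :=
    fun i => by
      exact_mod_cast Nat.pos_of_ne_zero (fun h0 =>
        absurd (Nat.descFactorial_eq_zero_iff_lt.1 h0) (not_lt.2 (hle i)))
  have hp1 : ∀ i, (b.descFactorial (K₁ i).card : ℝ)
      * (Fintype.card Y - b).descFactorial (K₂ i).card
      / (Fintype.card Y).descFactorial ((K₁ i).card + (K₂ i).card) ≤ 1 := by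
    intro i
    rw [div_le_one (hD i)]
    have hW := (descFactorial_mul_sum_bounds (b := b) (W := fun _ => 1) (Δ := 0)
      (by simp) (K₁ i) (K₂ i) (hd i)).1
    simp only [mul_zero, neg_zero, Real.exp_zero, one_mul, Finset.sum_const, nsmul_eq_mul,
      mul_one] at hW
    have hpos : (0 : ℝ) < (subsetsContainingAvoiding b (∅ : Finset Y) ∅).card := by
      simp only [subsetsContainingAvoiding, Finset.empty_subset, Finset.disjoint_empty_left,
        and_self, Finset.filter_true, Finset.card_powersetCard, Finset.card_univ]
      exact_mod_cast Nat.choose_pos hb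
    have hsub : ((subsetsContainingAvoiding b (K₁ i) (K₂ i)).card : ℝ)
        ≤ (subsetsContainingAvoiding b (∅ : Finset Y) ∅).card := by
      refine Nat.cast_le.2 (Finset.card_le_card fun B hB => ?_)
      rw [mem_subsetsContainingAvoiding] at hB ⊢
      simp [hB.1]
    refine le_of_mul_le_mul_right (hW.trans ?_) hpos
    exact mul_le_mul_of_nonneg_left hsub (hD i).le
  obtain ⟨E, hE, hsum⟩ := h (Finset.powersetCard b (Finset.univ : Finset Y))
    (fun i B => K₁ i ⊆ B ∧ Disjoint (K₂ i) B) τ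
    (fun i => b.descFactorial (K₁ i).card * (Fintype.card Y - b).descFactorial (K₂ i).card
            / (Fintype.card Y).descFactorial ((K₁ i).card + (K₂ i).card)) (8 * Δ)
    hτ0 hτ2 (fun i => (hτΔ i).trans (by linarith)) (fun i => by positivity) hp1
    (by positivity) (by linarith) (by
      intro I i
      set W : Finset Y → ℝ := fun B =>
        Real.exp (-∑ k ∈ I, if K₁ k ⊆ B ∧ Disjoint (K₂ k) B then τ k else 0) with hWdef
      have hW : ∀ B : Finset Y, B.card = b → ∀ y z,
          W B ≤ Real.exp (2 * Δ) * W (B.map (Equiv.swap y z).toEmbedding) := by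
        intro B hB y z
        rw [hWdef]
        dsimp only
        rw [← Real.exp_add, Real.exp_le_exp]
        set B' := B.map (Equiv.swap y z).toEmbedding with hB'
        have hBc : B'.card = b := by simp [hB', hB]
        have key : ∑ k ∈ I, (if K₁ k ⊆ B' ∧ Disjoint (K₂ k) B' then τ k else 0)
            ≤ ∑ k ∈ I, (if K₁ k ⊆ B ∧ Disjoint (K₂ k) B then τ k else 0)
              + (∑ k, (if (K₁ k ⊆ B' ∧ Disjoint (K₂ k) B') ∧ y ∈ K₁ k ∪ K₂ k then τ k else 0)
              + ∑ k, (if (K₁ k ⊆ B' ∧ Disjoint (K₂ k) B') ∧ z ∈ K₁ k ∪ K₂ k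
                then τ k else 0)) := by
          refine le_trans ?_ (add_le_add_right (add_le_add
            (Finset.sum_le_sum_of_subset_of_nonneg (Finset.subset_univ I) fun k _ _ => ?_)
            (Finset.sum_le_sum_of_subset_of_nonneg (Finset.subset_univ I) fun k _ _ => ?_)) _)
          · rw [← Finset.sum_add_distrib, ← Finset.sum_add_distrib]
            refine Finset.sum_le_sum fun k _ => ?_
            have := hτ0 k
            by_cases hA : K₁ k ⊆ B' ∧ Disjoint (K₂ k) B'
            · by_cases hy : y ∈ K₁ k ∪ K₂ k
              · rw [if_pos hA, if_pos (⟨hA, hy⟩ :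
                  (K₁ k ⊆ B' ∧ Disjoint (K₂ k) B') ∧ y ∈ K₁ k ∪ K₂ k)]
                split_ifs <;> linarith
              · by_cases hz : z ∈ K₁ k ∪ K₂ k
                · rw [if_pos hA, if_pos (⟨hA, hz⟩ :
                    (K₁ k ⊆ B' ∧ Disjoint (K₂ k) B') ∧ z ∈ K₁ k ∪ K₂ k)]
                  split_ifs <;> linarith
                · have hAB : K₁ k ⊆ B ∧ Disjoint (K₂ k) B := by
                    simp only [Finset.mem_union, not_or] at hy hz
                    constructor
                    · intro a ha
                      have h1 := hA.1 ha
                      rwa [hB', Finset.mem_map_equiv, Equiv.symm_swap,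
                        swap_apply_eq_self_of_notMem hy.1 hz.1 ha] at h1
                    · rw [Finset.disjoint_left]
                      intro a ha haB
                      refine Finset.disjoint_left.1 hA.2 ha ?_
                      rwa [hB', Finset.mem_map_equiv, Equiv.symm_swap,
                        swap_apply_eq_self_of_notMem hy.2 hz.2 ha]
                  rw [if_pos hA, if_pos hAB]
                  split_ifs <;> linarith
            · rw [if_neg hA]
              split_ifs <;> linarith
          · have := hτ0 k
            split_ifs <;> linarith
          · have := hτ0 k
            split_ifs <;> linarith
        have h1 := hloc B' y hBc
        have h2 := hloc B' z hBc
        linarith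
      have hmain := descFactorial_mul_sum_bounds (b := b) hW (K₁ i) (K₂ i) (hd i)
      have e0 : subsetsContainingAvoiding b (∅ : Finset Y) ∅ = Finset.powersetCard b Finset.univ := by
        simp [subsetsContainingAvoiding]
      rw [e0] at hmain
      obtain ⟨h1, h2⟩ := hmain
      have hS : 0 ≤ ∑ B ∈ Finset.powersetCard b (Finset.univ : Finset Y), W B :=
        Finset.sum_nonneg fun _ _ => (Real.exp_pos _).le
      have hk : (((K₁ i).card + (K₂ i).card : ℕ) : ℝ) * (2 * Δ) ≤ 8 * Δ := by
        have : (((K₁ i).card + (K₂ i).card : ℕ) : ℝ) ≤ 4 := by exact_mod_cast h4 i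
        nlinarith
      have hnn : 0 ≤ (b.descFactorial (K₁ i).card : ℝ)
        * (Fintype.card Y - b).descFactorial (K₂ i).card
          * ∑ B ∈ Finset.powersetCard b (Finset.univ : Finset Y), W B := by positivity
      have hq : (b.descFactorial (K₁ i).card : ℝ)
          * (Fintype.card Y - b).descFactorial (K₂ i).card
          / (Fintype.card Y).descFactorial ((K₁ i).card + (K₂ i).card)
          * ∑ B ∈ Finset.powersetCard b (Finset.univ : Finset Y), W B
          = (b.descFactorial (K₁ i).card : ℝ)
          * (Fintype.card Y - b).descFactorial (K₂ i).card
          * (∑ B ∈ Finset.powersetCard b (Finset.univ : Finset Y), W B)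
          / (Fintype.card Y).descFactorial ((K₁ i).card + (K₂ i).card) := by ring
      change Real.exp (-(8 * Δ)) * (_ * ∑ B ∈ Finset.powersetCard b (Finset.univ : Finset Y), W B)
          ≤ ∑ B ∈ subsetsContainingAvoiding b (K₁ i) (K₂ i), W B ∧
        ∑ B ∈ subsetsContainingAvoiding b (K₁ i) (K₂ i), W B ≤ Real.exp (8 * Δ) *
          (_ * ∑ B ∈ Finset.powersetCard b (Finset.univ : Finset Y), W B)
      constructor
      · rw [hq, ← mul_div_assoc, div_le_iff₀ (hD i), mul_comm (∑ B ∈ _, _)]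
        refine le_trans (mul_le_mul_of_nonneg_right (Real.exp_le_exp.2 ?_) hnn) h1
        linarith
      · rw [hq, ← mul_div_assoc, le_div_iff₀ (hD i), mul_comm (∑ B ∈ _, _)]
        exact h2.trans (mul_le_mul_of_nonneg_right (Real.exp_le_exp.2 hk) hnn))
  refine ⟨E, hE.trans (le_of_eq (by ring)), ?_⟩
  rw [hsum, Finset.card_powersetCard, Finset.card_univ]

end SubsetExchange

section Pairings

open Equiv

/-- Conjugation by a transposition: it replaces the pairs `a - b` and `r - s` of a pairing by
`a - r` and `b - s`. -/
def switching {P : Type} [DecidableEq P] (σ : Perm P) (b r : P) : Perm P :=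
  swap b r * σ * swap b r

lemma switching_apply {P : Type} (σ : Perm P) (b r x : P) :
    switching σ b r x = swap b r (σ (swap b r x)) := rfl

lemma switching_switching {P : Type} (σ : Perm P) (b r : P) :
    switching (switching σ b r) b r = σ := by
  ext x; simp [switching_apply]

/-- A symmetric family of forbidden pairs and forbidden double pairs: a forbidden pair is a loop
or runs along an edge of `X`, a forbidden double pair joins twice the same two cells, and double
pairs are forbidden only when all loops are. -/
structure Forbidden {P V : Type} (v : P → V) (X : SimpleGraph V) where
  /-- The forbidden pairs. -/
  pair : P → P → Prop
  /-- The forbidden double pairs. -/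
  quad : P → P → P → P → Prop
  pair_symm : ∀ p q, pair p q → pair q p
  pair_spec : ∀ p q, pair p q → v p = v q ∨ X.Adj (v p) (v q)
  quad_swap : ∀ p q p' q', quad p q p' q' → quad q p q' p'
  quad_comm : ∀ p q p' q', quad p q p' q' → quad p' q' p q
  quad_spec : ∀ p q p' q', quad p q p' q' →
    p ≠ p' ∧ q ≠ q' ∧ v p = v p' ∧ v q = v q' ∧ v p ≠ v q
  loops : (∀ p q p' q', ¬ quad p q p' q') ∨ ∀ p q, p ≠ q → v p = v q → pair p q

namespace Forbidden

variable {P V : Type} {v : P → V} {X : SimpleGraph V} (F : Forbidden v X)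

/-- The fixed-point-free involutions that contain no forbidden pair or double pair. -/
def Avoid (σ : Perm P) : Prop :=
  (∀ p, σ (σ p) = p) ∧ (∀ p, σ p ≠ p) ∧ (∀ p, ¬ F.pair p (σ p)) ∧
    ∀ p p', ¬ F.quad p (σ p) p' (σ p')

variable {F}

/-- The values of a switched pairing. -/
lemma switching_values {σ : Perm P} (h : F.Avoid σ) {a b r s : P} (hab : σ a = b)
    (hrs : σ r = s) (hra : r ≠ a) (hrb : r ≠ b) :
    switching σ b r a = r ∧ switching σ b r b = s ∧ switching σ b r r = a ∧
      switching σ b r s = b ∧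
      ∀ p, p ≠ a → p ≠ b → p ≠ r → p ≠ s → switching σ b r p = σ p := by
  obtain ⟨h1, h2, -, -⟩ := h
  have hinv : ∀ p, switching σ b r (switching σ b r p) = p := by
    intro p; simp [switching_apply, h1]
  have ha : switching σ b r a = r := by
    have : a ≠ b := by rw [← hab]; exact (h2 a).symm
    rw [switching_apply, swap_apply_of_ne_of_ne this hra.symm, hab, swap_apply_left]
  have hb : switching σ b r b = s := by
    have h5 : s ≠ b := by rintro rfl; exact hra (σ.injective (hrs.trans hab.symm))
    have h6 : s ≠ r := by rw [← hrs]; exact h2 r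
    rw [switching_apply, swap_apply_left, hrs, swap_apply_of_ne_of_ne h5 h6]
  refine ⟨ha, hb, by simpa only [ha] using hinv a, by simpa only [hb] using hinv b, ?_⟩
  intro p pa pb pr ps
  have h5 : σ p ≠ b := by rintro h; exact pa (σ.injective (h.trans hab.symm))
  have h6 : σ p ≠ r := by rintro h; apply ps; rw [← hrs, ← h, h1]
  rw [switching_apply, swap_apply_of_ne_of_ne pb pr, swap_apply_of_ne_of_ne h5 h6]

lemma exists_of_not_avoid_switching {σ : Perm P} (h : F.Avoid σ) {a b r s : P} (hab : σ a = b)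
    (hrs : σ r = s) (hra : r ≠ a) (hrb : r ≠ b) (hn : ¬ F.Avoid (switching σ b r)) :
    (F.pair a r ∨ ∃ c, F.quad a r c (switching σ b r c)) ∨
      F.pair b s ∨ ∃ c, F.quad b s c (switching σ b r c) := by
  obtain ⟨ha, hb, hr, hs, hoth⟩ := switching_values h hab hrs hra hrb
  obtain ⟨h1, h2, h3, h4⟩ := h
  have hinv : ∀ p, switching σ b r (switching σ b r p) = p := by
    intro p; simp [switching_apply, h1]
  have hfix : ∀ p, switching σ b r p ≠ p := by
    intro p hp
    apply h2 (swap b r p)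
    have := congrArg (swap b r) hp
    simpa [switching_apply] using this
  have hfirst : ∀ p p', F.quad p (switching σ b r p) p' (switching σ b r p') →
      (p = a ∨ p = b ∨ p = r ∨ p = s) → (∃ c, F.quad a r c (switching σ b r c)) ∨
        ∃ c, F.quad b s c (switching σ b r c) := by
    rintro p p' hq (rfl | rfl | rfl | rfl)
    · rw [ha] at hq; exact Or.inl ⟨p', hq⟩
    · rw [hb] at hq; exact Or.inr ⟨p', hq⟩
    · rw [hr] at hq
      refine Or.inl ⟨switching σ b p p', ?_⟩
      rw [hinv]; exact F.quad_swap _ _ _ _ hq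
    · rw [hs] at hq
      refine Or.inr ⟨switching σ b r p', ?_⟩
      rw [hinv]; exact F.quad_swap _ _ _ _ hq
  by_cases hp : ∃ p, F.pair p (switching σ b r p)
  · obtain ⟨p, hp⟩ := hp
    by_cases c1 : p = a
    · rw [c1, ha] at hp; exact Or.inl (Or.inl hp)
    by_cases c2 : p = b
    · rw [c2, hb] at hp; exact Or.inr (Or.inl hp)
    by_cases c3 : p = r
    · rw [c3, hr] at hp; exact Or.inl (Or.inl (F.pair_symm _ _ hp))
    by_cases c4 : p = s
    · rw [c4, hs] at hp; exact Or.inr (Or.inl (F.pair_symm _ _ hp))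
    rw [hoth p c1 c2 c3 c4] at hp
    exact absurd hp (h3 p)
  · have : ∃ p p', F.quad p (switching σ b r p) p' (switching σ b r p') := by
      by_contra hq
      push Not at hq hp
      exact hn ⟨hinv, hfix, hp, hq⟩
    obtain ⟨p, p', hq⟩ := this
    suffices (∃ c, F.quad a r c (switching σ b r c)) ∨
        ∃ c, F.quad b s c (switching σ b r c) by tauto
    by_cases c1 : p = a ∨ p = b ∨ p = r ∨ p = s
    · exact hfirst p p' hq c1
    by_cases c2 : p' = a ∨ p' = b ∨ p' = r ∨ p' = s
    · exact hfirst p' p (F.quad_comm _ _ _ _ hq) c2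
    push Not at c1 c2
    rw [hoth p c1.1 c1.2.1 c1.2.2.1 c1.2.2.2, hoth p' c2.1 c2.2.1 c2.2.2.1 c2.2.2.2] at hq
    exact absurd hq (h4 p p')

variable (v X) in
/-- The points that `c` cannot be joined to without creating a loop, an edge of `X` or a double
edge. -/
def Blocked (σ : Perm P) (c y : P) : Prop :=
  v c = v y ∨ X.Adj (v c) (v y) ∨ ∃ c', v c' = v c ∧ v (σ c') = v y

lemma blocked_of_not_avoid_switching {σ : Perm P} (h : F.Avoid σ) {a b r s : P} (hab : σ a = b)
    (hrs : σ r = s) (hra : r ≠ a) (hrb : r ≠ b) (hn : ¬ F.Avoid (switching σ b r)) :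
    Blocked v X σ a r ∨ Blocked v X σ b s := by
  have hex := exists_of_not_avoid_switching h hab hrs hra hrb hn
  obtain ⟨ha, hb, hr, hs, hoth⟩ := switching_values h hab hrs hra hrb
  obtain ⟨h1, h2, h3, h4⟩ := h
  have hba : σ b = a := by rw [← hab, h1]
  have hnoloop : ∀ p q p' q', F.quad p q p' q' → v a ≠ v b := by
    intro p q p' q' hq hab'
    rcases F.loops with h5 | h5
    · exact h5 _ _ _ _ hq
    · exact h3 a (by rw [hab]; exact h5 a b (by rw [← hab]; exact (h2 a).symm) hab')
  rcases hex with (h5 | ⟨c, h5⟩) | (h5 | ⟨c, h5⟩)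
  · left; have := F.pair_spec _ _ h5; unfold Blocked; tauto
  · left
    have hl := hnoloop _ _ _ _ h5
    obtain ⟨e1, e2, e3, e4, e5⟩ := F.quad_spec _ _ _ _ h5
    right; right
    by_cases c2 : c = b
    · subst c2; exact absurd e3 hl
    by_cases c3 : c = r
    · subst c3; exact absurd e3 e5
    by_cases c4 : c = s
    · subst c4; rw [hs] at e4; exact ⟨a, rfl, by rw [hab, e4]⟩
    rw [hoth c (Ne.symm e1) c2 c3 c4] at e4
    exact ⟨c, e3.symm, e4.symm⟩
  · right; have := F.pair_spec _ _ h5; unfold Blocked; tauto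
  · right
    have hl := hnoloop _ _ _ _ h5
    obtain ⟨e1, e2, e3, e4, e5⟩ := F.quad_spec _ _ _ _ h5
    right; right
    by_cases c2 : c = a
    · subst c2; exact absurd e3.symm hl
    by_cases c4 : c = s
    · subst c4; exact absurd e3 e5
    by_cases c3 : c = r
    · subst c3; rw [hr] at e4; exact ⟨b, rfl, by rw [hba, e4]⟩
    rw [hoth c c2 (Ne.symm e1) c3 c4] at e4
    exact ⟨c, e3.symm, e4.symm⟩

variable [Fintype P]

lemma card_blocked_le [Fintype V] {D : ℕ}
    (hD : ∀ u, (Finset.univ.filter fun p => v p = u).card + X.degree u ≤ D) (σ : Perm P) (c : P) :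
    (Finset.univ.filter fun y => Blocked v X σ c y).card ≤ D * (D + 1) := by
  have hfib : ∀ u, (Finset.univ.filter fun p => v p = u).card ≤ D := fun u =>
    (Nat.le_add_right _ _).trans (hD u)
  have hsub : (Finset.univ.filter fun y => Blocked v X σ c y) ⊆
      (Finset.univ.filter fun p => v p = v c) ∪
        ((X.neighborFinset (v c)).biUnion (fun u => Finset.univ.filter fun p => v p = u) ∪
        (Finset.univ.filter fun p => v p = v c).biUnion
          (fun c' => Finset.univ.filter fun p => v p = v (σ c'))) := by
    intro y hy
    have hy := (Finset.mem_filter.1 hy).2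
    simp only [Finset.mem_union, Finset.mem_biUnion, Finset.mem_filter, Finset.mem_univ, true_and,
      SimpleGraph.mem_neighborFinset]
    rcases hy with h | h | ⟨c', h1, h2⟩
    · exact Or.inl h.symm
    · exact Or.inr (Or.inl ⟨_, h, rfl⟩)
    · exact Or.inr (Or.inr ⟨c', h1, h2.symm⟩)
  refine (Finset.card_le_card hsub).trans ((Finset.card_union_le _ _).trans ?_)
  have h1 := Finset.card_biUnion_le_card_mul (X.neighborFinset (v c))
    (fun u => Finset.univ.filter fun p => v p = u) D (fun u _ => hfib u)
  have h2 := Finset.card_biUnion_le_card_mul (Finset.univ.filter fun p => v p = v c)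
    (fun c' => Finset.univ.filter fun p => v p = v (σ c')) D (fun u _ => hfib _)
  have h3 := hfib (v c)
  have h4 := hD (v c)
  have h5 := Finset.card_union_le
    ((X.neighborFinset (v c)).biUnion (fun u => Finset.univ.filter fun p => v p = u))
    ((Finset.univ.filter fun p => v p = v c).biUnion
          (fun c' => Finset.univ.filter fun p => v p = v (σ c')))
  rw [SimpleGraph.card_neighborFinset_eq_degree] at h1
  nlinarith

variable (F) in
/-- The avoiding pairings that contain the pairs in `K`. -/
noncomputable def avoiding (K : List (P × P)) : Finset (Perm P) :=
  Finset.univ.filter fun σ => F.Avoid σ ∧ ∀ e ∈ K, σ e.1 = e.2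

lemma mem_avoiding {K : List (P × P)} {σ : Perm P} :
    σ ∈ F.avoiding K ↔ F.Avoid σ ∧ ∀ e ∈ K, σ e.1 = e.2 := by
  simp [avoiding]

/-- The points covered by the pairs in `K`. -/
def Covered (K : List (P × P)) (a : P) : Prop := ∃ e ∈ K, a = e.1 ∨ a = e.2

lemma card_covered_le (K : List (P × P)) :
    (Finset.univ.filter fun a => Covered K a).card ≤ 2 * K.length := by
  induction K with
  | nil => simp [Covered]
  | cons e K ih =>
    have : (Finset.univ.filter fun a => Covered (e :: K) a) ⊆
        insert e.1 (insert e.2 (Finset.univ.filter fun a => Covered K a)) := by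
      intro a
      simp only [Finset.mem_filter, Finset.mem_univ, true_and, Finset.mem_insert]
      rintro ⟨e', he', h'⟩
      rcases List.mem_cons.1 he' with rfl | h
      · tauto
      · right; right; exact ⟨e', h, h'⟩
    have h1 := Finset.card_le_card this
    have h2 := Finset.card_insert_le e.1 (insert e.2 (Finset.univ.filter fun a => Covered K a))
    have h3 := Finset.card_insert_le e.2 (Finset.univ.filter fun a => Covered K a)
    simp only [List.length_cons]
    omega

lemma switching_mem_avoiding {K : List (P × P)} {σ : Perm P} (h : σ ∈ F.avoiding K) {a b r s : P}
    (hab : σ a = b) (hrs : σ r = s) (hra : r ≠ a) (hrb : r ≠ b) (ha : ¬ Covered K a)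
    (hr : ¬ Covered K r) (hn : F.Avoid (switching σ b r)) : switching σ b r ∈ F.avoiding K := by
  rw [mem_avoiding] at h ⊢
  refine ⟨hn, fun e he => ?_⟩
  have h1 := h.1.1
  have heval := h.2 e he
  have key : ∀ x y, σ x = y → ¬ Covered K x → e.1 ≠ x ∧ e.1 ≠ y := by
    intro x y hxy hx
    constructor
    · rintro rfl; exact hx ⟨e, he, Or.inl rfl⟩
    · rintro rfl; apply hx; refine ⟨e, he, Or.inr ?_⟩; rw [← heval, ← hxy, h1]
  obtain ⟨e1, e2⟩ := key a b hab ha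
  obtain ⟨e3, e4⟩ := key r s hrs hr
  rw [(switching_values h.1 hab hrs hra hrb).2.2.2.2 _ e1 e2 e3 e4, heval]

/-- Switching away a prescribed pair. -/
lemma card_avoiding_cons_mul_le [Fintype V] {D : ℕ}
    (hD : ∀ u, (Finset.univ.filter fun p => v p = u).card + X.degree u ≤ D)
    {K : List (P × P)} {a b : P} (ha : ¬ Covered K a) :
    (F.avoiding ((a, b) :: K)).card * Fintype.card P ≤ (F.avoiding K).card +
      (F.avoiding ((a, b) :: K)).card * (2 + 2 * K.length + 2 * (D * (D + 1))) := by
  let good : Perm P → Finset P := fun σ => Finset.univ.filter fun r =>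
    r ≠ a ∧ r ≠ b ∧ ¬ Covered K r ∧ ¬ Blocked v X σ a r ∧ ¬ Blocked v X σ b (σ r)
  have hgood : ∀ σ, Fintype.card P ≤
      (good σ).card + (2 + 2 * K.length + 2 * (D * (D + 1))) := by
    intro σ
    have hsub : (Finset.univ : Finset P) ⊆ good σ ∪ ({a, b} ∪
        ((Finset.univ.filter fun a => Covered K a) ∪
        ((Finset.univ.filter fun y => Blocked v X σ a y) ∪
          (Finset.univ.filter fun y => Blocked v X σ b y).map σ.symm.toEmbedding))) := by
      intro r _
      simp only [good, Finset.mem_union, Finset.mem_filter, Finset.mem_univ, true_and,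
        Finset.mem_insert, Finset.mem_singleton, Finset.mem_map_equiv, Equiv.symm_symm]
      grind
    have h0 := Finset.card_le_card hsub
    have h1 := Finset.card_union_le (good σ) ({a, b} ∪
        ((Finset.univ.filter fun a => Covered K a) ∪
        ((Finset.univ.filter fun y => Blocked v X σ a y) ∪
          (Finset.univ.filter fun y => Blocked v X σ b y).map σ.symm.toEmbedding)))
    have h2 := Finset.card_union_le {a, b} 
        ((Finset.univ.filter fun a => Covered K a) ∪
        ((Finset.univ.filter fun y => Blocked v X σ a y) ∪
          (Finset.univ.filter fun y => Blocked v X σ b y).map σ.symm.toEmbedding))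
    have h3 := Finset.card_union_le (Finset.univ.filter fun a => Covered K a)
        ((Finset.univ.filter fun y => Blocked v X σ a y) ∪
          (Finset.univ.filter fun y => Blocked v X σ b y).map σ.symm.toEmbedding)
    have h4 := Finset.card_union_le (Finset.univ.filter fun y => Blocked v X σ a y)
          ((Finset.univ.filter fun y => Blocked v X σ b y).map σ.symm.toEmbedding)
    have h5 := card_blocked_le hD σ a
    have h6 := card_blocked_le hD σ b
    have h7 := card_covered_le K
    have h8 : ({a, b} : Finset P).card ≤ 2 := Finset.card_le_two
    rw [Finset.card_map] at h4
    rw [Finset.card_univ] at h0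
    omega
  have hsum : ∑ σ ∈ F.avoiding ((a, b) :: K), (good σ).card ≤ (F.avoiding K).card := by
    rw [← Finset.card_sigma]
    refine Finset.card_le_card_of_injOn (fun x => switching x.1 b x.2) ?_ ?_
    · rintro ⟨σ, r⟩ hx
      simp only [Finset.coe_sigma, Set.mem_sigma_iff, Finset.mem_coe, good, Finset.mem_filter,
        Finset.mem_univ, true_and, mem_avoiding, List.mem_cons, forall_eq_or_imp] at hx
      obtain ⟨⟨hσ, hab, hK⟩, hra, hrb, hrK, hB1, hB2⟩ := hx
      refine switching_mem_avoiding (mem_avoiding.2 ⟨hσ, hK⟩) hab rfl hra hrb ha hrK ?_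
      by_contra hn
      exact (blocked_of_not_avoid_switching hσ hab rfl hra hrb hn).elim hB1 hB2
    · rintro ⟨σ, r⟩ hx ⟨σ', r'⟩ hx' hE
      simp only [Finset.coe_sigma, Set.mem_sigma_iff, Finset.mem_coe, good, Finset.mem_filter,
        Finset.mem_univ, true_and, mem_avoiding, List.mem_cons, forall_eq_or_imp] at hx hx' hE
      obtain ⟨⟨hσ, hab, hK⟩, hra, hrb, hrK, hB1, hB2⟩ := hx
      obtain ⟨⟨hσ', hab', hK'⟩, hra', hrb', hrK', hB1', hB2'⟩ := hx'
      have e1 := (switching_values hσ hab rfl hra hrb).1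
      have e2 := (switching_values hσ' hab' rfl hra' hrb').1
      have e3 : r = r' := by rw [← e1, hE, e2]
      subst e3
      have e4 : σ = σ' := by rw [← switching_switching σ b r, hE, switching_switching]
      rw [e4]
  calc (F.avoiding ((a, b) :: K)).card * Fintype.card P
      = ∑ σ ∈ F.avoiding ((a, b) :: K), Fintype.card P := by simp
    _ ≤ ∑ σ ∈ F.avoiding ((a, b) :: K),
        ((good σ).card + (2 + 2 * K.length + 2 * (D * (D + 1)))) :=
        Finset.sum_le_sum fun σ _ => hgood σ
    _ ≤ _ := by
      rw [Finset.sum_add_distrib]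
      simpa using hsum

end Forbidden
end Pairings

section PairingEstimates

open Equiv

lemma mul_card_biUnion_le {α β : Type} [DecidableEq β] (s : Finset α) (f : α → Finset β) {k B n : ℕ}
    (hs : s.card ≤ B) (hf : ∀ a ∈ s, k * (f a).card ≤ n) : k * (s.biUnion f).card ≤ B * n := by
  calc k * (s.biUnion f).card ≤ k * ∑ a ∈ s, (f a).card :=
        Nat.mul_le_mul_left _ Finset.card_biUnion_le
    _ = ∑ a ∈ s, k * (f a).card := Finset.mul_sum _ _ _
    _ ≤ ∑ a ∈ s, n := Finset.sum_le_sum hf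
    _ = s.card * n := by simp
    _ ≤ B * n := Nat.mul_le_mul_right _ hs

namespace Forbidden

variable {P V : Type} {v : P → V} {X : SimpleGraph V} {F : Forbidden v X} [Fintype P]

lemma card_avoiding_cons_mul_le_two_mul [Fintype V] {D : ℕ}
    (hD : ∀ u, (Finset.univ.filter fun p => v p = u).card + X.degree u ≤ D)
    (hD3 : 3 ≤ D) (hP : D ^ 4 + 2 ≤ Fintype.card P)
    {K : List (P × P)} (hK : K.length ≤ 3) {a b : P} (ha : ¬ Covered K a) :
    Fintype.card P * (F.avoiding ((a, b) :: K)).card ≤ 2 * (F.avoiding K).card := by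
  have h := card_avoiding_cons_mul_le (F := F) hD (b := b) ha
  set N := (F.avoiding ((a, b) :: K)).card
  have h1 : 2 * (2 + 2 * K.length + 2 * (D * (D + 1))) ≤ Fintype.card P := by
    have : 16 + 4 * (D * (D + 1)) ≤ D ^ 4 + 2 := by
      have : 9 * D ^ 2 ≤ D ^ 4 := by nlinarith [Nat.mul_le_mul hD3 hD3]
      nlinarith
    omega
  nlinarith

set_option maxHeartbeats 400000 in
/-- A pairing that contains the pairs in `K` can be switched to one that contains in addition the
pair `p - q`, except for a small proportion of the pairings. -/
lemma card_avoiding_mul_le [Fintype V] {D : ℕ}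
    (hD : ∀ u, (Finset.univ.filter fun p => v p = u).card + X.degree u ≤ D)
    (hD3 : 3 ≤ D) (hP : D ^ 4 + 2 ≤ Fintype.card P)
    {K : List (P × P)} (hK : K.length ≤ 1) {p q : P} (hpq : p ≠ q) (hp : ¬ Covered K p)
    (hq : ¬ Covered K q) (hF : ¬ F.pair p q)
    (hFK : ∀ e ∈ K, ¬ F.quad p q e.1 e.2 ∧ ¬ F.quad p q e.2 e.1) :
    Fintype.card P * (F.avoiding K).card ≤
      Fintype.card P * (Fintype.card P * (F.avoiding ((p, q) :: K)).card) +
        18 * D ^ 2 * (F.avoiding K).card := by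
  set N := (F.avoiding K).card with hN
  set n := Fintype.card P with hn
  have hn0 : 0 < n := by omega
  have hfib : ∀ u, (Finset.univ.filter fun p => v p = u).card ≤ D := fun u =>
    (Nat.le_add_right _ _).trans (hD u)
  let S := (F.avoiding K).filter fun σ => F.Avoid (switching σ (σ p) q)
  let T := (F.avoiding K).filter fun σ => ¬ F.Avoid (switching σ (σ p) q)
  have hST : N = S.card + T.card := (Finset.card_filter_add_card_filter_not _).symm
  have hS : S.card ≤ n * (F.avoiding ((p, q) :: K)).card := by
    have hsub : S ⊆ (Finset.univ : Finset P).biUnion fun r =>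
        (F.avoiding ((p, q) :: K)).image fun σ => switching σ r q := by
      intro σ hσ
      obtain ⟨hσ1, hσ2⟩ := Finset.mem_filter.1 hσ
      simp only [Finset.mem_biUnion, Finset.mem_univ, true_and, Finset.mem_image]
      refine ⟨σ p, switching σ (σ p) q, ?_, switching_switching _ _ _⟩
      by_cases hc : q = σ p
      · have : switching σ (σ p) q = σ := by ext x; simp [switching_apply, hc]
        rw [this, mem_avoiding]
        rw [mem_avoiding] at hσ1
        refine ⟨hσ1.1, ?_⟩
        simp only [List.mem_cons, forall_eq_or_imp]
        exact ⟨hc.symm, hσ1.2⟩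
      · have h1 := switching_mem_avoiding hσ1 rfl rfl hpq.symm hc hp hq hσ2
        have h2 := (switching_values (mem_avoiding.1 hσ1).1 rfl rfl hpq.symm hc).1
        rw [mem_avoiding] at h1 ⊢
        refine ⟨h1.1, ?_⟩
        simp only [List.mem_cons, forall_eq_or_imp]
        exact ⟨h2, h1.2⟩
    refine (Finset.card_le_card hsub).trans ?_
    refine (Finset.card_biUnion_le_card_mul _ _ _ fun r _ => Finset.card_image_le).trans ?_
    rw [Finset.card_univ]
  have hT : n * T.card ≤ 18 * D ^ 2 * N := by
    let R1 := (Finset.univ.filter fun c => v c = v p).biUnion fun c =>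
      (Finset.univ.filter fun y => v y = v q).biUnion fun y =>
        if Covered K c then ∅ else F.avoiding ((c, y) :: K)
    let Y2 := ((Finset.univ.filter fun y => v y = v p) ∪ (Finset.univ.filter fun y => v y = v q)) ∪
        (Finset.univ.filter fun a => Covered K a).biUnion fun k =>
          Finset.univ.filter fun y => v y = v k
    let R2 := Y2.biUnion fun y => F.avoiding ((p, y) :: K)
    let Z : P → Finset P := fun r => Finset.univ.filter fun s => v r = v s ∨ X.Adj (v r) (v s)
    let R3 := (Finset.univ : Finset P).biUnion fun r => (Z r).biUnion fun s =>
      if r = q then ∅ else F.avoiding ((q, s) :: (p, r) :: K)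
    let R4 := (Finset.univ : Finset P).biUnion fun r => (Finset.univ : Finset P).biUnion fun s =>
      (Finset.univ.filter fun c => v c = v r).biUnion fun c =>
        (Finset.univ.filter fun y => v y = v s).biUnion fun y =>
          if r = q ∨ Covered ((q, s) :: (p, r) :: K) c then ∅
          else F.avoiding ((c, y) :: (q, s) :: (p, r) :: K)
    have hsub : T ⊆ (R1 ∪ R2) ∪ (R3 ∪ R4) := by
      intro σ hσ
      obtain ⟨hσ1, hσ2⟩ := Finset.mem_filter.1 hσ
      obtain ⟨hA, hAK⟩ := mem_avoiding.1 hσ1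
      have hσσ := hA.1
      have hc : q ≠ σ p := by
        intro hc
        apply hσ2
        have : switching σ (σ p) q = σ := by ext x; simp [switching_apply, hc]
        rwa [this]
      have hex := exists_of_not_avoid_switching hA rfl rfl hpq.symm hc hσ2
      obtain ⟨va, vb, vr, vs, voth⟩ := switching_values hA rfl rfl hpq.symm hc
      have hcov : ∀ c, Covered K c → ∃ e ∈ K, (c = e.1 ∧ σ c = e.2) ∨ (c = e.2 ∧ σ c = e.1) := by
        rintro c ⟨e, he, rfl | rfl⟩
        · exact ⟨e, he, Or.inl ⟨rfl, hAK e he⟩⟩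
        · exact ⟨e, he, Or.inr ⟨rfl, by rw [← hAK e he, hσσ]⟩⟩
      have hmem2 : ∀ y, y ∈ Y2 → σ p = y → σ ∈ (R1 ∪ R2) ∪ (R3 ∪ R4) := by
        intro y hy hy'
        refine Finset.mem_union_left _ (Finset.mem_union_right _ ?_)
        simp only [R2, Finset.mem_biUnion]
        refine ⟨y, hy, mem_avoiding.2 ⟨hA, ?_⟩⟩
        simp only [List.mem_cons, forall_eq_or_imp]
        exact ⟨hy', hAK⟩
      have hY2 : ∀ y, (v y = v p ∨ v y = v q ∨ ∃ k, Covered K k ∧ v y = v k) → y ∈ Y2 := by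
        intro y hy
        simp only [Y2, Finset.mem_union, Finset.mem_biUnion, Finset.mem_filter, Finset.mem_univ,
          true_and]
        tauto
      rcases hex with (h5 | ⟨c, h5⟩) | (h5 | ⟨c, h5⟩)
      · exact absurd h5 hF
      · obtain ⟨e1, e2, e3, e4, e5⟩ := F.quad_spec _ _ _ _ h5
        by_cases c2 : c = σ p
        · exact hmem2 (σ p) (hY2 _ (Or.inl (by rw [← c2, e3]))) rfl
        by_cases c3 : c = q
        · exact absurd (c3 ▸ e3) e5
        by_cases c4 : c = σ q
        · rw [c4, vs] at e4
          exact hmem2 (σ p) (hY2 _ (Or.inr (Or.inl e4.symm))) rfl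
        rw [voth c (Ne.symm e1) c2 c3 c4] at e4 h5
        refine Finset.mem_union_left _ (Finset.mem_union_left _ ?_)
        simp only [R1, Finset.mem_biUnion, Finset.mem_filter, Finset.mem_univ, true_and]
        refine ⟨c, e3.symm, σ c, e4.symm, ?_⟩
        rw [if_neg, mem_avoiding]
        · refine ⟨hA, ?_⟩
          simp only [List.mem_cons, forall_eq_or_imp]
          exact ⟨trivial, hAK⟩
        · intro hcc
          obtain ⟨e, he, ⟨h6, h7⟩ | ⟨h6, h7⟩⟩ := hcov c hcc
          · rw [h6, ← h6, h7, h6] at h5; exact (hFK e he).1 h5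
          · rw [h6, ← h6, h7, h6] at h5; exact (hFK e he).2 h5
      · refine Finset.mem_union_right _ (Finset.mem_union_left _ ?_)
        simp only [R3, Z, Finset.mem_biUnion, Finset.mem_filter, Finset.mem_univ, true_and]
        refine ⟨σ p, σ q, F.pair_spec _ _ h5, ?_⟩
        rw [if_neg hc.symm, mem_avoiding]
        refine ⟨hA, ?_⟩
        simp only [List.mem_cons, forall_eq_or_imp]
        exact ⟨trivial, trivial, hAK⟩
      · obtain ⟨e1, e2, e3, e4, e5⟩ := F.quad_spec _ _ _ _ h5
        by_cases c1 : c = p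
        · exact hmem2 (σ p) (hY2 _ (Or.inl (by rw [e3, c1]))) rfl
        by_cases c3 : c = q
        · exact hmem2 (σ p) (hY2 _ (Or.inr (Or.inl (by rw [e3, c3])))) rfl
        by_cases c4 : c = σ q
        · exact absurd (c4 ▸ e3) e5
        rw [voth c c1 (Ne.symm e1) c3 c4] at e4 h5
        by_cases hcc : Covered K c
        · exact hmem2 (σ p) (hY2 _ (Or.inr (Or.inr ⟨c, hcc, e3⟩))) rfl
        refine Finset.mem_union_right _ (Finset.mem_union_right _ ?_)
        simp only [R4, Finset.mem_biUnion, Finset.mem_filter, Finset.mem_univ, true_and]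
        refine ⟨σ p, σ q, c, e3.symm, σ c, e4.symm, ?_⟩
        rw [if_neg, mem_avoiding]
        · refine ⟨hA, ?_⟩
          simp only [List.mem_cons, forall_eq_or_imp]
          exact ⟨trivial, trivial, trivial, hAK⟩
        · rintro (h6 | ⟨e, he, h6⟩)
          · exact hc h6.symm
          · rcases List.mem_cons.1 he with rfl | he
            · exact h6.elim c3 c4
            rcases List.mem_cons.1 he with rfl | he
            · exact h6.elim c1 (Ne.symm e1)
            · exact hcc ⟨e, he, h6⟩
    have hcons : ∀ (L : List (P × P)), L.length ≤ 3 → ∀ a b, ¬ Covered L a →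
        n * (F.avoiding ((a, b) :: L)).card ≤ 2 * (F.avoiding L).card := fun L hL a b ha =>
      card_avoiding_cons_mul_le_two_mul hD hD3 hP hL ha
    have hqp : ∀ r, r ≠ q → ¬ Covered ((p, r) :: K) q := by
      rintro r hr ⟨e, he, h6⟩
      rcases List.mem_cons.1 he with rfl | he
      · exact h6.elim hpq.symm hr.symm
      · exact hq ⟨e, he, h6⟩
    have hR1 : n * R1.card ≤ D * (D * (2 * N)) := by
      refine mul_card_biUnion_le _ _ (hfib (v p)) ?_
      intro c _
      refine mul_card_biUnion_le _ _ (hfib (v q)) ?_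
      intro y _
      split_ifs with hcc
      · simp
      · exact hcons K (by omega) c y hcc
    have hR2 : n * R2.card ≤ (D + D + 2 * D) * (2 * N) := by
      refine mul_card_biUnion_le Y2 _ ?_ ?_
      swap
      · intro c _
        exact hcons K (by omega) p c hp
      refine (Finset.card_union_le _ _).trans (add_le_add ((Finset.card_union_le _ _).trans
        (add_le_add (hfib _) (hfib _))) ?_)
      refine (Finset.card_biUnion_le_card_mul _ _ D fun k _ => hfib _).trans
        (Nat.mul_le_mul_right _ ((card_covered_le K).trans (by omega)))
    have hZ : ∀ r, (Z r).card ≤ D * (D + 1) := fun r => by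
      refine le_trans (Finset.card_le_card ?_) (card_blocked_le (X := X) hD 1 r)
      intro s hs
      have := (Finset.mem_filter.1 hs).2
      exact Finset.mem_filter.2 ⟨Finset.mem_univ _, by unfold Blocked; tauto⟩
    have hR3 : n * (n * R3.card) ≤ n * (D * (D + 1) * (4 * N)) := by
      rw [← mul_assoc]
      refine mul_card_biUnion_le _ _ (by rw [Finset.card_univ]) ?_
      intro r _
      refine mul_card_biUnion_le _ _ (hZ r) ?_
      intro s _
      split_ifs with hcc
      · simp
      · have h1 := hcons ((p, r) :: K) (by simp; omega) q s (hqp r hcc)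
        have h2 := hcons K (by omega) p r hp
        nlinarith
    have hR4 : n * (n * (n * R4.card)) ≤ n * (n * (D * (D * (8 * N)))) := by
      rw [← mul_assoc, ← mul_assoc]
      refine mul_card_biUnion_le _ _ (by rw [Finset.card_univ]) ?_
      intro r _
      refine mul_card_biUnion_le _ _ (by rw [Finset.card_univ]) ?_
      intro s _
      refine mul_card_biUnion_le _ _ (hfib (v r)) ?_
      intro c _
      refine mul_card_biUnion_le _ _ (hfib (v s)) ?_
      intro y _
      split_ifs with hcc
      · simp
      · push Not at hcc
        have h0 := hcons ((q, s) :: (p, r) :: K) (by simp; omega) c y hcc.2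
        have h1 := hcons ((p, r) :: K) (by simp; omega) q s (hqp r hcc.1)
        have h2 := hcons K (by omega) p r hp
        calc n * n * n * (F.avoiding ((c, y) :: (q, s) :: (p, r) :: K)).card
            = n * n * (n * (F.avoiding ((c, y) :: (q, s) :: (p, r) :: K)).card) := by ring
          _ ≤ n * n * (2 * (F.avoiding ((q, s) :: (p, r) :: K)).card) :=
              Nat.mul_le_mul_left _ h0
          _ = 2 * n * (n * (F.avoiding ((q, s) :: (p, r) :: K)).card) := by ring
          _ ≤ 2 * n * (2 * (F.avoiding ((p, r) :: K)).card) := Nat.mul_le_mul_left _ h1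
          _ = 4 * (n * (F.avoiding ((p, r) :: K)).card) := by ring
          _ ≤ 4 * (2 * N) := Nat.mul_le_mul_left _ h2
          _ = 8 * N := by ring
    have hR3' := Nat.le_of_mul_le_mul_left hR3 hn0
    have hR4' := Nat.le_of_mul_le_mul_left (Nat.le_of_mul_le_mul_left hR4 hn0) hn0
    have hcard : T.card ≤ R1.card + R2.card + (R3.card + R4.card) :=
      (Finset.card_le_card hsub).trans ((Finset.card_union_le _ _).trans
        (add_le_add (Finset.card_union_le _ _) (Finset.card_union_le _ _)))
    calc n * T.card ≤ n * (R1.card + R2.card + (R3.card + R4.card)) :=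
          Nat.mul_le_mul_left _ hcard
      _ = n * R1.card + n * R2.card + (n * R3.card + n * R4.card) := by ring
      _ ≤ D * (D * (2 * N)) + (D + D + 2 * D) * (2 * N) +
          (D * (D + 1) * (4 * N) + D * (D * (8 * N))) := by gcongr
      _ = (14 * D ^ 2 + 12 * D) * N := by ring
      _ ≤ 18 * D ^ 2 * N := Nat.mul_le_mul_right _ (by nlinarith)
  calc n * N = n * S.card + n * T.card := by rw [hST]; ring
    _ ≤ _ := by gcongr

end Forbidden
end PairingEstimates

section PairingCount

open Equiv

/-- The product of hard constraints is the indicator that none of them is violated. -/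
lemma sum_prod_hard_constraints {ι Ω : Type*} (s : Finset Ω) (A : ι → Ω → Prop)
    [∀ i ω, Decidable (A i ω)] (I : Finset ι) [DecidablePred fun ω => ∀ k ∈ I, ¬ A k ω] :
    ∑ ω ∈ s, (1 : ℝ) * ∏ k ∈ I, (if A k ω then 1 - 1 else 1)
      = ((s.filter fun ω => ∀ k ∈ I, ¬ A k ω).card : ℝ) := by
  rw [Finset.card_filter, Nat.cast_sum]
  refine Finset.sum_congr rfl fun ω _ => ?_
  rw [one_mul]
  split_ifs with h
  · rw [Finset.prod_eq_one fun k hk => if_neg (h k hk)]; simp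
  · push Not at h
    obtain ⟨k, hk, hA⟩ := h
    rw [Finset.prod_eq_zero hk (by rw [if_pos hA, sub_self])]; simp

namespace Forbidden

variable {P V : Type} {v : P → V} {X : SimpleGraph V} {F : Forbidden v X} [Fintype P] [Fintype V]

lemma abs_card_avoiding_cons_sub_le {D : ℕ}
    (hD : ∀ u, (Finset.univ.filter fun p => v p = u).card + X.degree u ≤ D)
    (hD3 : 3 ≤ D) (hP : D ^ 4 + 2 ≤ Fintype.card P)
    {K : List (P × P)} (hK : K.length ≤ 1) {p q : P} (hpq : p ≠ q) (hp : ¬ Covered K p)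
    (hq : ¬ Covered K q) (hF : ¬ F.pair p q)
    (hFK : ∀ e ∈ K, ¬ F.quad p q e.1 e.2 ∧ ¬ F.quad p q e.2 e.1) :
    |((F.avoiding ((p, q) :: K)).card : ℝ) - 1 / Fintype.card P * (F.avoiding K).card|
      ≤ 18 * (D : ℝ) ^ 2 / (Fintype.card P : ℝ) ^ 2 * (F.avoiding K).card := by
  have h1 := card_avoiding_mul_le hD hD3 hP hK hpq hp hq hF hFK
  have h2 := card_avoiding_cons_mul_le (F := F) hD (b := q) hp
  have h3 := card_avoiding_cons_mul_le_two_mul (F := F) hD hD3 hP (hK.trans (by norm_num))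
    (b := q) hp
  have h4 : 2 + 2 * K.length + 2 * (D * (D + 1)) ≤ 9 * D ^ 2 := by nlinarith
  have h5 := Nat.mul_le_mul_left (F.avoiding ((p, q) :: K)).card h4
  set n := Fintype.card P
  have hn0 : (0 : ℝ) < n := by
    have : 0 < n := by omega
    exact_mod_cast this
  set N := (F.avoiding K).card
  set N' := (F.avoiding ((p, q) :: K)).card
  have g1 : (n : ℝ) * N ≤ n * (n * N') + 18 * D ^ 2 * N := by exact_mod_cast h1
  have g2 : (N' : ℝ) * n ≤ N + N' * (9 * D ^ 2) := by
    have : N' * n ≤ N + N' * (9 * D ^ 2) := by omega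
    exact_mod_cast this
  have g3 : (n : ℝ) * N' ≤ 2 * N := by exact_mod_cast h3
  have e1 : 18 * (D : ℝ) ^ 2 / (n : ℝ) ^ 2 * N = (18 * D ^ 2 * N) / (n : ℝ) ^ 2 := by ring
  have e2 : (N' : ℝ) - 1 / n * N = (n * (n * N') - n * N) / (n : ℝ) ^ 2 := by field_simp
  rw [e1, e2, abs_div, abs_of_pos (by positivity : (0 : ℝ) < (n : ℝ) ^ 2)]
  refine div_le_div_of_nonneg_right ?_ (by positivity)
  rw [abs_le]
  constructor
  · linarith
  · have g4 := mul_le_mul_of_nonneg_left g2 hn0.le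
    have g5 := mul_le_mul_of_nonneg_left g3 (by positivity : (0 : ℝ) ≤ 9 * (D : ℝ) ^ 2)
    nlinarith

lemma abs_card_avoiding_cons_cons_sub_le {D : ℕ}
    (hD : ∀ u, (Finset.univ.filter fun p => v p = u).card + X.degree u ≤ D)
    (hD3 : 3 ≤ D) (hP : D ^ 4 + 2 ≤ Fintype.card P) {p q p' q' : P} (h1 : p ≠ p') (h2 : q ≠ q')
    (h3 : v p = v p') (h4 : v q = v q') (h5 : v p ≠ v q) (hpair : ¬ F.pair p q)
    (hpair' : ¬ F.pair p' q') (hquad : ¬ F.quad p q p' q') :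
    |((F.avoiding [(p, q), (p', q')]).card : ℝ) - 1 / (Fintype.card P : ℝ) ^ 2 * (F.avoiding []).card|
      ≤ 72 * (D : ℝ) ^ 2 / (Fintype.card P : ℝ) ^ 3 * (F.avoiding []).card := by
  have hpq : p ≠ q := fun h => h5 (h ▸ rfl)
  have hpq' : p ≠ q' := fun h => h5 (by rw [h4, h])
  have hqp' : q ≠ p' := fun h => h5 (by rw [h3, h])
  have hpq_ne : p' ≠ q' := fun h => h5 (by rw [h3, h4, h])
  have a1 := abs_card_avoiding_cons_sub_le (F := F) hD hD3 hP (K := [(p', q')]) (by simp) hpq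
    (by simp [Covered, h1, hpq']) (by simp [Covered, h2, hqp']) hpair (by
      simp only [List.mem_singleton, forall_eq]
      refine ⟨hquad, fun h => h5 ?_⟩
      rw [(F.quad_spec _ _ _ _ h).2.2.1, h4])
  have a2 := abs_card_avoiding_cons_sub_le (F := F) hD hD3 hP (K := []) (by simp) hpq_ne
    (by simp [Covered]) (by simp [Covered]) hpair' (by simp)
  set n := Fintype.card P
  have hn : D ^ 4 + 2 ≤ (n : ℝ) := by exact_mod_cast hP
  have hD3' : (3 : ℝ) ≤ D := by exact_mod_cast hD3
  have hn0 : (0 : ℝ) < n := by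
    have : (0 : ℝ) ≤ (D : ℝ) ^ 4 := by positivity
    linarith
  set a := ((F.avoiding [(p, q), (p', q')]).card : ℝ)
  set b := ((F.avoiding [(p', q')]).card : ℝ)
  set c := ((F.avoiding []).card : ℝ)
  have hc : 0 ≤ c := Nat.cast_nonneg _
  set δ := 18 * (D : ℝ) ^ 2 / n with hδ
  have hδ0 : 0 ≤ δ := by positivity
  have hδ2 : δ ≤ 2 := by
    rw [hδ, div_le_iff₀ hn0]
    nlinarith [mul_nonneg (sq_nonneg (D : ℝ)) (by nlinarith : (0 : ℝ) ≤ (D : ℝ) ^ 2 - 9)]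
  have e1 : 18 * (D : ℝ) ^ 2 / (n : ℝ) ^ 2 = δ / n := by rw [hδ]; field_simp
  have e2 : 72 * (D : ℝ) ^ 2 / (n : ℝ) ^ 3 = 4 * δ / n ^ 2 := by rw [hδ]; field_simp; ring
  rw [e1] at a1 a2
  rw [e2]
  rw [abs_le] at a1 a2 ⊢
  have hb : b ≤ (1 + δ) / n * c := by
    have : (1 + δ) / n * c = 1 / n * c + δ / n * c := by ring
    linarith [a2.2]
  have hin : 0 ≤ 1 / (n : ℝ) := by positivity
  have hbb : δ / n * b ≤ 3 * δ / n ^ 2 * c := by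
    calc δ / n * b ≤ δ / n * ((1 + δ) / n * c) := mul_le_mul_of_nonneg_left hb (by positivity)
      _ ≤ δ / n * ((1 + 2) / n * c) := by gcongr
      _ = 3 * δ / n ^ 2 * c := by ring
  have e3 : (1 : ℝ) / n * (δ / n * c) = δ / n ^ 2 * c := by ring
  have e4 : (1 : ℝ) / n * (1 / n * c) = 1 / n ^ 2 * c := by ring
  have l1 := mul_le_mul_of_nonneg_left a2.1 hin
  have l2 := mul_le_mul_of_nonneg_left a2.2 hin
  have e5 : 4 * δ / (n : ℝ) ^ 2 * c = 3 * δ / n ^ 2 * c + δ / n ^ 2 * c := by ring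
  constructor <;> nlinarith [a1.1, a1.2]

end Forbidden
end PairingCount

section PairingAsymptotics

open Equiv

variable {P V : Type}

/-- Fixed-point-free involutions. -/
def IsPairing (σ : Perm P) : Prop := (∀ p, σ (σ p) = p) ∧ ∀ p, σ p ≠ p

/-- Pairings that induce a simple graph on the cells, edge-disjoint from `X`. -/
def IsSimplePairing (v : P → V) (X : SimpleGraph V) (σ : Perm P) : Prop :=
  IsPairing σ ∧ (∀ p, v p ≠ v (σ p) ∧ ¬ X.Adj (v p) (v (σ p))) ∧
    ∀ p p', p ≠ p' → v p = v p' → v (σ p) ≠ v (σ p')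

lemma two_mul_card_filter_lt {ord : P → ℕ} (hord : Function.Injective ord) (S : Finset (P × P))
    (hne : ∀ e ∈ S, e.1 ≠ e.2) (hsymm : ∀ e ∈ S, (e.2, e.1) ∈ S) :
    2 * (S.filter fun e => ord e.1 < ord e.2).card = S.card := by
  have h1 : (S.filter fun e => ord e.1 < ord e.2).card
      = (S.filter fun e => ord e.2 < ord e.1).card := by
    refine Finset.card_nbij' (fun e => (e.2, e.1)) (fun e => (e.2, e.1)) ?_ ?_ ?_ ?_ <;>
    simp +contextual [Set.MapsTo, Set.LeftInvOn, hsymm]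
  have h2 := Finset.card_filter_add_card_filter_not (s := S) fun e => ord e.1 < ord e.2
  have h3 : (S.filter fun e => ¬ ord e.1 < ord e.2) = S.filter fun e => ord e.2 < ord e.1 := by
    refine Finset.filter_congr fun e he => ?_
    have := hord.ne (hne e he)
    omega
  rw [h3] at h2
  omega

lemma four_mul_card_filter_lt {ord : P → ℕ} (hord : Function.Injective ord)
    (S : Finset (P × P × P × P))
    (hne : ∀ p q p' q', (p, q, p', q') ∈ S → p ≠ q ∧ p ≠ p' ∧ p ≠ q' ∧ q ≠ p' ∧ q ≠ q' ∧ p' ≠ q')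
    (hswap : ∀ p q p' q', (p, q, p', q') ∈ S → (q, p, q', p') ∈ S)
    (hcomm : ∀ p q p' q', (p, q, p', q') ∈ S → (p', q', p, q) ∈ S) :
    4 * (S.filter fun e => ord e.1 < ord e.2.1 ∧ ord e.1 < ord e.2.2.1 ∧
      ord e.1 < ord e.2.2.2).card = S.card := by
  have key : ∀ f : P × P × P × P → P × P × P × P, (∀ e, f (f e) = e) → (∀ e ∈ S, f e ∈ S) →
      ∑ e ∈ S, (if ord e.1 < ord e.2.1 ∧ ord e.1 < ord e.2.2.1 ∧ ord e.1 < ord e.2.2.2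
        then 1 else 0) =
      ∑ e ∈ S, (if ord (f e).1 < ord (f e).2.1 ∧ ord (f e).1 < ord (f e).2.2.1 ∧
        ord (f e).1 < ord (f e).2.2.2 then 1 else 0) := by
    intro f hf hS
    refine Finset.sum_nbij' f f hS hS (fun e _ => hf e) (fun e _ => hf e) fun e _ => ?_
    rw [hf]
  have k1 := key (fun e => (e.2.1, e.1, e.2.2.2, e.2.2.1)) (fun e => rfl)
    (fun e he => hswap _ _ _ _ he)
  have k2 := key (fun e => (e.2.2.1, e.2.2.2, e.1, e.2.1)) (fun e => rfl)
    (fun e he => hcomm _ _ _ _ he)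
  have k3 := key (fun e => (e.2.2.2, e.2.2.1, e.2.1, e.1)) (fun e => rfl)
    (fun e he => hcomm _ _ _ _ (hswap _ _ _ _ he))
  rw [Finset.card_filter]
  have h4 : ∀ x : ℕ, 4 * x = x + x + (x + x) := fun x => by ring
  rw [h4]
  nth_rewrite 2 [k1]
  nth_rewrite 2 [k2]
  nth_rewrite 2 [k3]
  rw [← Finset.sum_add_distrib, ← Finset.sum_add_distrib, ← Finset.sum_add_distrib,
    Finset.card_eq_sum_ones]
  refine Finset.sum_congr rfl fun e he => ?_
  obtain ⟨p, q, p', q'⟩ := e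
  have h := hne p q p' q' he
  have g1 := hord.ne h.1
  have g2 := hord.ne h.2.1
  have g3 := hord.ne h.2.2.1
  have g4 := hord.ne h.2.2.2.1
  have g5 := hord.ne h.2.2.2.2.1
  have g6 := hord.ne h.2.2.2.2.2
  dsimp only
  split_ifs <;> omega

variable [Fintype P]

/-- The ordered pairs of points that form a loop or run along an edge of `X`. -/
noncomputable def badPairs (v : P → V) (X : SimpleGraph V) : Finset (P × P) :=
  Finset.univ.filter fun e => e.1 ≠ e.2 ∧ (v e.1 = v e.2 ∨ X.Adj (v e.1) (v e.2))

/-- The ordered double pairs `p - q`, `p' - q'` between two distinct cells. -/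
noncomputable def doublePairs (v : P → V) : Finset (P × P × P × P) :=
  Finset.univ.filter fun e => e.1 ≠ e.2.2.1 ∧ e.2.1 ≠ e.2.2.2 ∧ v e.1 = v e.2.2.1 ∧
    v e.2.1 = v e.2.2.2 ∧ v e.1 ≠ v e.2.1

variable [Fintype V] {v : P → V} {X : SimpleGraph V}

lemma card_badPairs_le {D : ℕ}
    (hD : ∀ u, (Finset.univ.filter fun p => v p = u).card + X.degree u ≤ D) :
    (badPairs v X).card ≤ Fintype.card P * (D * (D + 1)) := by
  have hsub : badPairs v X ⊆ (Finset.univ : Finset P).biUnion fun p =>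
      (Finset.univ.filter fun y => Forbidden.Blocked v X 1 p y).image fun y => (p, y) := by
    rintro ⟨p, q⟩ h
    have h := (Finset.mem_filter.1 h).2
    simp only [Finset.mem_biUnion, Finset.mem_univ, true_and, Finset.mem_image, Finset.mem_filter]
    exact ⟨p, q, by unfold Forbidden.Blocked; tauto, rfl⟩
  refine (Finset.card_le_card hsub).trans ((Finset.card_biUnion_le_card_mul _ _ _ fun p _ =>
    Finset.card_image_le.trans (Forbidden.card_blocked_le hD 1 p)).trans ?_)
  rw [Finset.card_univ]

lemma card_doublePairs_le {D : ℕ}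
    (hD : ∀ u, (Finset.univ.filter fun p => v p = u).card + X.degree u ≤ D) :
    (doublePairs v).card ≤ Fintype.card P * (Fintype.card P * (D * D)) := by
  have hfib : ∀ u, (Finset.univ.filter fun p => v p = u).card ≤ D := fun u =>
    (Nat.le_add_right _ _).trans (hD u)
  have hsub : doublePairs v ⊆ (Finset.univ : Finset P).biUnion fun p =>
      (Finset.univ : Finset P).biUnion fun q =>
      ((Finset.univ.filter fun y => v y = v p) ×ˢ (Finset.univ.filter fun y => v y = v q)).image
        fun y => (p, q, y.1, y.2) := by
    rintro ⟨p, q, p', q'⟩ h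
    have h := (Finset.mem_filter.1 h).2
    simp only [Finset.mem_biUnion, Finset.mem_univ, true_and, Finset.mem_image, Finset.mem_filter,
      Finset.mem_product, Prod.exists]
    exact ⟨p, q, p', q', ⟨h.2.2.1.symm, h.2.2.2.1.symm⟩, rfl⟩
  refine (Finset.card_le_card hsub).trans ((Finset.card_biUnion_le_card_mul _ _ _ fun p _ =>
    Finset.card_biUnion_le_card_mul _ _ _ fun q _ =>
    Finset.card_image_le.trans ?_).trans (le_of_eq (by rw [Finset.card_univ])))
  rw [Finset.card_product]
  exact Nat.mul_le_mul (hfib _) (hfib _)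

/-- Few double pairs run along an edge of `X`. -/
lemma card_doublePairs_adj_le {D : ℕ}
    (hD : ∀ u, (Finset.univ.filter fun p => v p = u).card + X.degree u ≤ D) :
    ((doublePairs v).filter fun e => X.Adj (v e.1) (v e.2.1)).card
      ≤ Fintype.card P * (D * (D + 1) * (D * D)) := by
  have hfib : ∀ u, (Finset.univ.filter fun p => v p = u).card ≤ D := fun u =>
    (Nat.le_add_right _ _).trans (hD u)
  have hsub : ((doublePairs v).filter fun e => X.Adj (v e.1) (v e.2.1)) ⊆
      (Finset.univ : Finset P).biUnion fun p =>
      (Finset.univ.filter fun y => Forbidden.Blocked v X 1 p y).biUnion fun q =>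
      ((Finset.univ.filter fun y => v y = v p) ×ˢ (Finset.univ.filter fun y => v y = v q)).image
        fun y => (p, q, y.1, y.2) := by
    rintro ⟨p, q, p', q'⟩ h
    obtain ⟨h, hadj⟩ := Finset.mem_filter.1 h
    have h := (Finset.mem_filter.1 h).2
    simp only [Finset.mem_biUnion, Finset.mem_univ, true_and, Finset.mem_image, Finset.mem_filter,
      Finset.mem_product, Prod.exists]
    exact ⟨p, q, Or.inr (Or.inl hadj), p', q', ⟨h.2.2.1.symm, h.2.2.2.1.symm⟩, rfl⟩
  refine (Finset.card_le_card hsub).trans ((Finset.card_biUnion_le_card_mul _ _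
    (D * (D + 1) * (D * D)) fun p _ => ?_).trans (le_of_eq (by rw [Finset.card_univ])))
  refine (Finset.card_biUnion_le_card_mul _ _ (D * D) fun q _ =>
    Finset.card_image_le.trans ?_).trans
      (Nat.mul_le_mul_right _ (Forbidden.card_blocked_le hD 1 p))
  rw [Finset.card_product]
  exact Nat.mul_le_mul (hfib _) (hfib _)

end PairingAsymptotics

section PairingTheorem

open Equiv

variable {P V : Type} [Fintype P] {v : P → V} {X : SimpleGraph V}

/-- Forbidding some of the bad pairs. -/
def Forbidden.ofPairs (I : Finset (P × P)) (hI : I ⊆ badPairs v X) : Forbidden v X where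
  pair p q := (p, q) ∈ I ∨ (q, p) ∈ I
  quad _ _ _ _ := False
  pair_symm p q h := h.symm
  pair_spec p q h := by
    rcases h with h | h
    · exact (Finset.mem_filter.1 (hI h)).2.2
    · exact (Finset.mem_filter.1 (hI h)).2.2.imp Eq.symm SimpleGraph.Adj.symm
  quad_swap _ _ _ _ h := h
  quad_comm _ _ _ _ h := h
  quad_spec _ _ _ _ h := h.elim
  loops := Or.inl fun _ _ _ _ h => h

/-- Forbidding all bad pairs and some of the double pairs. -/
def Forbidden.ofQuads (X : SimpleGraph V) (I : Finset (P × P × P × P)) (hI : I ⊆ doublePairs v) :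
    Forbidden v X where
  pair p q := p ≠ q ∧ (v p = v q ∨ X.Adj (v p) (v q))
  quad p q p' q' := (p, q, p', q') ∈ I ∨ (q, p, q', p') ∈ I ∨ (p', q', p, q) ∈ I ∨
    (q', p', q, p) ∈ I
  pair_symm p q h := ⟨h.1.symm, h.2.imp Eq.symm SimpleGraph.Adj.symm⟩
  pair_spec p q h := h.2
  quad_swap _ _ _ _ h := by tauto
  quad_comm _ _ _ _ h := by tauto
  quad_spec p q p' q' h := by
    have key : ∀ a b c d, (a, b, c, d) ∈ I → a ≠ c ∧ b ≠ d ∧ v a = v c ∧ v b = v d ∧ v a ≠ v b :=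
      fun a b c d h => (Finset.mem_filter.1 (hI h)).2
    rcases h with h | h | h | h
    · exact key _ _ _ _ h
    · obtain ⟨h1, h2, h3, h4, h5⟩ := key _ _ _ _ h
      exact ⟨h2, h1, h4, h3, h5.symm⟩
    · obtain ⟨h1, h2, h3, h4, h5⟩ := key _ _ _ _ h
      exact ⟨h1.symm, h2.symm, h3.symm, h4.symm, by rwa [← h3, ← h4]⟩
    · obtain ⟨h1, h2, h3, h4, h5⟩ := key _ _ _ _ h
      exact ⟨h2.symm, h1.symm, h4.symm, h3.symm, by rw [← h3, ← h4]; exact h5.symm⟩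
  loops := Or.inr fun p q h h' => ⟨h, Or.inl h'⟩

variable [Fintype V] {D : ℕ}

lemma exists_card_avoiding_bad_eq
    (hD : ∀ u, (Finset.univ.filter fun p => v p = u).card + X.degree u ≤ D)
    (hD3 : 3 ≤ D) (hP : D ^ 4 + 2 ≤ Fintype.card P) :
    ∃ E : ℝ, |E| ≤ 20 * (D : ℝ) ^ 4 / Fintype.card P ∧
      (((Forbidden.ofQuads (v := v) X ∅ (by simp)).avoiding []).card : ℝ)
        = (Finset.univ.filter fun σ : Perm P => IsPairing σ).card *
          Real.exp (-((badPairs v X).card / (2 * Fintype.card P)) + E) := by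
  set n := Fintype.card P with hn
  have hn' : D ^ 4 + 2 ≤ (n : ℝ) := by exact_mod_cast hP
  have hD3' : (3 : ℝ) ≤ D := by exact_mod_cast hD3
  have hDsq : 9 * (D : ℝ) ^ 2 ≤ (D : ℝ) ^ 4 := by
    nlinarith [mul_nonneg (sq_nonneg (D : ℝ)) (by nlinarith : (0 : ℝ) ≤ (D : ℝ) ^ 2 - 9)]
  have hn0 : (0 : ℝ) < n := by nlinarith
  obtain ⟨ord, hord⟩ : ∃ ord : P → ℕ, Function.Injective ord :=
    ⟨fun p => (Fintype.equivFin P p).val, Fin.val_injective.comp (Fintype.equivFin P).injective⟩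
  let J := (badPairs v X).filter fun e => ord e.1 < ord e.2
  have hJb : J ⊆ badPairs v X := Finset.filter_subset _ _
  have hJ : 2 * J.card = (badPairs v X).card := by
    refine two_mul_card_filter_lt hord _ (fun e he => (Finset.mem_filter.1 he).2.1) ?_
    intro e he
    obtain ⟨-, h1, h2⟩ := Finset.mem_filter.1 he
    exact Finset.mem_filter.2 ⟨Finset.mem_univ _, h1.symm, h2.imp Eq.symm SimpleGraph.Adj.symm⟩
  let s : Finset (Perm P) := Finset.univ.filter fun σ : Perm P => IsPairing σ
  let A : P × P → Perm P → Prop := fun e σ => σ e.1 = e.2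
  have hs : ∀ (I : Finset (P × P)) (hI : I ⊆ J), (s.filter fun σ => ∀ k ∈ I, ¬ A k σ)
      = (Forbidden.ofPairs I (hI.trans hJb)).avoiding [] := by
    intro I hI
    ext σ
    simp only [s, A, Finset.mem_filter, Finset.mem_univ, true_and, Forbidden.mem_avoiding,
      Forbidden.Avoid, Forbidden.ofPairs, List.not_mem_nil, false_imp_iff, implies_true,
      and_true, not_false_eq_true, not_or]
    constructor
    · rintro ⟨⟨h1, h2⟩, h3⟩
      exact ⟨h1, h2, fun p => ⟨fun h => h3 _ h rfl, fun h => h3 _ h (h1 p)⟩⟩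
    · rintro ⟨h1, h2, h3⟩
      refine ⟨⟨h1, h2⟩, fun k hk h => (h3 k.1).1 ?_⟩
      rw [h]; exact hk
  have hs' : ∀ (I : Finset (P × P)) (hI : I ⊆ J) (i : P × P),
      ((s.filter (A i)).filter fun σ => ∀ k ∈ I, ¬ A k σ)
      = (Forbidden.ofPairs I (hI.trans hJb)).avoiding [i] := by
    intro I hI i
    rw [Finset.filter_comm, hs I hI]
    ext σ
    simp only [Finset.mem_filter, Forbidden.mem_avoiding, List.not_mem_nil, false_imp_iff,
      implies_true, and_true, List.mem_singleton, forall_eq, A]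
  obtain ⟨E, hE, hsum⟩ := sum_mul_prod_eq_exp s (fun _ => (1 : ℝ)) A (fun _ => 1)
    (fun _ => 1 / (n : ℝ)) (fun _ => 18 * (D : ℝ) ^ 2 / n ^ 2) J (fun _ _ => zero_le_one)
    (fun _ _ => by positivity) (fun _ _ => zero_le_one) (fun _ _ => le_rfl) (by
      intro i _
      right
      rw [one_mul, div_add_div _ _ hn0.ne' (by positivity), div_le_div_iff₀ (by positivity)
        (by norm_num)]
      nlinarith [mul_pos hn0 hn0, mul_pos hn0 (mul_pos hn0 hn0)]) (by
      intro I hI i hi hiI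
      rw [sum_prod_hard_constraints, sum_prod_hard_constraints, hs I hI, hs' I hI]
      obtain ⟨hib, hlt⟩ := Finset.mem_filter.1 hi
      refine Forbidden.abs_card_avoiding_cons_sub_le hD hD3 hP (K := []) (by simp)
        (Finset.mem_filter.1 hib).2.1 (by simp [Forbidden.Covered]) (by simp [Forbidden.Covered])
        ?_ (by simp)
      rintro (h | h)
      · exact hiI h
      · have := (Finset.mem_filter.1 (hI h)).2
        simp only at this
        omega)
  rw [sum_prod_hard_constraints, hs J subset_rfl] at hsum
  refine ⟨E, hE.trans ?_, ?_⟩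
  · simp only [one_mul, Finset.sum_const, nsmul_eq_mul]
    have h1 : 1 / (n : ℝ) + 18 * (D : ℝ) ^ 2 / n ^ 2 ≤ 3 / n := by
      rw [div_add_div _ _ hn0.ne' (by positivity), div_le_div_iff₀ (by positivity) hn0]
      nlinarith [mul_pos hn0 hn0, mul_pos hn0 (mul_pos hn0 hn0)]
    have h2 : (1 / (n : ℝ) + 18 * (D : ℝ) ^ 2 / n ^ 2) ^ 2 ≤ (3 / n) ^ 2 := by gcongr
    have h3 : (J.card : ℝ) ≤ n * (D : ℝ) ^ 2 * (2 / 3) := by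
      have h4 : (2 * J.card : ℝ) ≤ n * (D * (D + 1)) := by
        have := card_badPairs_le (v := v) hD
        rw [← hJ] at this
        exact_mod_cast this
      nlinarith
    calc (J.card : ℝ) * (18 * (D : ℝ) ^ 2 / n ^ 2 +
          2 * (1 / (n : ℝ) + 18 * (D : ℝ) ^ 2 / n ^ 2) ^ 2)
        ≤ (n * (D : ℝ) ^ 2 * (2 / 3)) * (18 * (D : ℝ) ^ 2 / n ^ 2 + 2 * (3 / n) ^ 2) := by gcongr
      _ = (12 * (D : ℝ) ^ 4 + 12 * D ^ 2) / n := by field_simp; ring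
      _ ≤ 20 * (D : ℝ) ^ 4 / n := by
        refine div_le_div_of_nonneg_right ?_ hn0.le
        nlinarith
  · have e1 : (Forbidden.ofQuads (v := v) X ∅ (by simp)).avoiding []
        = (Forbidden.ofPairs J hJb).avoiding [] := by
      ext σ
      simp only [Forbidden.mem_avoiding, Forbidden.Avoid, Forbidden.ofPairs, Forbidden.ofQuads,
        List.not_mem_nil, false_imp_iff, implies_true, and_true, not_false_eq_true,
        Finset.notMem_empty, or_self]
      refine and_congr_right fun h1 => and_congr_right fun h2 => forall_congr' fun p => not_congr ?_
      simp only [J, badPairs, Finset.mem_filter, Finset.mem_univ, true_and]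
      have h3 := hord.ne (h2 p)
      have h4 := h2 p
      constructor
      · rintro ⟨h5, h6⟩
        rcases lt_or_gt_of_ne h3 with h7 | h7
        · exact Or.inr ⟨⟨h5.symm, h6.imp Eq.symm SimpleGraph.Adj.symm⟩, h7⟩
        · exact Or.inl ⟨⟨h5, h6⟩, h7⟩
      · rintro (⟨⟨h5, h6⟩, -⟩ | ⟨⟨h5, h6⟩, -⟩)
        · exact ⟨h5, h6⟩
        · exact ⟨h5.symm, h6.imp Eq.symm SimpleGraph.Adj.symm⟩
    rw [e1, hsum, ← hJ]
    congr 2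
    · simp [s]
    · simp only [one_mul, Finset.sum_const, nsmul_eq_mul, add_left_inj, neg_inj]
      push_cast
      field_simp

end PairingTheorem

section SimplePairings

open Equiv

variable {P V : Type} [Fintype P] {v : P → V} {X : SimpleGraph V} [Fintype V] {D : ℕ}

set_option maxHeartbeats 1000000 in
lemma exists_card_isSimplePairing_eq
    (hD : ∀ u, (Finset.univ.filter fun p => v p = u).card + X.degree u ≤ D)
    (hD3 : 3 ≤ D) (hP : D ^ 4 + 2 ≤ Fintype.card P) :
    ∃ E : ℝ, |E| ≤ 50 * (D : ℝ) ^ 4 / Fintype.card P ∧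
      ((Finset.univ.filter fun σ : Perm P => IsSimplePairing v X σ).card : ℝ)
        = (Finset.univ.filter fun σ : Perm P => IsPairing σ).card *
          Real.exp (-((badPairs v X).card / (2 * Fintype.card P) +
            (doublePairs v).card / (4 * (Fintype.card P) ^ 2)) + E) := by
  obtain ⟨E₁, hE₁, hcard₁⟩ := exists_card_avoiding_bad_eq hD hD3 hP
  set n := Fintype.card P with hn
  have hn' : D ^ 4 + 2 ≤ (n : ℝ) := by exact_mod_cast hP
  have hD3' : (3 : ℝ) ≤ D := by exact_mod_cast hD3
  have hDsq : 9 * (D : ℝ) ^ 2 ≤ (D : ℝ) ^ 4 := by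
    nlinarith [mul_nonneg (sq_nonneg (D : ℝ)) (by nlinarith : (0 : ℝ) ≤ (D : ℝ) ^ 2 - 9)]
  have hn0 : (0 : ℝ) < n := by nlinarith
  obtain ⟨ord, hord⟩ : ∃ ord : P → ℕ, Function.Injective ord :=
    ⟨fun p => (Fintype.equivFin P p).val, Fin.val_injective.comp (Fintype.equivFin P).injective⟩
  let S := (doublePairs v).filter fun e => ¬ X.Adj (v e.1) (v e.2.1)
  have memS : ∀ p q p' q', (p, q, p', q') ∈ S ↔
      (p ≠ p' ∧ q ≠ q' ∧ v p = v p' ∧ v q = v q' ∧ v p ≠ v q) ∧ ¬ X.Adj (v p) (v q) := by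
    intro p q p' q'
    simp [S, doublePairs]
  let J := S.filter fun e => ord e.1 < ord e.2.1 ∧ ord e.1 < ord e.2.2.1 ∧ ord e.1 < ord e.2.2.2
  have hJS : J ⊆ S := Finset.filter_subset _ _
  have hJb : J ⊆ doublePairs v := hJS.trans (Finset.filter_subset _ _)
  have hSne : ∀ p q p' q', (p, q, p', q') ∈ S →
      p ≠ q ∧ p ≠ p' ∧ p ≠ q' ∧ q ≠ p' ∧ q ≠ q' ∧ p' ≠ q' := by
    intro p q p' q' he
    obtain ⟨⟨h1, h2, h3, h4, h5⟩, -⟩ := (memS _ _ _ _).1 he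
    exact ⟨fun h => h5 (h ▸ rfl), h1, fun h => h5 (by rw [h4, h]), fun h => h5 (by rw [h3, h]),
      h2, fun h => h5 (by rw [h3, h4, h])⟩
  have hSswap : ∀ p q p' q', (p, q, p', q') ∈ S → (q, p, q', p') ∈ S := by
    intro p q p' q' he
    obtain ⟨⟨h1, h2, h3, h4, h5⟩, h6⟩ := (memS _ _ _ _).1 he
    exact (memS _ _ _ _).2 ⟨⟨h2, h1, h4, h3, h5.symm⟩, fun h => h6 h.symm⟩
  have hScomm : ∀ p q p' q', (p, q, p', q') ∈ S → (p', q', p, q) ∈ S := by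
    intro p q p' q' he
    obtain ⟨⟨h1, h2, h3, h4, h5⟩, h6⟩ := (memS _ _ _ _).1 he
    refine (memS _ _ _ _).2 ⟨⟨h1.symm, h2.symm, h3.symm, h4.symm, ?_⟩, ?_⟩
    · rwa [← h3, ← h4]
    · rwa [← h3, ← h4]
  have hJ : 4 * J.card = S.card := four_mul_card_filter_lt hord S hSne hSswap hScomm
  let s : Finset (Perm P) := (Forbidden.ofQuads (v := v) X ∅ (by simp)).avoiding []
  let A : P × P × P × P → Perm P → Prop := fun e σ => σ e.1 = e.2.1 ∧ σ e.2.2.1 = e.2.2.2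
  have hs : ∀ (I : Finset (P × P × P × P)) (hI : I ⊆ J), (s.filter fun σ => ∀ k ∈ I, ¬ A k σ)
      = (Forbidden.ofQuads X I (hI.trans hJb)).avoiding [] := by
    intro I hI
    ext σ
    simp only [s, A, Finset.mem_filter, Forbidden.mem_avoiding,
      Forbidden.Avoid, Forbidden.ofQuads, List.not_mem_nil, false_imp_iff, implies_true,
      and_true, not_false_eq_true, not_or, Finset.notMem_empty, and_self]
    constructor
    · rintro ⟨⟨h1, h2, h3⟩, h4⟩
      refine ⟨h1, h2, h3, fun p p' => ⟨fun h => h4 _ h ⟨rfl, rfl⟩, fun h => h4 _ h ⟨h1 _, h1 _⟩,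
        fun h => h4 _ h ⟨rfl, rfl⟩, fun h => h4 _ h ⟨h1 _, h1 _⟩⟩⟩
    · rintro ⟨h1, h2, h3, h4⟩
      refine ⟨⟨h1, h2, h3⟩, fun k hk h => (h4 k.1 k.2.2.1).1 ?_⟩
      rw [h.1, h.2]; exact hk
  have hs' : ∀ (I : Finset (P × P × P × P)) (hI : I ⊆ J) (i : P × P × P × P),
      ((s.filter (A i)).filter fun σ => ∀ k ∈ I, ¬ A k σ)
      = (Forbidden.ofQuads X I (hI.trans hJb)).avoiding [(i.1, i.2.1), (i.2.2.1, i.2.2.2)] := by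
    intro I hI i
    rw [Finset.filter_comm, hs I hI]
    ext σ
    simp [Forbidden.mem_avoiding, A]
  have hsmall : 1 / (n : ℝ) ^ 2 + 72 * (D : ℝ) ^ 2 / n ^ 3 ≤ 9 / n ^ 2 := by
    rw [div_add_div _ _ (by positivity) (by positivity), div_le_div_iff₀ (by positivity)
      (by positivity)]
    have : 72 * (D : ℝ) ^ 2 ≤ 8 * n := by nlinarith
    have h2 := mul_le_mul_of_nonneg_right this (by positivity : (0 : ℝ) ≤ n ^ 4)
    nlinarith
  have hn81 : (81 : ℝ) ≤ n := by nlinarith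
  obtain ⟨E, hE, hsum⟩ := sum_mul_prod_eq_exp s (fun _ => (1 : ℝ)) A (fun _ => 1)
    (fun _ => 1 / (n : ℝ) ^ 2) (fun _ => 72 * (D : ℝ) ^ 2 / n ^ 3) J (fun _ _ => zero_le_one)
    (fun _ _ => by positivity) (fun _ _ => zero_le_one) (fun _ _ => le_rfl) (by
      intro i _
      right
      rw [one_mul]
      refine hsmall.trans ?_
      rw [div_le_div_iff₀ (by positivity) (by norm_num)]
      nlinarith) (by
      intro I hI i hi hiI
      rw [sum_prod_hard_constraints, sum_prod_hard_constraints, hs I hI, hs' I hI]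
      obtain ⟨hiS, hmin⟩ := Finset.mem_filter.1 hi
      obtain ⟨p, q, p', q'⟩ := i
      obtain ⟨⟨h1, h2, h3, h4, h5⟩, h6⟩ := (memS _ _ _ _).1 hiS
      refine Forbidden.abs_card_avoiding_cons_cons_sub_le hD hD3 hP h1 h2 h3 h4 h5 ?_ ?_ ?_
      · rintro ⟨-, h | h⟩
        exacts [h5 h, h6 h]
      · rintro ⟨-, h | h⟩
        · exact h5 (by rw [h3, h4]; exact h)
        · exact h6 (by rw [h3, h4]; exact h)
      · rintro (h | h | h | h)
        · exact hiI h
        all_goals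
          have := (Finset.mem_filter.1 (hI h)).2
          simp only at this hmin
          omega)
  rw [sum_prod_hard_constraints, hs J subset_rfl] at hsum
  have hfin : (Forbidden.ofQuads X J hJb).avoiding []
      = Finset.univ.filter fun σ : Perm P => IsSimplePairing v X σ := by
    ext σ
    simp only [Finset.mem_filter, Finset.mem_univ, true_and, Forbidden.mem_avoiding,
      Forbidden.Avoid, Forbidden.ofQuads, List.not_mem_nil, false_imp_iff, implies_true,
      and_true, not_or, not_and, IsSimplePairing, IsPairing, and_assoc]
    refine and_congr_right fun h1 => and_congr_right fun h2 => ?_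
    have h3 : ∀ p, p ≠ σ p := fun p => (h2 p).symm
    simp only [h3, ne_eq, not_false_eq_true, true_imp_iff]
    refine and_congr_right fun h4 => ?_
    constructor
    · intro h5 p p' hne hv hv'
      have hm : (p, σ p, p', σ p') ∈ S :=
        (memS _ _ _ _).2 ⟨⟨hne, fun h => hne (σ.injective h), hv, hv', (h4 p).1⟩, (h4 p).2⟩
      have hn := hSne _ _ _ _ hm
      have g1 := hord.ne hn.1
      have g2 := hord.ne hn.2.1
      have g3 := hord.ne hn.2.2.1
      have g4 := hord.ne hn.2.2.2.1
      have g5 := hord.ne hn.2.2.2.2.1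
      have g6 := hord.ne hn.2.2.2.2.2
      have h6 := h5 p p'
      simp only [J, Finset.mem_filter, hm, hSswap _ _ _ _ hm, hScomm _ _ _ _ hm,
        hScomm _ _ _ _ (hSswap _ _ _ _ hm), true_and] at h6
      omega
    · intro h5 p p'
      have key : ∀ p p', (p, σ p, p', σ p') ∉ J := by
        intro p p' h
        obtain ⟨⟨h1, h2, h3, h4, h5'⟩, h6⟩ := (memS _ _ _ _).1 (hJS h)
        exact h5 p p' h1 h3 h4
      refine ⟨key _ _, fun h => key (σ p) (σ p') (by rwa [h1, h1]), key _ _,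
        fun h => key (σ p') (σ p) (by rwa [h1, h1])⟩
  rw [hfin] at hsum
  have hSc : (S.card : ℝ) + ((doublePairs v).filter fun e => X.Adj (v e.1) (v e.2.1)).card
      = (doublePairs v).card := by
    rw [add_comm]
    exact_mod_cast Finset.card_filter_add_card_filter_not (s := doublePairs v)
      fun e => X.Adj (v e.1) (v e.2.1)
  have hadj : ((((doublePairs v).filter fun e => X.Adj (v e.1) (v e.2.1)).card : ℕ) : ℝ)
      ≤ n * (D * (D + 1) * (D * D)) := by
    exact_mod_cast card_doublePairs_adj_le (v := v) hD
  set a : ℝ := (((doublePairs v).filter fun e => X.Adj (v e.1) (v e.2.1)).card : ℝ) with ha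
  have ha0 : 0 ≤ a := by positivity
  have hJ' : (4 : ℝ) * J.card = S.card := by exact_mod_cast hJ
  refine ⟨E₁ + a / (4 * n ^ 2) + E, ?_, ?_⟩
  · have hE' : |E| ≤ 19 * (D : ℝ) ^ 4 / n := by
      refine hE.trans ?_
      simp only [one_mul, Finset.sum_const, nsmul_eq_mul]
      have h2 : (1 / (n : ℝ) ^ 2 + 72 * (D : ℝ) ^ 2 / n ^ 3) ^ 2 ≤ (9 / n ^ 2) ^ 2 := by
        gcongr
      have h3 : (J.card : ℝ) ≤ n * (n * (D * D)) / 4 := by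
        have h4 : ((doublePairs v).card : ℝ) ≤ n * (n * (D * D)) := by
          exact_mod_cast card_doublePairs_le (v := v) hD
        linarith
      calc (J.card : ℝ) * (72 * (D : ℝ) ^ 2 / n ^ 3 +
            2 * (1 / (n : ℝ) ^ 2 + 72 * (D : ℝ) ^ 2 / n ^ 3) ^ 2)
          ≤ (n * (n * (D * D)) / 4) * (72 * (D : ℝ) ^ 2 / n ^ 3 + 2 * (9 / n ^ 2) ^ 2) := by
            gcongr
        _ = (18 * (D : ℝ) ^ 4 + (81 / 2) * D ^ 2 / n) / n := by field_simp; ring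
        _ ≤ 19 * (D : ℝ) ^ 4 / n := by
          refine div_le_div_of_nonneg_right ?_ hn0.le
          have : (81 / 2) * (D : ℝ) ^ 2 / n ≤ D ^ 2 := by
            rw [div_le_iff₀ hn0]
            nlinarith [sq_nonneg (D : ℝ)]
          nlinarith
    have ha' : |a / (4 * n ^ 2)| ≤ (D : ℝ) ^ 4 / n := by
      rw [abs_of_nonneg (by positivity), div_le_div_iff₀ (by positivity) hn0]
      have : (D : ℝ) * (D + 1) * (D * D) ≤ 4 * D ^ 4 := by nlinarith [pow_nonneg (by linarith : (0 : ℝ) ≤ D) 3]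
      have h2 := mul_le_mul_of_nonneg_left this hn0.le
      nlinarith
    calc |E₁ + a / (4 * n ^ 2) + E| ≤ |E₁| + |a / (4 * n ^ 2)| + |E| := abs_add_three _ _ _
      _ ≤ 20 * (D : ℝ) ^ 4 / n + (D : ℝ) ^ 4 / n + 19 * (D : ℝ) ^ 4 / n := by gcongr
      _ = 40 * (D : ℝ) ^ 4 / n := by ring
      _ ≤ 50 * (D : ℝ) ^ 4 / n := by gcongr; norm_num
  · rw [hsum]
    simp only [Finset.sum_const, nsmul_eq_mul, mul_one]
    rw [hcard₁, mul_assoc, ← Real.exp_add]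
    congr 2
    rw [← hSc, ← hJ']
    field_simp
    ring

end SimplePairings

section PairingsAndGraphs

open Equiv

variable {P V : Type}

lemma card_isPairing_mul [Fintype P] {m : ℕ} (hm : Fintype.card P = 2 * m) :
    (Finset.univ.filter fun σ : Perm P => IsPairing σ).card * (2 ^ m * m.factorial)
      = (2 * m).factorial := by
  have h1 : (Finset.univ.filter fun σ : Perm P => IsPairing σ)
      = Finset.univ.filter fun σ : Perm P => σ.cycleType = Multiset.replicate m 2 := by
    refine Finset.filter_congr fun σ _ => ?_
    constructor
    · rintro ⟨h1, h2⟩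
      have hpow : σ ^ 2 = 1 := by ext p; simp [sq, h1]
      have h3 := Perm.cycleType_of_pow_prime_eq_one (p := 2) hpow
      have h4 : σ.support = Finset.univ := by ext p; simp [h2]
      have h5 := σ.sum_cycleType
      rw [h4, Finset.card_univ, hm, h3] at h5
      simp only [Multiset.sum_replicate, smul_eq_mul] at h5
      rw [h3]
      congr 1
      omega
    · intro h
      have h5 := σ.sum_cycleType
      rw [h, Multiset.sum_replicate, smul_eq_mul, mul_comm, ← hm] at h5
      have h4 : σ.support = Finset.univ := (Finset.card_eq_iff_eq_univ _).1 h5.symm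
      have h6 : σ ^ 2 = 1 := by
        rw [← orderOf_dvd_iff_pow_eq_one, ← Perm.lcm_cycleType, h]
        refine Multiset.lcm_dvd.2 fun b hb => ?_
        rw [Multiset.eq_of_mem_replicate hb]
      refine ⟨fun p => ?_, fun p => ?_⟩
      · have := congrArg (fun τ : Perm P => τ p) h6
        simpa [sq] using this
      · exact Perm.mem_support.1 (h4 ▸ Finset.mem_univ p)
  rw [h1]
  have h2 := Perm.card_of_cycleType_mul_eq P (Multiset.replicate m 2)
  rw [if_pos (by
    constructor
    · simp [hm, mul_comm]
    · intro a ha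
      rw [Multiset.eq_of_mem_replicate ha])] at h2
  rw [← hm, ← h2, hm]
  rcases Nat.eq_zero_or_pos m with rfl | hm0
  · simp
  · congr 1
    rw [Multiset.sum_replicate, Multiset.prod_replicate, Multiset.toFinset_replicate, if_neg hm0.ne']
    simp [mul_comm]

/-- The graph on the cells induced by a pairing of the points. -/
def pairingGraph (v : P → V) (σ : Perm P) : SimpleGraph V :=
  SimpleGraph.fromRel fun u w => ∃ p, v p = u ∧ v (σ p) = w

variable {v : P → V} {X : SimpleGraph V}

lemma IsSimplePairing.pairingGraph_adj {σ : Perm P} (h : IsSimplePairing v X σ) {u w : V} :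
    (pairingGraph v σ).Adj u w ↔ ∃ p, v p = u ∧ v (σ p) = w := by
  rw [pairingGraph, SimpleGraph.fromRel_adj]
  constructor
  · rintro ⟨-, h' | ⟨p, h1, h2⟩⟩
    · exact h'
    · exact ⟨σ p, h2, by rw [h.1.1]; exact h1⟩
  · rintro ⟨p, h1, h2⟩
    exact ⟨fun h' => (h.2.1 p).1 (by rw [h1, h2, h']), Or.inl ⟨p, h1, h2⟩⟩

variable [Fintype P] [Fintype V]

lemma IsSimplePairing.degree_pairingGraph {σ : Perm P} (h : IsSimplePairing v X σ) (u : V) :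
    (pairingGraph v σ).degree u = (Finset.univ.filter fun p => v p = u).card := by
  rw [← SimpleGraph.card_neighborFinset_eq_degree]
  symm
  refine Finset.card_bij (fun p _ => v (σ p)) ?_ ?_ ?_
  · intro p hp
    rw [SimpleGraph.mem_neighborFinset, h.pairingGraph_adj]
    exact ⟨p, (Finset.mem_filter.1 hp).2, rfl⟩
  · intro p hp p' hp' he
    by_contra hne
    exact h.2.2 p p' hne ((Finset.mem_filter.1 hp).2.trans (Finset.mem_filter.1 hp').2.symm) he
  · intro w hw
    rw [SimpleGraph.mem_neighborFinset, h.pairingGraph_adj] at hw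
    obtain ⟨p, h1, h2⟩ := hw
    exact ⟨p, Finset.mem_filter.2 ⟨Finset.mem_univ _, h1⟩, h2⟩

lemma card_pairingGraph_fiber {g : V → ℕ}
    (hg : ∀ u, (Finset.univ.filter fun p => v p = u).card = g u) {G : SimpleGraph V}
    (hG : ∀ u, G.degree u = g u) (hX : ∀ u w, G.Adj u w → ¬ X.Adj u w) :
    (Finset.univ.filter fun σ : Perm P => IsSimplePairing v X σ ∧ pairingGraph v σ = G).card
      = ∏ u, (g u).factorial := by
  have hcard : ∀ u, Fintype.card {p // v p = u} = Fintype.card {d : G.Dart // d.fst = u} := by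
    intro u
    rw [Fintype.card_subtype, Fintype.card_subtype, hg, ← hG u, ← G.dart_fst_fiber_card_eq_degree u]
  let f₀ : P ≃ G.Dart := (Equiv.sigmaFiberEquiv v).symm.trans
    ((Equiv.sigmaCongrRight fun u => Fintype.equivOfCardEq (hcard u)).trans
      (Equiv.sigmaFiberEquiv fun d : G.Dart => d.fst))
  have hf₀ : ∀ p, (f₀ p).fst = v p := fun p =>
    (Fintype.equivOfCardEq (hcard (v p)) ⟨p, rfl⟩).2
  have hf₀' : ∀ d, v (f₀.symm d) = d.fst := fun d => by
    rw [← hf₀, Equiv.apply_symm_apply]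
  let S : Perm G.Dart := ⟨SimpleGraph.Dart.symm, SimpleGraph.Dart.symm, fun d => d.symm_symm,
    fun d => d.symm_symm⟩
  let conj : Perm P → Perm P := fun e => (e.trans f₀).trans (S.trans (e.trans f₀).symm)
  have hS : ∀ d : G.Dart, (S d).fst = d.snd := fun d => rfl
  have hSS : ∀ d : G.Dart, S (S d) = d := fun d => d.symm_symm
  have key : ∀ e : Perm P, v ∘ e = v → ∀ p, v (conj e p) = (f₀ (e p)).snd := by
    intro e he p
    have : v (conj e p) = v (e (conj e p)) := (congrFun he _).symm
    rw [this]
    simp [conj, hf₀', hS]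
  have key1 : ∀ e : Perm P, v ∘ e = v → ∀ p, (f₀ (e p)).fst = v p := by
    intro e he p
    rw [hf₀]; exact congrFun he p
  have hstab : (Finset.univ.filter fun e : Perm P => v ∘ e = v).card = ∏ u, (g u).factorial := by
    have h1 := DomMulAct.stabilizer_card (f := v)
    rw [Fintype.card_subtype] at h1
    convert h1 using 2 with u
    rw [← hg u, Fintype.card_subtype]
  rw [← hstab]
  symm
  refine Finset.card_bij (fun e _ => conj e) ?_ ?_ ?_
  · intro e he
    have he := (Finset.mem_filter.1 he).2
    have hs : IsSimplePairing v X (conj e) := by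
      refine ⟨⟨fun p => ?_, fun p hp => ?_⟩, fun p => ?_, fun p p' hne hv hv' => hne ?_⟩
      · simp [conj, hSS]
      · have h1 := key e he p
        rw [hp, ← key1 e he p] at h1
        exact (f₀ (e p)).fst_ne_snd h1
      · rw [key e he, ← key1 e he p]
        exact ⟨(f₀ (e p)).fst_ne_snd, hX _ _ (f₀ (e p)).adj⟩
      · rw [key e he, key e he] at hv'
        have h1 : (f₀ (e p)).fst = (f₀ (e p')).fst := by rw [key1 e he, key1 e he, hv]
        exact e.injective (f₀.injective (SimpleGraph.Dart.ext _ _ (Prod.ext h1 hv')))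
    refine Finset.mem_filter.2 ⟨Finset.mem_univ _, hs, ?_⟩
    ext u w
    rw [hs.pairingGraph_adj]
    constructor
    · rintro ⟨p, rfl, rfl⟩
      rw [key e he, ← key1 e he p]
      exact (f₀ (e p)).adj
    · intro h
      refine ⟨e.symm (f₀.symm ⟨(u, w), h⟩), ?_, ?_⟩
      · rw [← key1 e he]; simp
      · rw [key e he]; simp
  · intro e he e' he' hee
    have he := (Finset.mem_filter.1 he).2
    have he' := (Finset.mem_filter.1 he').2
    ext p
    refine f₀.injective (SimpleGraph.Dart.ext _ _ (Prod.ext ?_ ?_))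
    · exact (key1 e he p).trans (key1 e' he' p).symm
    · have := key e he p
      rw [hee, key e' he' p] at this
      exact this.symm
  · intro σ hσ
    obtain ⟨hs, hGσ⟩ := (Finset.mem_filter.1 hσ).2
    subst hGσ
    let f : P → (pairingGraph v σ).Dart := fun p =>
      ⟨(v p, v (σ p)), hs.pairingGraph_adj.2 ⟨p, rfl, rfl⟩⟩
    have hinj : Function.Injective f := by
      intro p p' h
      by_contra hne
      have h1 : v p = v p' := congrArg (fun d => d.fst) h
      have h2 : v (σ p) = v (σ p') := congrArg (fun d => d.snd) h
      exact hs.2.2 p p' hne h1 h2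
    have hbij : Function.Bijective f :=
      (Fintype.bijective_iff_injective_and_card f).2 ⟨hinj, Fintype.card_congr f₀⟩
    let fe : P ≃ (pairingGraph v σ).Dart := Equiv.ofBijective f hbij
    have hfe : ∀ p, fe p = f p := fun p => rfl
    refine ⟨fe.trans f₀.symm, ?_, ?_⟩
    · refine Finset.mem_filter.2 ⟨Finset.mem_univ _, ?_⟩
      funext p
      simp only [Function.comp_apply, Equiv.trans_apply, hf₀']
      rfl
    · ext p
      refine fe.injective ?_
      simp only [conj, Equiv.trans_apply, Equiv.symm_trans_apply, Equiv.apply_symm_apply,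
        Equiv.symm_symm]
      refine SimpleGraph.Dart.ext _ _ (Prod.ext rfl ?_)
      change v p = v (σ (σ p))
      rw [hs.1.1]

lemma card_isSimplePairing {g : V → ℕ}
    (hg : ∀ u, (Finset.univ.filter fun p => v p = u).card = g u) :
    (Finset.univ.filter fun σ : Perm P => IsSimplePairing v X σ).card
      = (Finset.univ.filter fun G : SimpleGraph V => (∀ u, G.degree u = g u) ∧
          ∀ u w, G.Adj u w → ¬ X.Adj u w).card * ∏ u, (g u).factorial := by
  rw [Finset.card_eq_sum_card_fiberwise (f := pairingGraph v)
    (t := Finset.univ.filter fun G : SimpleGraph V => (∀ u, G.degree u = g u) ∧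
          ∀ u w, G.Adj u w → ¬ X.Adj u w), Finset.sum_const_nat (m := ∏ u, (g u).factorial)]
  · intro G hG
    obtain ⟨h1, h2⟩ := (Finset.mem_filter.1 hG).2
    rw [← card_pairingGraph_fiber hg h1 h2, Finset.filter_filter]
  · intro σ hσ
    have h := (Finset.mem_filter.1 hσ).2
    refine Finset.mem_coe.2 (Finset.mem_filter.2 ⟨Finset.mem_univ _, fun u => ?_, fun u w hA => ?_⟩)
    · rw [← hg u, ← h.degree_pairingGraph]
    · obtain ⟨p, rfl, rfl⟩ := h.pairingGraph_adj.1 hA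
      exact (h.2.1 p).2

end PairingsAndGraphs

section GraphCount

open Equiv

variable {P V : Type} [Fintype P] [Fintype V] {v : P → V} {X : SimpleGraph V} {g : V → ℕ}

lemma card_badPairs_eq (hg : ∀ u, (Finset.univ.filter fun p => v p = u).card = g u) :
    ((badPairs v X).card : ℝ) = ∑ u, (g u : ℝ) * (g u - 1) +
      ∑ u, ∑ w, if X.Adj u w then (g u : ℝ) * g w else 0 := by
  have h1 : (badPairs v X).card = ∑ u, ∑ w,
      ((badPairs v X).filter fun e => (v e.1, v e.2) = (u, w)).card := by
    rw [Finset.card_eq_sum_card_fiberwise (f := fun e : P × P => (v e.1, v e.2))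
      (t := Finset.univ) (by simp [Set.MapsTo]), ← Finset.univ_product_univ, Finset.sum_product]
  have h2 : ∀ u w, (((badPairs v X).filter fun e => (v e.1, v e.2) = (u, w)).card : ℝ)
      = (if u = w then (g u : ℝ) * (g u - 1) else 0) + if X.Adj u w then (g u : ℝ) * g w else 0 := by
    intro u w
    by_cases huw : u = w
    · subst huw
      rw [if_pos rfl, if_neg (X.loopless.irrefl u)]
      have : ((badPairs v X).filter fun e => (v e.1, v e.2) = (u, u))
          = (Finset.univ.filter fun p => v p = u).offDiag := by
        ext ⟨p, q⟩
        simp only [badPairs, Finset.mem_filter, Finset.mem_univ, true_and, Prod.mk.injEq,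
          Finset.mem_offDiag]
        constructor
        · rintro ⟨⟨h1, -⟩, h2, h3⟩
          exact ⟨h2, h3, h1⟩
        · rintro ⟨h1, h2, h3⟩
          exact ⟨⟨h3, Or.inl (h1.trans h2.symm)⟩, h1, h2⟩
      rw [this, Finset.offDiag_card, hg, Nat.cast_sub (Nat.le_mul_self _)]
      push_cast
      ring
    · rw [if_neg huw]
      by_cases hadj : X.Adj u w
      · rw [if_pos hadj]
        have : ((badPairs v X).filter fun e => (v e.1, v e.2) = (u, w))
            = (Finset.univ.filter fun p => v p = u) ×ˢ (Finset.univ.filter fun p => v p = w) := by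
          ext ⟨p, q⟩
          simp only [badPairs, Finset.mem_filter, Finset.mem_univ, true_and, Prod.mk.injEq,
            Finset.mem_product]
          constructor
          · rintro ⟨-, h⟩
            exact h
          · rintro ⟨rfl, rfl⟩
            exact ⟨⟨fun h => huw (h ▸ rfl), Or.inr hadj⟩, rfl, rfl⟩
        rw [this, Finset.card_product, hg, hg]
        push_cast
        ring
      · rw [if_neg hadj]
        have : ((badPairs v X).filter fun e => (v e.1, v e.2) = (u, w)) = ∅ := by
          refine Finset.filter_eq_empty_iff.2 fun e he h => ?_
          obtain ⟨h3, h4⟩ := Prod.mk.inj h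
          subst h3 h4
          rcases (Finset.mem_filter.1 he).2.2 with h5 | h5
          exacts [huw h5, hadj h5]
        rw [this]
        simp
  rw [h1]
  push_cast
  simp only [h2, Finset.sum_add_distrib]
  simp

lemma card_doublePairs_eq (hg : ∀ u, (Finset.univ.filter fun p => v p = u).card = g u) :
    ((doublePairs v).card : ℝ) = ∑ u, ∑ w,
      if u ≠ w then ((g u : ℝ) * (g u - 1)) * (g w * (g w - 1)) else 0 := by
  have h1 : (doublePairs v).card = ∑ u, ∑ w,
      ((doublePairs v).filter fun e => (v e.1, v e.2.1) = (u, w)).card := by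
    rw [Finset.card_eq_sum_card_fiberwise (f := fun e : P × P × P × P => (v e.1, v e.2.1))
      (t := Finset.univ) (by simp [Set.MapsTo]), ← Finset.univ_product_univ, Finset.sum_product]
  rw [h1]
  push_cast
  refine Finset.sum_congr rfl fun u _ => Finset.sum_congr rfl fun w _ => ?_
  split_ifs with huw
  · have : ((doublePairs v).filter fun e => (v e.1, v e.2.1) = (u, w)).card
        = ((Finset.univ.filter fun p => v p = u).offDiag ×ˢ
          (Finset.univ.filter fun p => v p = w).offDiag).card := by
      refine Finset.card_nbij' (fun e => ((e.1, e.2.2.1), (e.2.1, e.2.2.2)))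
        (fun e => (e.1.1, e.2.1, e.1.2, e.2.2)) ?_ ?_ (fun _ _ => rfl) (fun _ _ => rfl)
      · rintro ⟨p, q, p', q'⟩ h
        simp only [doublePairs, Finset.coe_filter, Finset.mem_filter, Finset.mem_univ, true_and,
          Prod.mk.injEq, Set.mem_ofPred_eq] at h
        obtain ⟨⟨h1, h2, h3, h4, h5⟩, h6, h7⟩ := h
        simp only [Finset.coe_product, Set.mem_prod, Finset.mem_coe, Finset.mem_offDiag,
          Finset.mem_filter, Finset.mem_univ, true_and]
        exact ⟨⟨h6, h3 ▸ h6, h1⟩, h7, h4 ▸ h7, h2⟩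
      · rintro ⟨⟨p, p'⟩, q, q'⟩ h
        simp only [Finset.coe_product, Set.mem_prod, Finset.mem_coe, Finset.mem_offDiag,
          Finset.mem_filter, Finset.mem_univ, true_and] at h
        obtain ⟨⟨h1, h2, h3⟩, h4, h5, h6⟩ := h
        simp only [doublePairs, Finset.coe_filter, Finset.mem_filter, Finset.mem_univ, true_and,
          Prod.mk.injEq, Set.mem_ofPred_eq]
        exact ⟨⟨h3, h6, h1.trans h2.symm, h4.trans h5.symm, by rwa [h1, h4]⟩, h1, h4⟩
    rw [this, Finset.card_product, Finset.offDiag_card, Finset.offDiag_card, hg, hg]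
    push_cast
    rw [Nat.cast_sub (Nat.le_mul_self _), Nat.cast_sub (Nat.le_mul_self _)]
    push_cast
    ring
  · rw [Nat.cast_eq_zero, Finset.card_eq_zero]
    refine Finset.filter_eq_empty_iff.2 fun e he h => ?_
    obtain ⟨h3, h4⟩ := Prod.mk.inj h
    subst h3 h4
    exact huw (Finset.mem_filter.1 he).2.2.2.2.2

/-- The number of graphs with prescribed degrees and no edge in common with `X`. -/
noncomputable def graphCount (g : V → ℕ) (X : SimpleGraph V) : ℕ :=
  (Finset.univ.filter fun G : SimpleGraph V => (∀ u, G.degree u = g u) ∧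
    ∀ u w, G.Adj u w → ¬ X.Adj u w).card

lemma exists_graphCount_eq_of_points {D m : ℕ}
    (hg : ∀ u, (Finset.univ.filter fun p => v p = u).card = g u) (hcard : Fintype.card P = 2 * m)
    (hD : ∀ u, g u + X.degree u ≤ D) (hD3 : 3 ≤ D)
    (hDm : D ^ 4 + 2 ≤ 2 * m) :
    ∃ E : ℝ, |E| ≤ 50 * (D : ℝ) ^ 4 / (2 * m : ℕ) ∧
      (graphCount g X : ℝ) * ∏ u, ((g u).factorial : ℝ)
        = ((2 * m).factorial : ℝ) / (2 ^ m * m.factorial) *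
          Real.exp (-((∑ u, (g u : ℝ) * (g u - 1)) / (2 * (2 * m : ℕ)) +
            (∑ u, ∑ w, if u ≠ w then ((g u : ℝ) * (g u - 1)) * (g w * (g w - 1)) else 0)
              / (4 * ((2 * m : ℕ) : ℝ) ^ 2) +
            (∑ u, ∑ w, if X.Adj u w then (g u : ℝ) * g w else 0) / (2 * (2 * m : ℕ))) + E) := by
  obtain ⟨E, hE, h⟩ := exists_card_isSimplePairing_eq (v := v) (X := X) (D := D)
    (fun u => by rw [hg]; exact hD u) hD3 (by rwa [hcard])
  rw [hcard] at hE h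
  refine ⟨E, hE, ?_⟩
  have h2 := card_isSimplePairing (v := v) (X := X) hg
  have h3 : ((Finset.univ.filter fun σ : Perm P => IsSimplePairing v X σ).card : ℝ)
      = graphCount g X * ∏ u, ((g u).factorial : ℝ) := by
    rw [h2]
    push_cast
    rfl
  rw [← h3, h]
  have h4 := card_isPairing_mul hcard
  have h5 : ((Finset.univ.filter fun σ : Perm P => IsPairing σ).card : ℝ)
      = ((2 * m).factorial : ℝ) / (2 ^ m * m.factorial) := by
    rw [eq_div_iff (by positivity)]
    exact_mod_cast h4
  rw [h5, card_badPairs_eq hg, card_doublePairs_eq hg]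
  congr 3
  ring

lemma exists_graphCount_eq {D m : ℕ} (hD : ∀ u, g u + X.degree u ≤ D) (hD3 : 3 ≤ D)
    (hm : ∑ u, g u = 2 * m) (hDm : D ^ 4 + 2 ≤ 2 * m) :
    ∃ E : ℝ, |E| ≤ 50 * (D : ℝ) ^ 4 / (2 * m : ℕ) ∧
      (graphCount g X : ℝ) * ∏ u, ((g u).factorial : ℝ)
        = ((2 * m).factorial : ℝ) / (2 ^ m * m.factorial) *
          Real.exp (-((∑ u, (g u : ℝ) * (g u - 1)) / (2 * (2 * m : ℕ)) +
            (∑ u, ∑ w, if u ≠ w then ((g u : ℝ) * (g u - 1)) * (g w * (g w - 1)) else 0)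
              / (4 * ((2 * m : ℕ) : ℝ) ^ 2) +
            (∑ u, ∑ w, if X.Adj u w then (g u : ℝ) * g w else 0) / (2 * (2 * m : ℕ))) + E) := by
  refine exists_graphCount_eq_of_points (v := (Sigma.fst : (Σ u, Fin (g u)) → V)) (fun u => ?_)
    (by simp [hm]) hD hD3 hDm
  rw [← Fintype.card_subtype, Fintype.card_congr (Equiv.sigmaSubtype u), Fintype.card_fin]

end GraphCount

section RootedFunctions

variable {V : Type} {k : V} {π ρ : V → V}

/-- Parent functions of trees rooted at `k`. -/
def IsRooted (k : V) (π : V → V) : Prop := π k = k ∧ ∀ v, ∃ m, π^[m] v = k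

/-- The vertex `v` lies on the forward orbit of `u`. -/
def Below (π : V → V) (u v : V) : Prop := ∃ m, π^[m] u = v

/-- The graph joining every vertex to its parent. -/
def parentGraph (π : V → V) : SimpleGraph V := SimpleGraph.fromRel fun a b => π a = b

lemma Below.step {u v : V} (h : Below π (π u) v) : Below π u v := by
  obtain ⟨m, hm⟩ := h
  exact ⟨m + 1, by rwa [Function.iterate_succ_apply]⟩

lemma below_iff {u v : V} : Below π u v ↔ u = v ∨ Below π (π u) v := by
  constructor
  · rintro ⟨m, hm⟩
    cases m with
    | zero => exact Or.inl hm
    | succ m => exact Or.inr ⟨m, by rwa [Function.iterate_succ_apply] at hm⟩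
  · rintro (rfl | h)
    exacts [⟨0, rfl⟩, h.step]

lemma IsRooted.iterate_root (h : IsRooted k π) (m : ℕ) : π^[m] k = k :=
  Function.iterate_fixed h.1 m

lemma IsRooted.not_below_apply (h : IsRooted k π) {z : V} (hz : z ≠ k) : ¬ Below π (π z) z := by
  rintro ⟨m, hm⟩
  rw [← Function.iterate_succ_apply] at hm
  obtain ⟨r, hr⟩ := h.2 z
  have h1 : π^[(m + 1) * r] z = z := Function.IsPeriodicPt.mul_const (m := m + 1) hm r
  have h2 : (m + 1) * r = m * r + r := by ring
  rw [h2, Function.iterate_add_apply, hr, h.iterate_root] at h1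
  exact hz h1.symm

lemma IsRooted.apply_ne (h : IsRooted k π) {z : V} (hz : z ≠ k) : π z ≠ z := fun h' =>
  h.not_below_apply hz ⟨0, h'⟩

lemma isRooted_of_agree (h : IsRooted k π) (S : Set V) (hk : ρ k = k)
    (hagree : ∀ v ∉ S, ρ v = π v) (hS : ∀ v ∈ S, Below ρ v k) : IsRooted k ρ := by
  refine ⟨hk, fun v => ?_⟩
  obtain ⟨m, hm⟩ := h.2 v
  induction m generalizing v with
  | zero => exact ⟨0, hm⟩
  | succ m ih =>
    by_cases hv : v ∈ S
    · exact hS v hv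
    · rw [Function.iterate_succ_apply, ← hagree v hv] at hm
      exact Below.step (ih (ρ v) hm)

lemma iterate_eq_of_avoid {S : Set V} (hagree : ∀ v ∉ S, ρ v = π v) {u : V}
    (hu : ∀ s ∈ S, ¬ Below π u s) (m : ℕ) : ρ^[m] u = π^[m] u := by
  induction m with
  | zero => rfl
  | succ m ih =>
    rw [Function.iterate_succ_apply', Function.iterate_succ_apply', ih]
    exact hagree _ fun h => hu _ h ⟨m, rfl⟩

lemma below_iff_of_avoid {S : Set V} (hagree : ∀ v ∉ S, ρ v = π v) {u v : V}
    (hu : ∀ s ∈ S, ¬ Below π u s) : Below ρ u v ↔ Below π u v := by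
  simp only [Below, iterate_eq_of_avoid hagree hu]

lemma IsRooted.existsUnique_child (h : IsRooted k π) {a : V} (ha : a ≠ k) :
    ∃ z, (z ≠ k ∧ π z = k ∧ Below π a z) ∧ ∀ z', z' ≠ k → π z' = k → Below π a z' → z' = z := by
  have hex := h.2 a
  obtain ⟨m, hm⟩ : ∃ m, Nat.find hex = m + 1 := by
    refine Nat.exists_eq_succ_of_ne_zero fun h0 => ?_
    have := Nat.find_spec hex
    rw [h0] at this
    exact ha this
  have hspec := Nat.find_spec hex
  rw [hm, Function.iterate_succ_apply'] at hspec
  refine ⟨π^[m] a, ⟨fun h0 => ?_, hspec, m, rfl⟩, ?_⟩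
  · exact Nat.find_min hex (m := m) (by omega) h0
  · rintro z' hz' hzk ⟨r, hr⟩
    have aux : ∀ i j, i < j → π (π^[i] a) = k → π^[j] a = k := by
      intro i j hij hi
      obtain ⟨t, rfl⟩ : ∃ t, j = t + (i + 1) := ⟨j - (i + 1), by omega⟩
      rw [Function.iterate_add_apply, Function.iterate_succ_apply', hi, h.iterate_root]
    rcases lt_trichotomy r m with hlt | rfl | hlt
    · exact absurd (aux r m hlt (by rw [hr, hzk])) (Nat.find_min hex (by omega))
    · exact hr.symm
    · exact absurd (hr.symm.trans (aux m r hlt hspec)) hz'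

lemma parentGraph_adj (h : IsRooted k π) {a b : V} :
    (parentGraph π).Adj a b ↔ a ≠ k ∧ π a = b ∨ b ≠ k ∧ π b = a := by
  rw [parentGraph, SimpleGraph.fromRel_adj]
  constructor
  · rintro ⟨hne, rfl | rfl⟩
    · exact Or.inl ⟨fun ha => hne (by rw [ha, h.1]), rfl⟩
    · exact Or.inr ⟨fun ha => hne (by rw [ha, h.1]), rfl⟩
  · rintro (⟨h1, rfl⟩ | ⟨h1, rfl⟩)
    · exact ⟨(h.apply_ne h1).symm, Or.inl rfl⟩
    · exact ⟨h.apply_ne h1, Or.inr rfl⟩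

lemma parentGraph_adj_root (h : IsRooted k π) {j : V} :
    (parentGraph π).Adj j k ↔ j ≠ k ∧ π j = k := by
  rw [parentGraph_adj h]
  simp

lemma IsRooted.reachable (h : IsRooted k π) (v : V) : (parentGraph π).Reachable v k := by
  obtain ⟨m, hm⟩ := h.2 v
  induction m generalizing v with
  | zero => exact hm ▸ SimpleGraph.Reachable.refl _
  | succ m ih =>
    by_cases hv : v = k
    · exact hv ▸ SimpleGraph.Reachable.refl _
    · exact ((parentGraph_adj h).2 (Or.inl ⟨hv, rfl⟩)).reachable.trans
        (ih (π v) (by rwa [Function.iterate_succ_apply] at hm))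

lemma IsRooted.eq_of_parentGraph_eq (h : IsRooted k π) (h' : IsRooted k ρ)
    (heq : parentGraph π = parentGraph ρ) : π = ρ := by
  funext v
  obtain ⟨m, hm⟩ := h.2 v
  induction m generalizing v with
  | zero =>
    have : v = k := hm
    rw [this, h.1, h'.1]
  | succ m ih =>
    by_cases hv : v = k
    · rw [hv, h.1, h'.1]
    · have h1 := ih (π v) (by rwa [Function.iterate_succ_apply] at hm)
      have h2 : (parentGraph ρ).Adj v (π v) := heq ▸ (parentGraph_adj h).2 (Or.inl ⟨hv, rfl⟩)
      rcases (parentGraph_adj h').1 h2 with ⟨-, h3⟩ | ⟨-, h3⟩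
      · exact h3.symm
      · exact absurd ⟨1, by rw [Function.iterate_one, h1, h3]⟩ (h.not_below_apply hv)

variable [Fintype V]

lemma IsRooted.isTree (h : IsRooted k π) : (parentGraph π).IsTree := by
  have hconn : (parentGraph π).Connected := by
    have : Nonempty V := ⟨k⟩
    exact ⟨fun u v => (h.reachable u).trans (h.reachable v).symm⟩
  refine SimpleGraph.isTree_iff_connected_and_card.2 ⟨hconn, le_antisymm ?_
    hconn.card_vert_le_card_edgeSet_add_one⟩
  have hsub : (parentGraph π).edgeSet ⊆
      ((Finset.univ.erase k).image fun v => s(v, π v) : Finset (Sym2 V)) := by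
    intro e
    induction e with
    | h a b =>
      intro he
      rw [SimpleGraph.mem_edgeSet, parentGraph_adj h] at he
      rw [Finset.mem_coe, Finset.mem_image]
      rcases he with ⟨h1, rfl⟩ | ⟨h1, rfl⟩
      · exact ⟨a, by simp [h1], rfl⟩
      · exact ⟨b, by simp [h1], Sym2.eq_swap⟩
  have h1 := Set.ncard_le_ncard hsub (Finset.finite_toSet _)
  rw [Set.ncard_coe_finset] at h1
  have h2 := h1.trans Finset.card_image_le
  rw [Finset.card_erase_of_mem (Finset.mem_univ k), Finset.card_univ] at h2
  have h3 : 0 < Fintype.card V := Fintype.card_pos_iff.2 ⟨k⟩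
  rw [Nat.card_coe_set_eq, Nat.card_eq_fintype_card]
  omega

lemma exists_isRooted_of_isTree {T : SimpleGraph V} (hT : T.IsTree) (k : V) :
    ∃ π, IsRooted k π ∧ parentGraph π = T := by
  have hstep : ∀ v, v ≠ k → ∃ w, T.Adj v w ∧ T.dist w k + 1 = T.dist v k := by
    intro v hv
    obtain ⟨p, hp⟩ := hT.1.exists_walk_length_eq_dist v k
    cases p with
    | nil => exact absurd rfl hv
    | cons hadj q =>
      rename_i w
      refine ⟨w, hadj, ?_⟩
      have h1 := SimpleGraph.dist_le q
      have h2 := hT.1.dist_triangle (u := v) (v := w) (w := k)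
      rw [SimpleGraph.dist_eq_one_iff_adj.2 hadj] at h2
      rw [SimpleGraph.Walk.length_cons] at hp
      omega
  choose! f hf using hstep
  let π : V → V := fun v => if v = k then k else f v
  have hπ : ∀ v, v ≠ k → π v = f v := fun v hv => if_neg hv
  have hr : IsRooted k π := by
    refine ⟨if_pos rfl, fun v => ?_⟩
    obtain ⟨m, hm⟩ : ∃ m, T.dist v k = m := ⟨_, rfl⟩
    induction m generalizing v with
    | zero => exact ⟨0, hT.1.dist_eq_zero_iff.1 hm⟩
    | succ m ih =>
      have hv : v ≠ k := by
        rintro rfl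
        simp at hm
      refine Below.step (ih (π v) ?_)
      have := (hf v hv).2
      rw [hπ v hv]
      omega
  refine ⟨π, hr, ?_⟩
  have hle : parentGraph π ≤ T := by
    intro a b hab
    rcases (parentGraph_adj hr).1 hab with ⟨h1, rfl⟩ | ⟨h1, rfl⟩
    · rw [hπ a h1]; exact (hf a h1).1
    · rw [hπ b h1]; exact (hf b h1).1.symm
  have h1 := (SimpleGraph.isTree_iff_connected_and_card.1 hr.isTree).2
  have h2 := (SimpleGraph.isTree_iff_connected_and_card.1 hT).2
  rw [← SimpleGraph.edgeSet_inj]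
  refine Set.eq_of_subset_of_ncard_le (SimpleGraph.edgeSet_subset_edgeSet.2 hle) ?_ (Set.toFinite _)
  rw [Nat.card_coe_set_eq] at h1 h2
  omega

/-- The number of children of `v`. -/
noncomputable def childCount (k : V) (π : V → V) (v : V) : ℕ :=
  (Finset.univ.filter fun u => u ≠ k ∧ π u = v).card

lemma IsRooted.degree_parentGraph (h : IsRooted k π) (v : V) :
    (parentGraph π).degree v = childCount k π v + if v = k then 0 else 1 := by
  have h1 : (parentGraph π).neighborFinset v = (Finset.univ.filter fun u => u ≠ k ∧ π u = v) ∪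
      if v = k then ∅ else {π v} := by
    ext u
    rw [SimpleGraph.mem_neighborFinset, parentGraph_adj h]
    split_ifs with hv <;> simp [hv, eq_comm]
  rw [← SimpleGraph.card_neighborFinset_eq_degree, h1, Finset.card_union_of_disjoint]
  · split_ifs <;> simp [childCount]
  · split_ifs with hv
    · simp
    · rw [Finset.disjoint_singleton_right]
      intro hm
      exact h.not_below_apply hv ⟨1, (Finset.mem_filter.1 hm).2.2⟩

end RootedFunctions

section TreeCount

variable {V : Type} [Fintype V] {k : V}

/-- The parent functions rooted at `k` with prescribed numbers of children. -/
noncomputable def rootedFunctions (k : V) (c : V → ℕ) : Finset (V → V) :=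
  Finset.univ.filter fun π => IsRooted k π ∧ ∀ v, childCount k π v = c v

lemma mem_rootedFunctions {c : V → ℕ} {π : V → V} :
    π ∈ rootedFunctions k c ↔ IsRooted k π ∧ ∀ v, childCount k π v = c v := by
  simp [rootedFunctions]

lemma childCount_update (π : V → V) {z : V} (hz : z ≠ k) (b v : V) :
    childCount k (Function.update π z b) v + (if v = π z then 1 else 0)
      = childCount k π v + if v = b then 1 else 0 := by
  have key : ∀ ρ : V → V, childCount k ρ v = (if v = ρ z then 1 else 0) +
      ∑ u ∈ Finset.univ.erase z, if u ≠ k ∧ ρ u = v then 1 else 0 := by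
    intro ρ
    rw [childCount, Finset.card_filter, ← Finset.add_sum_erase _ _ (Finset.mem_univ z)]
    simp [hz, eq_comm]
  rw [key, key π, Function.update_self]
  have : ∑ u ∈ Finset.univ.erase z, (if u ≠ k ∧ Function.update π z b u = v then 1 else 0)
      = ∑ u ∈ Finset.univ.erase z, if u ≠ k ∧ π u = v then 1 else 0 := by
    refine Finset.sum_congr rfl fun u hu => ?_
    rw [Function.update_of_ne (Finset.ne_of_mem_erase hu)]
  rw [this]
  ring

lemma IsRooted.card_children_not_above {π : V → V} (h : IsRooted k π) {a : V} (ha : a ≠ k) :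
    (Finset.univ.filter fun z => z ≠ k ∧ π z = k ∧ ¬ Below π a z).card + 1 = childCount k π k := by
  obtain ⟨z, hz, huniq⟩ := h.existsUnique_child ha
  have : (Finset.univ.filter fun z => z ≠ k ∧ π z = k ∧ ¬ Below π a z)
      = (Finset.univ.filter fun u => u ≠ k ∧ π u = k).erase z := by
    ext u
    simp only [Finset.mem_filter, Finset.mem_univ, true_and, Finset.mem_erase]
    constructor
    · rintro ⟨h1, h2, h3⟩
      exact ⟨fun hu => h3 (hu ▸ hz.2.2), h1, h2⟩
    · rintro ⟨h1, h2, h3⟩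
      exact ⟨h2, h3, fun h4 => h1 (huniq u h2 h3 h4)⟩
  rw [this]
  exact Finset.card_erase_add_one (Finset.mem_filter.2 ⟨Finset.mem_univ _, hz.1, hz.2.1⟩)

lemma card_pairs_eq {α β : Type} (s : Finset α) (t : Finset β) (r : α → β → Prop)
    [∀ a, DecidablePred (r a)] [DecidablePred fun e : α × β => r e.1 e.2] {m : ℕ}
    (h : ∀ a ∈ s, (t.filter (r a)).card = m) :
    ((s ×ˢ t).filter fun e => r e.1 e.2).card = s.card * m := by
  rw [Finset.card_filter, Finset.sum_product, Finset.card_eq_sum_ones, Finset.sum_mul]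
  refine Finset.sum_congr rfl fun a ha => ?_
  simp only [one_mul, ← h a ha, Finset.card_filter]
  congr!

lemma card_rootedFunctions_mul_eq {c c' : V → ℕ} {a : V} (ha : a ≠ k)
    (hcc : ∀ v, c v + (if v = k then 1 else 0) = c' v + if v = a then 1 else 0) :
    (rootedFunctions k c).card * c a = (rootedFunctions k c').card * c k := by
  have hck : c' k = c k + 1 := by
    have := hcc k
    rw [if_pos rfl, if_neg ha.symm] at this
    omega
  rw [← card_pairs_eq (rootedFunctions k c) Finset.univ (fun π z => z ≠ k ∧ π z = a) (m := c a)
    (fun π hπ => by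
      rw [← (mem_rootedFunctions.1 hπ).2 a]
      rfl),
    ← card_pairs_eq (rootedFunctions k c') Finset.univ
      (fun π z => z ≠ k ∧ π z = k ∧ ¬ Below π a z) (m := c k) (fun π hπ => by
        have := (mem_rootedFunctions.1 hπ).1.card_children_not_above ha
        rw [(mem_rootedFunctions.1 hπ).2 k, hck] at this
        omega)]
  refine Finset.card_nbij' (fun e => (Function.update e.1 e.2 k, e.2))
    (fun e => (Function.update e.1 e.2 a, e.2)) ?_ ?_ ?_ ?_
  · rintro ⟨π, z⟩ he
    obtain ⟨h1, hz, hza⟩ := Finset.mem_filter.1 he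
    obtain ⟨hr, hc⟩ := mem_rootedFunctions.1 (Finset.mem_product.1 h1).1
    dsimp only at hz hza hr hc
    have hagree : ∀ v ∉ ({z} : Set V), Function.update π z k v = π v := fun v hv =>
      Function.update_of_ne hv _ _
    have hav : ∀ s ∈ ({z} : Set V), ¬ Below π a s := by
      rintro s rfl
      rw [← hza]
      exact hr.not_below_apply hz
    refine Finset.mem_coe.2 (Finset.mem_filter.2 ⟨Finset.mem_product.2
      ⟨mem_rootedFunctions.2 ⟨?_, fun v => ?_⟩, Finset.mem_univ _⟩, hz, ?_, ?_⟩)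
    · dsimp only
      refine isRooted_of_agree hr {z} ?_ hagree ?_
      · rw [hagree k hz.symm, hr.1]
      · rintro s rfl
        exact ⟨1, by simp⟩
    · have h2 := childCount_update π hz k v
      have h3 := hcc v
      rw [hc, hza] at h2
      dsimp only
      omega
    · simp
    · dsimp only
      rw [below_iff_of_avoid hagree hav]
      exact hav z rfl
  · rintro ⟨π, z⟩ he
    obtain ⟨h1, hz, hzk, hb⟩ := Finset.mem_filter.1 he
    obtain ⟨hr, hc⟩ := mem_rootedFunctions.1 (Finset.mem_product.1 h1).1
    dsimp only at hz hzk hb hr hc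
    have hagree : ∀ v ∉ ({z} : Set V), Function.update π z a v = π v := fun v hv =>
      Function.update_of_ne hv _ _
    have hav : ∀ s ∈ ({z} : Set V), ¬ Below π a s := by
      rintro s rfl
      exact hb
    refine Finset.mem_coe.2 (Finset.mem_filter.2 ⟨Finset.mem_product.2
      ⟨mem_rootedFunctions.2 ⟨?_, fun v => ?_⟩, Finset.mem_univ _⟩, hz, ?_⟩)
    · dsimp only
      refine isRooted_of_agree hr {z} ?_ hagree ?_
      · rw [hagree k hz.symm, hr.1]
      · rintro s rfl
        refine Below.step ?_
        rw [Function.update_self, below_iff_of_avoid hagree hav]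
        exact hr.2 a
    · have h2 := childCount_update π hz a v
      have h3 := hcc v
      rw [hc, hzk] at h2
      dsimp only
      omega
    · simp
  · rintro ⟨π, z⟩ he
    obtain ⟨h1, hz, hza⟩ := Finset.mem_filter.1 he
    simp only [Function.update_idem, Prod.mk.injEq, and_true]
    exact Function.update_eq_iff.2 ⟨hza.symm, fun _ _ => rfl⟩
  · rintro ⟨π, z⟩ he
    obtain ⟨h1, hz, hza, -⟩ := Finset.mem_filter.1 he
    simp only [Function.update_idem, Prod.mk.injEq, and_true]
    exact Function.update_eq_iff.2 ⟨hza.symm, fun _ _ => rfl⟩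

/-- The number of rooted trees with prescribed numbers of children. -/
lemma card_rootedFunctions {n : ℕ} (hn : Fintype.card V = n + 2) {c : V → ℕ}
    (hc : ∑ v, c v = n + 1) :
    (rootedFunctions k c).card * ∏ v, (c v).factorial = c k * n.factorial := by
  obtain ⟨r, hr⟩ : ∃ r, c k + r = n + 1 :=
    ⟨n + 1 - c k, Nat.add_sub_cancel' (hc ▸ Finset.single_le_sum (fun _ _ => Nat.zero_le _)
      (Finset.mem_univ k))⟩
  induction r generalizing c with
  | zero =>
    have h0 : ∀ v, v ≠ k → c v = 0 := by
      intro v hv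
      have h1 := Finset.add_sum_erase Finset.univ c (Finset.mem_univ k)
      have h2 : ∑ u ∈ Finset.univ.erase k, c u = 0 := by omega
      exact Finset.sum_eq_zero_iff.1 h2 v (by simp [hv])
    have h1 : ∏ v, (c v).factorial = (n + 1).factorial := by
      rw [← Finset.mul_prod_erase Finset.univ _ (Finset.mem_univ k),
        Finset.prod_eq_one fun v hv => by rw [h0 v (Finset.ne_of_mem_erase hv), Nat.factorial_zero],
        mul_one]
      congr 1
    have h2 : rootedFunctions k c = {fun _ => k} := by
      ext π
      rw [mem_rootedFunctions, Finset.mem_singleton]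
      constructor
      · rintro ⟨h2, h3⟩
        funext v
        by_cases hv : v = k
        · rw [hv, h2.1]
        · by_contra hne
          have h4 := h3 (π v)
          rw [h0 _ hne, childCount, Finset.card_eq_zero, Finset.filter_eq_empty_iff] at h4
          exact h4 (Finset.mem_univ v) ⟨hv, rfl⟩
      · rintro rfl
        refine ⟨⟨rfl, fun v => ⟨1, rfl⟩⟩, fun v => ?_⟩
        by_cases hv : v = k
        · subst hv
          have : (Finset.univ.filter fun u : V => u ≠ v ∧ v = v) = Finset.univ.erase v := by
            ext u; simp
          rw [childCount, this, Finset.card_erase_of_mem (Finset.mem_univ _), Finset.card_univ]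
          omega
        · rw [h0 v hv, childCount, Finset.card_eq_zero, Finset.filter_eq_empty_iff]
          rintro u - ⟨-, h⟩
          exact hv h.symm
    rw [h1, h2, Finset.card_singleton, one_mul, Nat.factorial_succ]
    congr 1
    omega
  | succ r ih =>
    obtain ⟨a, ha, hca⟩ : ∃ a, a ≠ k ∧ c a ≠ 0 := by
      by_contra! hall
      have h1 := Finset.add_sum_erase Finset.univ c (Finset.mem_univ k)
      rw [Finset.sum_eq_zero fun v hv => hall v (Finset.ne_of_mem_erase hv)] at h1
      omega
    let c' : V → ℕ := fun v => if v = k then c v + 1 else if v = a then c v - 1 else c v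
    have hcc : ∀ v, c v + (if v = k then 1 else 0) = c' v + if v = a then 1 else 0 := by
      intro v
      by_cases h1 : v = k
      · subst h1; simp [c', ha.symm]
      · by_cases h2 : v = a
        · subst h2; simp only [c', if_neg h1, if_pos]; omega
        · simp [c', h1, h2]
    have hsum : ∑ v, c' v = n + 1 := by
      have := Finset.sum_congr (rfl : (Finset.univ : Finset V) = Finset.univ) fun v _ => hcc v
      rw [Finset.sum_add_distrib, Finset.sum_add_distrib, Finset.sum_ite_eq' , Finset.sum_ite_eq'] at this
      simp only [Finset.mem_univ, if_true] at this
      omega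
    have hck : c' k = c k + 1 := by simp [c']
    have h1 := ih hsum (by omega)
    have h2 := card_rootedFunctions_mul_eq (k := k) ha hcc
    have h3 : (∏ v, (c v).factorial) * (c k + 1) = (∏ v, (c' v).factorial) * c a := by
      have h4 : ∀ v, (c v).factorial * (if v = k then c k + 1 else 1)
          = (c' v).factorial * if v = a then c a else 1 := by
        intro v
        by_cases h1 : v = k
        · subst h1
          simp [hck, ha.symm, Nat.factorial_succ, mul_comm]
        · by_cases h2 : v = a
          · subst h2
            simp only [c', if_neg ha, if_pos, mul_one]
            rw [mul_comm, Nat.mul_factorial_pred hca]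
          · simp [c', h1, h2]
      have h5 := Finset.prod_congr (rfl : (Finset.univ : Finset V) = Finset.univ) fun v _ => h4 v
      rw [Finset.prod_mul_distrib, Finset.prod_mul_distrib, Finset.prod_ite_eq',
        Finset.prod_ite_eq'] at h5
      simpa using h5
    rw [hck] at h1
    refine Nat.eq_of_mul_eq_mul_right (Nat.mul_pos (Nat.pos_of_ne_zero hca) (Nat.succ_pos (c k))) ?_
    calc (rootedFunctions k c).card * (∏ v, (c v).factorial) * (c a * (c k + 1))
        = ((rootedFunctions k c).card * c a) * ((∏ v, (c v).factorial) * (c k + 1)) := by ring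
      _ = ((rootedFunctions k c').card * (∏ v, (c' v).factorial)) * (c k * c a) := by
        rw [h2, h3]; ring
      _ = c k * n.factorial * (c a * (c k + 1)) := by rw [h1]; ring

end TreeCount

section TreeSwitching

open Equiv

variable {V : Type} {j k : V} {π : V → V}

lemma IsRooted.comp_swap_of_child (h : IsRooted k π) (hj : j ≠ k) {z : V} (hz : z ≠ k)
    (hzk : π z = k) (hb : ¬ Below π j z) :
    IsRooted k (π ∘ swap j z) ∧ (π ∘ swap j z) j = k ∧ ¬ Below (π ∘ swap j z) z j := by
  have hjz : j ≠ z := fun h' => hb ⟨0, h'⟩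
  have hagree : ∀ v ∉ ({j, z} : Set V), (π ∘ swap j z) v = π v := by
    intro v hv
    simp only [Set.mem_insert_iff, Set.mem_singleton_iff, not_or] at hv
    rw [Function.comp_apply, swap_apply_of_ne_of_ne hv.1 hv.2]
  have hav : ∀ s ∈ ({j, z} : Set V), ¬ Below π (π j) s := by
    rintro s (rfl | rfl)
    exacts [h.not_below_apply hj, fun h' => hb h'.step]
  have h1 : (π ∘ swap j z) j = k := by simp [hzk]
  have h2 : (π ∘ swap j z) z = π j := by simp
  refine ⟨isRooted_of_agree h {j, z} ?_ hagree ?_, h1, ?_⟩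
  · rw [Function.comp_apply, swap_apply_of_ne_of_ne hj.symm hz.symm, h.1]
  · rintro s (rfl | rfl)
    · exact ⟨1, h1⟩
    · refine Below.step ?_
      rw [h2, below_iff_of_avoid hagree hav]
      exact h.2 _
  · rw [below_iff, h2, below_iff_of_avoid hagree hav, not_or]
    exact ⟨hjz.symm, hav j (Or.inl rfl)⟩

lemma IsRooted.comp_swap_of_not_below (h : IsRooted k π) (hj : j ≠ k) {z : V} (hz : z ≠ k)
    (hjk : π j = k) (hb : ¬ Below π z j) :
    IsRooted k (π ∘ swap j z) ∧ (π ∘ swap j z) z = k ∧ ¬ Below (π ∘ swap j z) j z := by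
  rw [swap_comm]
  exact h.comp_swap_of_child hz hj hjk hb

lemma childCount_comp_swap [Fintype V] (hj : j ≠ k) {z : V} (hz : z ≠ k) (v : V) :
    childCount k (π ∘ swap j z) v = childCount k π v := by
  have hk : swap j z k = k := swap_apply_of_ne_of_ne hj.symm hz.symm
  refine Finset.card_nbij' (swap j z) (swap j z) ?_ ?_ ?_ ?_
  · intro u hu
    obtain ⟨h1, h2⟩ := (Finset.mem_filter.1 hu).2
    refine Finset.mem_coe.2 (Finset.mem_filter.2 ⟨Finset.mem_univ _, fun h => h1 ?_, h2⟩)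
    rw [← hk] at h
    exact (swap j z).injective h
  · intro u hu
    obtain ⟨h1, h2⟩ := (Finset.mem_filter.1 hu).2
    refine Finset.mem_coe.2 (Finset.mem_filter.2 ⟨Finset.mem_univ _, fun h => h1 ?_, ?_⟩)
    · rw [← hk] at h
      exact (swap j z).injective h
    · simpa using h2
  · intro u _
    simp
  · intro u _
    simp

/-- The weight of a graph in which the pairs in `I` are penalized. -/
noncomputable def edgeWeight (τ : V × V → ℝ) (I : Finset (V × V)) (T : SimpleGraph V) : ℝ :=
  Real.exp (-∑ e ∈ I, if T.Adj e.1 e.2 then τ e else 0)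

lemma edgeWeight_parentGraph_le {ρ : V → V} (hπ : IsRooted k π) (hρ : IsRooted k ρ) {z : V}
    (hagree : ∀ v, v ≠ j → v ≠ z → ρ v = π v) {τ : V × V → ℝ} {t : ℝ} (hτ0 : ∀ e, 0 ≤ τ e)
    (hτ : ∀ e, τ e ≤ t) (I : Finset (V × V)) :
    edgeWeight τ I (parentGraph π) ≤ Real.exp (4 * t) * edgeWeight τ I (parentGraph ρ) := by
  rw [edgeWeight, edgeWeight, ← Real.exp_add, Real.exp_le_exp]
  have ht : ∀ e₀ : V × V, ∑ e ∈ I, (if e = e₀ then t else 0) ≤ t := by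
    intro e₀
    rw [Finset.sum_ite_eq']
    split_ifs
    exacts [le_rfl, (hτ0 e₀).trans (hτ e₀)]
  have key : ∑ e ∈ I, (if (parentGraph ρ).Adj e.1 e.2 then τ e else 0)
      ≤ ∑ e ∈ I, ((if (parentGraph π).Adj e.1 e.2 then τ e else 0) +
        ((if e = (j, ρ j) then t else 0) + (if e = (ρ j, j) then t else 0) +
          (if e = (z, ρ z) then t else 0) + (if e = (ρ z, z) then t else 0))) := by
    refine Finset.sum_le_sum ?_
    rintro ⟨a, b⟩ -
    have h0 : 0 ≤ t := (hτ0 (a, b)).trans (hτ (a, b))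
    have hnn : ∀ (p : Prop) [Decidable p], (0 : ℝ) ≤ if p then t else 0 := by
      intro p _; split_ifs <;> simp [h0]
    have h1 := hnn ((a, b) = (j, ρ j))
    have h2 := hnn ((a, b) = (ρ j, j))
    have h3 := hnn ((a, b) = (z, ρ z))
    have h4 := hnn ((a, b) = (ρ z, z))
    have h6 : 0 ≤ if (parentGraph π).Adj a b then τ (a, b) else 0 := by
      split_ifs
      exacts [hτ0 _, le_rfl]
    by_cases hadj : (parentGraph ρ).Adj a b
    swap
    · rw [if_neg hadj]
      positivity
    rw [if_pos hadj]
    by_cases hadj' : (parentGraph π).Adj a b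
    · rw [if_pos hadj']
      linarith
    have h5 := hτ (a, b)
    rcases (parentGraph_adj hρ).1 hadj with ⟨h7, rfl⟩ | ⟨h7, rfl⟩
    · by_cases haj : a = j
      · subst haj
        rw [if_pos rfl] at h1 ⊢
        linarith
      · by_cases haz : a = z
        · subst haz
          rw [if_pos rfl] at h3 ⊢
          linarith
        · exact absurd ((parentGraph_adj hπ).2 (Or.inl ⟨h7, (hagree a haj haz).symm⟩)) hadj'
    · by_cases haj : b = j
      · subst haj
        rw [if_pos rfl] at h2 ⊢
        linarith
      · by_cases haz : b = z
        · subst haz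
          rw [if_pos rfl] at h4 ⊢
          linarith
        · exact absurd ((parentGraph_adj hπ).2 (Or.inr ⟨h7, (hagree b haj haz).symm⟩)) hadj'
  simp only [Finset.sum_add_distrib] at key
  have := ht (j, ρ j)
  have := ht (ρ j, j)
  have := ht (z, ρ z)
  have := ht (ρ z, z)
  linarith

lemma sum_pairs_eq {α β : Type} (s : Finset α) (t : Finset β) (r : α → β → Prop)
    [∀ a, DecidablePred (r a)] [DecidablePred fun e : α × β => r e.1 e.2] (W : α → ℝ) :
    ∑ e ∈ (s ×ˢ t).filter (fun e => r e.1 e.2), W e.1 = ∑ a ∈ s, W a * (t.filter (r a)).card := by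
  rw [Finset.sum_filter, Finset.sum_product]
  refine Finset.sum_congr rfl fun a _ => ?_
  rw [Finset.card_filter, Nat.cast_sum, Finset.mul_sum]
  refine Finset.sum_congr rfl fun b _ => ?_
  by_cases h : r a b <;> simp [h]

variable [Fintype V]

lemma sum_edgeWeight_rootedFunctions {c : V → ℕ} (hj : j ≠ k) {τ : V × V → ℝ} {t : ℝ}
    (hτ0 : ∀ e, 0 ≤ τ e) (hτ : ∀ e, τ e ≤ t) (I : Finset (V × V)) :
    (∑ π ∈ rootedFunctions k c, edgeWeight τ I (parentGraph π)) * (c k - 1)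
        ≤ Real.exp (4 * t) * ∑ π ∈ rootedFunctions k c, edgeWeight τ I (parentGraph π) *
          (Finset.univ.filter fun z => π j = k ∧ z ≠ k ∧ ¬ Below π z j).card ∧
    ∑ π ∈ rootedFunctions k c, edgeWeight τ I (parentGraph π) *
          (Finset.univ.filter fun z => π j = k ∧ z ≠ k ∧ ¬ Below π z j).card
        ≤ Real.exp (4 * t) *
          ((∑ π ∈ rootedFunctions k c, edgeWeight τ I (parentGraph π)) * (c k - 1)) := by
  let W : (V → V) → ℝ := fun π => edgeWeight τ I (parentGraph π)
  let A := ((rootedFunctions k c) ×ˢ (Finset.univ : Finset V)).filter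
    fun e => e.2 ≠ k ∧ e.1 e.2 = k ∧ ¬ Below e.1 j e.2
  let B := ((rootedFunctions k c) ×ˢ (Finset.univ : Finset V)).filter
    fun e => e.1 j = k ∧ e.2 ≠ k ∧ ¬ Below e.1 e.2 j
  have hA : ∑ e ∈ A, W e.1 = (∑ π ∈ rootedFunctions k c, W π) * (c k - 1) := by
    rw [sum_pairs_eq (rootedFunctions k c) Finset.univ
      (fun π z => z ≠ k ∧ π z = k ∧ ¬ Below π j z) W, Finset.sum_mul]
    refine Finset.sum_congr rfl fun π hπ => ?_
    have h1 := (mem_rootedFunctions.1 hπ).1.card_children_not_above hj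
    rw [(mem_rootedFunctions.1 hπ).2 k] at h1
    rw [← h1]
    push_cast
    ring
  have hB : ∑ e ∈ B, W e.1 = ∑ π ∈ rootedFunctions k c, W π *
      (Finset.univ.filter fun z => π j = k ∧ z ≠ k ∧ ¬ Below π z j).card :=
    sum_pairs_eq (rootedFunctions k c) Finset.univ
      (fun π z => π j = k ∧ z ≠ k ∧ ¬ Below π z j) W
  let φ : (V → V) × V → (V → V) × V := fun e => (e.1 ∘ swap j e.2, e.2)
  have hφ : ∀ e, φ (φ e) = e := by
    rintro ⟨π, z⟩
    simp only [φ, Prod.mk.injEq, and_true]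
    funext v
    simp
  have hAB : ∀ e ∈ A, φ e ∈ B := by
    rintro ⟨π, z⟩ he
    obtain ⟨h1, hz, hzk, hb⟩ := Finset.mem_filter.1 he
    obtain ⟨hr, hc⟩ := mem_rootedFunctions.1 (Finset.mem_product.1 h1).1
    obtain ⟨h2, h3, h4⟩ := hr.comp_swap_of_child hj hz hzk hb
    exact Finset.mem_filter.2 ⟨Finset.mem_product.2 ⟨mem_rootedFunctions.2
      ⟨h2, fun v => by rw [← hc v]; exact childCount_comp_swap hj hz v⟩, Finset.mem_univ _⟩, h3, hz, h4⟩
  have hBA : ∀ e ∈ B, φ e ∈ A := by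
    rintro ⟨π, z⟩ he
    obtain ⟨h1, hjk, hz, hb⟩ := Finset.mem_filter.1 he
    obtain ⟨hr, hc⟩ := mem_rootedFunctions.1 (Finset.mem_product.1 h1).1
    obtain ⟨h2, h3, h4⟩ := hr.comp_swap_of_not_below hj hz hjk hb
    exact Finset.mem_filter.2 ⟨Finset.mem_product.2 ⟨mem_rootedFunctions.2
      ⟨h2, fun v => by rw [← hc v]; exact childCount_comp_swap hj hz v⟩, Finset.mem_univ _⟩, hz, h3, h4⟩
  have hagree : ∀ (π : V → V) z v, v ≠ j → v ≠ z → (π ∘ swap j z) v = π v := by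
    intro π z v h1 h2
    rw [Function.comp_apply, swap_apply_of_ne_of_ne h1 h2]
  have rootA : ∀ e ∈ A, IsRooted k e.1 := fun e he =>
    (mem_rootedFunctions.1 (Finset.mem_product.1 (Finset.mem_filter.1 he).1).1).1
  have rootB : ∀ e ∈ B, IsRooted k e.1 := fun e he =>
    (mem_rootedFunctions.1 (Finset.mem_product.1 (Finset.mem_filter.1 he).1).1).1
  have e1 : ∑ e ∈ A, W (φ e).1 = ∑ e ∈ B, W e.1 :=
    Finset.sum_nbij' φ φ hAB hBA (fun e _ => hφ e) (fun e _ => hφ e) fun _ _ => rfl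
  rw [← hA, ← hB]
  constructor
  · rw [← e1, Finset.mul_sum]
    exact Finset.sum_le_sum fun e he =>
      edgeWeight_parentGraph_le (rootA e he) (rootB _ (hAB e he)) (hagree e.1 e.2) hτ0 hτ I
  · rw [← e1, Finset.mul_sum]
    exact Finset.sum_le_sum fun e he =>
      edgeWeight_parentGraph_le (rootB _ (hAB e he)) (rootA e he)
        (fun v h1 h2 => (hagree e.1 e.2 v h1 h2).symm) hτ0 hτ I

end TreeSwitching

section Trees

variable {V : Type}

lemma IsRooted.reachable_deleteEdges {j k : V} {π : V → V} (h : IsRooted k π)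
    {u a : V} (hu : ∀ m, π^[m] u = j → π^[m] u = a ∨ ∃ i < m, π^[i] u = a) (ha : Below π u a) :
    ((parentGraph π).deleteEdges {s(j, k)}).Reachable u a := by
  obtain ⟨m, hm⟩ := ha
  induction m generalizing u with
  | zero => exact hm ▸ SimpleGraph.Reachable.refl _
  | succ m ih =>
    by_cases hua : u = a
    · exact hua ▸ SimpleGraph.Reachable.refl _
    have huj : u ≠ j := by
      rintro rfl
      rcases hu 0 rfl with h1 | ⟨i, hi, -⟩
      · exact hua h1
      · omega
    have hrec : ((parentGraph π).deleteEdges {s(j, k)}).Reachable (π u) a := by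
      refine ih ?_ (by rwa [Function.iterate_succ_apply] at hm)
      intro m' hm'
      rw [← Function.iterate_succ_apply] at hm' ⊢
      rcases hu _ hm' with h1 | ⟨i, hi, h1⟩
      · exact Or.inl h1
      · cases i with
        | zero => exact absurd h1 hua
        | succ i =>
          rw [Function.iterate_succ_apply] at h1
          exact Or.inr ⟨i, by omega, h1⟩
    by_cases huk : u = k
    · subst huk
      rwa [h.1] at hrec
    refine SimpleGraph.Reachable.trans (SimpleGraph.Adj.reachable ?_) hrec
    rw [SimpleGraph.deleteEdges_adj]
    refine ⟨(parentGraph_adj h).2 (Or.inl ⟨huk, rfl⟩), fun he => ?_⟩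
    rw [Set.mem_singleton_iff, Sym2.eq_iff] at he
    rcases he with ⟨h1, -⟩ | ⟨h1, -⟩
    exacts [huj h1, huk h1]

lemma IsRooted.reachable_of_below {j k : V} {π : V → V} (h : IsRooted k π) {u : V}
    (hu : Below π u j) : ((parentGraph π).deleteEdges {s(j, k)}).Reachable u j :=
  h.reachable_deleteEdges (fun _ hm => Or.inl hm) hu

lemma IsRooted.reachable_of_not_below {j k : V} {π : V → V} (h : IsRooted k π) {u : V}
    (hu : ¬ Below π u j) : ((parentGraph π).deleteEdges {s(j, k)}).Reachable u k :=
  h.reachable_deleteEdges (fun m hm => absurd ⟨m, hm⟩ hu) (h.2 u)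

lemma not_reachable_deleteEdges {T : SimpleGraph V} (hT : T.IsTree) {j k : V} (hjk : T.Adj j k) :
    ¬ (T.deleteEdges {s(j, k)}).Reachable j k := by
  have h1 := SimpleGraph.isAcyclic_iff_forall_adj_isBridge.1 hT.isAcyclic hjk
  exact SimpleGraph.isBridge_iff.1 h1

variable [Fintype V]

/-- The number of vertices other than `k` that `T` without the edge `j k` does not connect
to `j`. -/
noncomputable def farCount (T : SimpleGraph V) (j k : V) : ℕ :=
  (Finset.univ.filter fun z => z ≠ k ∧ ¬ (T.deleteEdges {s(j, k)}).Reachable z j).card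

lemma IsRooted.card_not_below {j k : V} {π : V → V} (h : IsRooted k π) (hj : j ≠ k) :
    (Finset.univ.filter fun z => π j = k ∧ z ≠ k ∧ ¬ Below π z j).card
      = if (parentGraph π).Adj j k then farCount (parentGraph π) j k else 0 := by
  have hadj := parentGraph_adj_root (j := j) h
  split_ifs with hjk
  · have hπ := (hadj.1 hjk).2
    rw [farCount]
    congr 1
    refine Finset.filter_congr fun z _ => ?_
    have hb : Below π z j ↔ ((parentGraph π).deleteEdges {s(j, k)}).Reachable z j := by
      refine ⟨h.reachable_of_below, fun hr => ?_⟩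
      by_contra hnb
      exact not_reachable_deleteEdges h.isTree hjk (hr.symm.trans (h.reachable_of_not_below hnb))
    rw [hb]
    simp [hπ]
  · rw [Finset.card_eq_zero, Finset.filter_eq_empty_iff]
    rintro z - ⟨h1, -⟩
    exact hjk (hadj.2 ⟨hj, h1⟩)

lemma farCount_add_farCount {T : SimpleGraph V} (hT : T.IsTree) {j k : V} (hjk : T.Adj j k) :
    farCount T j k + farCount T k j + 2 = Fintype.card V := by
  have hne := hjk.ne
  obtain ⟨π, hπ, rfl⟩ := exists_isRooted_of_isTree hT k
  have hex : ∀ z, ¬ ((parentGraph π).deleteEdges {s(j, k)}).Reachable z k ↔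
      ((parentGraph π).deleteEdges {s(j, k)}).Reachable z j := by
    intro z
    constructor
    · intro h
      refine hπ.reachable_of_below ?_
      by_contra hnb
      exact h (hπ.reachable_of_not_below hnb)
    · intro h h'
      exact not_reachable_deleteEdges hT hjk (h.symm.trans h')
  rw [farCount, farCount, Sym2.eq_swap (a := k) (b := j)]
  have h1 : (Finset.univ.filter fun z => z ≠ k ∧
      ¬ ((parentGraph π).deleteEdges {s(j, k)}).Reachable z j)
      = ((Finset.univ.erase j).erase k).filter fun z =>
        ¬ ((parentGraph π).deleteEdges {s(j, k)}).Reachable z j := by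
    ext z
    simp only [Finset.mem_filter, Finset.mem_univ, true_and, Finset.mem_erase, and_true]
    constructor
    · rintro ⟨h1, h2⟩
      exact ⟨⟨h1, fun h => h2 (h ▸ SimpleGraph.Reachable.refl _)⟩, h2⟩
    · rintro ⟨⟨h1, -⟩, h2⟩
      exact ⟨h1, h2⟩
  have h2 : (Finset.univ.filter fun z => z ≠ j ∧
      ¬ ((parentGraph π).deleteEdges {s(j, k)}).Reachable z k)
      = ((Finset.univ.erase j).erase k).filter fun z =>
        ((parentGraph π).deleteEdges {s(j, k)}).Reachable z j := by
    ext z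
    simp only [Finset.mem_filter, Finset.mem_univ, true_and, Finset.mem_erase, and_true, ← hex]
    constructor
    · rintro ⟨h1, h2⟩
      exact ⟨⟨fun h => h2 (h ▸ SimpleGraph.Reachable.refl _), h1⟩, h2⟩
    · rintro ⟨⟨-, h1⟩, h2⟩
      exact ⟨h1, h2⟩
  rw [h1, h2, add_comm (Finset.card _), Finset.card_filter_add_card_filter_not,
    Finset.card_erase_of_mem (by simp [hne.symm]), Finset.card_erase_of_mem (Finset.mem_univ _),
    Finset.card_univ]
  have : 2 ≤ Fintype.card V := by
    rw [← Finset.card_univ, ← Finset.card_pair hne]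
    exact Finset.card_le_card (Finset.subset_univ _)
  omega

/-- The trees with prescribed degrees. -/
noncomputable def treesWithDegrees (x : V → ℕ) : Finset (SimpleGraph V) :=
  Finset.univ.filter fun T => T.IsTree ∧ ∀ v, T.degree v = x v

lemma mem_treesWithDegrees {x : V → ℕ} {T : SimpleGraph V} :
    T ∈ treesWithDegrees x ↔ T.IsTree ∧ ∀ v, T.degree v = x v := by
  simp [treesWithDegrees]

lemma sum_treesWithDegrees {x c : V → ℕ} (k : V) (hc : ∀ v, x v = c v + if v = k then 0 else 1)
    (f : SimpleGraph V → ℝ) :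
    ∑ T ∈ treesWithDegrees x, f T = ∑ π ∈ rootedFunctions k c, f (parentGraph π) := by
  symm
  refine Finset.sum_bij (fun π _ => parentGraph π) ?_ ?_ ?_ fun _ _ => rfl
  · intro π hπ
    obtain ⟨h1, h2⟩ := mem_rootedFunctions.1 hπ
    exact mem_treesWithDegrees.2 ⟨h1.isTree, fun v => by rw [h1.degree_parentGraph, h2, hc]⟩
  · intro π hπ ρ hρ h
    exact (mem_rootedFunctions.1 hπ).1.eq_of_parentGraph_eq (mem_rootedFunctions.1 hρ).1 h
  · intro T hT
    obtain ⟨h1, h2⟩ := mem_treesWithDegrees.1 hT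
    obtain ⟨π, h3, rfl⟩ := exists_isRooted_of_isTree h1 k
    refine ⟨π, mem_rootedFunctions.2 ⟨h3, fun v => ?_⟩, rfl⟩
    have h4 := h2 v
    rw [h3.degree_parentGraph, hc v] at h4
    omega

lemma card_treesWithDegrees {n : ℕ} (hn : Fintype.card V = n + 2) {x : V → ℕ}
    (hx1 : ∀ v, 1 ≤ x v) (hx : ∑ v, x v = 2 * (n + 1)) :
    (treesWithDegrees x).card * ∏ v, (x v - 1).factorial = n.factorial := by
  obtain ⟨k⟩ : Nonempty V := Fintype.card_pos_iff.1 (by omega)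
  let c : V → ℕ := fun v => x v - if v = k then 0 else 1
  have hc : ∀ v, x v = c v + if v = k then 0 else 1 := by
    intro v
    have := hx1 v
    simp only [c]
    split_ifs <;> omega
  have hck : c k = x k := by simp [c]
  have h1 : (treesWithDegrees x).card = (rootedFunctions k c).card := by
    have := sum_treesWithDegrees k hc fun _ => 1
    simpa using this
  have hsum : ∑ v, c v = n + 1 := by
    have h2 : ∑ v, x v = ∑ v, c v + ∑ v, if v = k then 0 else 1 := by
      rw [← Finset.sum_add_distrib]
      exact Finset.sum_congr rfl fun v _ => hc v
    have h3 : ∑ v, (if v = k then 0 else 1) = n + 1 := by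
      have h4 : ∑ v, (if v = k then 0 else 1) = (Finset.univ.filter fun v => ¬ v = k).card := by
        rw [Finset.card_filter]
        exact Finset.sum_congr rfl fun v _ => by split_ifs <;> rfl
      have h5 : (Finset.univ.filter fun v => ¬ v = k) = Finset.univ.erase k := by
        ext
        simp
      rw [h4, h5, Finset.card_erase_of_mem (Finset.mem_univ k), Finset.card_univ]
      omega
    omega
  have h2 := card_rootedFunctions hn (k := k) hsum
  have h3 : ∏ v, (c v).factorial = x k * ∏ v, (x v - 1).factorial := by
    rw [← Finset.mul_prod_erase Finset.univ _ (Finset.mem_univ k),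
      ← Finset.mul_prod_erase Finset.univ (fun v => (x v - 1).factorial) (Finset.mem_univ k),
      hck, ← mul_assoc, Nat.mul_factorial_pred (by have := hx1 k; omega)]
    congr 1
    refine Finset.prod_congr rfl fun v hv => ?_
    simp [c, Finset.ne_of_mem_erase hv]
  rw [h3, hck] at h2
  rw [h1]
  refine Nat.eq_of_mul_eq_mul_left (hx1 k) ?_
  rw [← h2]
  ring

lemma sum_edgeWeight_farCount {x : V → ℕ} (hx1 : ∀ v, 1 ≤ x v) {j k : V} (hj : j ≠ k)
    {τ : V × V → ℝ} {t : ℝ} (hτ0 : ∀ e, 0 ≤ τ e) (hτ : ∀ e, τ e ≤ t) (I : Finset (V × V)) :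
    (x k - 1) * (∑ T ∈ treesWithDegrees x, edgeWeight τ I T)
        ≤ Real.exp (4 * t) * ∑ T ∈ (treesWithDegrees x).filter (fun T => T.Adj j k),
          edgeWeight τ I T * farCount T j k ∧
    ∑ T ∈ (treesWithDegrees x).filter (fun T => T.Adj j k), edgeWeight τ I T * farCount T j k
        ≤ Real.exp (4 * t) * ((x k - 1) * ∑ T ∈ treesWithDegrees x, edgeWeight τ I T) := by
  let c : V → ℕ := fun v => x v - if v = k then 0 else 1
  have hc : ∀ v, x v = c v + if v = k then 0 else 1 := by
    intro v
    have := hx1 v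
    simp only [c]
    split_ifs <;> omega
  have hck : c k = x k := by simp [c]
  have h := sum_edgeWeight_rootedFunctions (c := c) hj hτ0 hτ I
  rw [Finset.sum_filter, sum_treesWithDegrees k hc, sum_treesWithDegrees k hc, ← hck]
  have h1 : ∑ π ∈ rootedFunctions k c, (if (parentGraph π).Adj j k then
        edgeWeight τ I (parentGraph π) * farCount (parentGraph π) j k else 0)
      = ∑ π ∈ rootedFunctions k c, edgeWeight τ I (parentGraph π) *
          (Finset.univ.filter fun z => π j = k ∧ z ≠ k ∧ ¬ Below π z j).card := by
    refine Finset.sum_congr rfl fun π hπ => ?_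
    rw [(mem_rootedFunctions.1 hπ).1.card_not_below hj]
    split_ifs <;> simp
  rw [h1, mul_comm ((c k : ℝ) - 1)]
  exact h

lemma sum_edgeWeight_adj {n : ℕ} (hn : Fintype.card V = n + 2) {x : V → ℕ}
    (hx1 : ∀ v, 1 ≤ x v) {j k : V} (hj : j ≠ k)
    {τ : V × V → ℝ} {t : ℝ} (hτ0 : ∀ e, 0 ≤ τ e) (hτ : ∀ e, τ e ≤ t) (I : Finset (V × V)) :
    (x j - 1 + (x k - 1)) * (∑ T ∈ treesWithDegrees x, edgeWeight τ I T)
        ≤ Real.exp (4 * t) * (n * ∑ T ∈ (treesWithDegrees x).filter (fun T => T.Adj j k),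
          edgeWeight τ I T) ∧
    n * ∑ T ∈ (treesWithDegrees x).filter (fun T => T.Adj j k), edgeWeight τ I T
        ≤ Real.exp (4 * t) * ((x j - 1 + (x k - 1)) *
          ∑ T ∈ treesWithDegrees x, edgeWeight τ I T) := by
  have h1 := sum_edgeWeight_farCount hx1 hj hτ0 hτ I
  have h2 := sum_edgeWeight_farCount hx1 hj.symm hτ0 hτ I
  have h3 : (treesWithDegrees x).filter (fun T => T.Adj k j)
      = (treesWithDegrees x).filter (fun T => T.Adj j k) :=
    Finset.filter_congr fun T _ => T.adj_comm k j
  rw [h3] at h2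
  have h4 : n * ∑ T ∈ (treesWithDegrees x).filter (fun T => T.Adj j k), edgeWeight τ I T
      = ∑ T ∈ (treesWithDegrees x).filter (fun T => T.Adj j k), edgeWeight τ I T * farCount T j k
      + ∑ T ∈ (treesWithDegrees x).filter (fun T => T.Adj j k),
        edgeWeight τ I T * farCount T k j := by
    rw [← Finset.sum_add_distrib, Finset.mul_sum]
    refine Finset.sum_congr rfl fun T hT => ?_
    obtain ⟨hT1, hT2⟩ := Finset.mem_filter.1 hT
    have h5 := farCount_add_farCount (mem_treesWithDegrees.1 hT1).1 hT2
    rw [hn] at h5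
    have h6 : (n : ℝ) = farCount T j k + farCount T k j := by
      have : n = farCount T j k + farCount T k j := by omega
      exact_mod_cast this
    rw [h6]
    ring
  rw [h4, mul_add, add_mul, mul_add]
  constructor <;> linarith [h1.1, h1.2, h2.1, h2.2]

end Trees

/-- The probability that `e` is an edge of a uniform random tree with degrees `x` on `n + 2`
vertices. -/
noncomputable def treeEdgeProb {V : Type} (n : ℕ) (x : V → ℕ) (e : V × V) : ℝ :=
  if e.1 = e.2 then 0 else ((x e.1 : ℝ) - 1 + (x e.2 - 1)) / n

lemma treeEdgeProb_nonneg {V : Type} {n : ℕ} {x : V → ℕ} (hx1 : ∀ v, 1 ≤ x v) (e : V × V) :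
    0 ≤ treeEdgeProb n x e := by
  have h1 : (1 : ℝ) ≤ x e.1 := by exact_mod_cast hx1 e.1
  have h2 : (1 : ℝ) ≤ x e.2 := by exact_mod_cast hx1 e.2
  rw [treeEdgeProb]
  split_ifs
  · exact le_rfl
  · exact div_nonneg (by linarith) (by positivity)

lemma treeEdgeProb_le_one {V : Type} [Fintype V] {n : ℕ} (hn : Fintype.card V = n + 2)
    {x : V → ℕ} (hx1 : ∀ v, 1 ≤ x v) (hx : ∑ v, x v = 2 * (n + 1)) (e : V × V) :
    treeEdgeProb n x e ≤ 1 := by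
  have hx1' : ∀ v, (0 : ℝ) ≤ x v - 1 := fun v => by
    have : (1 : ℝ) ≤ x v := by exact_mod_cast hx1 v
    linarith
  rw [treeEdgeProb]
  split_ifs with h
  · exact zero_le_one
  · refine div_le_one_of_le₀ ?_ (by positivity)
    have h1 : ∑ v, ((x v : ℝ) - 1) = n := by
      rw [Finset.sum_sub_distrib, ← Nat.cast_sum, hx]
      simp [hn]
      ring
    rw [← h1, ← Finset.sum_pair (f := fun v => (x v : ℝ) - 1) h]
    exact Finset.sum_le_sum_of_subset_of_nonneg (Finset.subset_univ _) fun v _ _ => hx1' v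

lemma exists_sum_treesWithDegrees_exp_neg_eq : ∃ C : ℝ, 0 < C ∧
    ∀ {V : Type} [Fintype V] {n : ℕ}, Fintype.card V = n + 2 → 0 < n →
      ∀ {x : V → ℕ}, (∀ v, 1 ≤ x v) → ∑ v, x v = 2 * (n + 1) →
      ∀ {τ : V × V → ℝ} {t : ℝ}, (∀ e, 0 ≤ τ e) → (∀ e, τ e ≤ t) → t ≤ 1 / 2 →
      ∃ E : ℝ, |E| ≤ C * t * ∑ e, τ e * treeEdgeProb n x e ∧
        ∑ T ∈ treesWithDegrees x, Real.exp (-∑ e : V × V, if T.Adj e.1 e.2 then τ e else 0)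
          = (treesWithDegrees x).card * Real.exp (-∑ e, τ e * treeEdgeProb n x e + E) := by
  obtain ⟨C, hC, h⟩ := exists_sum_exp_neg_eq 2
  refine ⟨C * 4, by positivity, ?_⟩
  intro V _ n hn hn0 x hx1 hx τ t hτ0 hτ ht
  have hn0' : (0 : ℝ) < n := by exact_mod_cast hn0
  obtain ⟨v⟩ : Nonempty V := Fintype.card_pos_iff.1 (by omega)
  have ht0 : 0 ≤ t := (hτ0 (v, v)).trans (hτ (v, v))
  obtain ⟨E, hE, hsum⟩ := h (treesWithDegrees x) (fun (e : V × V) T => T.Adj e.1 e.2) τ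
    (treeEdgeProb n x) (4 * t) hτ0 (fun e => (hτ e).trans ht) (fun e => (hτ e).trans (by linarith))
    (treeEdgeProb_nonneg hx1) (treeEdgeProb_le_one hn hx1 hx) (by linarith) (by linarith) (by
      intro I e
      by_cases he : e.1 = e.2
      · have : (treesWithDegrees x).filter (fun T => T.Adj e.1 e.2) = ∅ := by
          rw [Finset.filter_eq_empty_iff]
          intro T _
          rw [he]
          exact T.loopless.irrefl _
        rw [this]
        simp [treeEdgeProb, he]
      · have := sum_edgeWeight_adj hn hx1 he hτ0 hτ I
        simp only [edgeWeight] at this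
        rw [treeEdgeProb, if_neg he]
        set W := ∑ T ∈ treesWithDegrees x,
          Real.exp (-∑ e ∈ I, if T.Adj e.1 e.2 then τ e else 0)
        set A := ∑ T ∈ (treesWithDegrees x).filter (fun T => T.Adj e.1 e.2),
          Real.exp (-∑ e ∈ I, if T.Adj e.1 e.2 then τ e else 0)
        obtain ⟨h1, h2⟩ := this
        have hq : ((x e.1 : ℝ) - 1 + (x e.2 - 1)) / n * W
            = ((x e.1 : ℝ) - 1 + (x e.2 - 1)) * W / n := by ring
        constructor
        · rw [hq, Real.exp_neg, inv_mul_le_iff₀ (Real.exp_pos _), div_le_iff₀ hn0']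
          linarith
        · rw [hq, ← mul_div_assoc, le_div_iff₀ hn0']
          linarith)
  refine ⟨E, ?_, hsum⟩
  calc |E| ≤ _ := hE
    _ = _ := by ring

lemma exists_sum_mul_exp_eq {ι : Type*} (s : Finset ι) {a e : ι → ℝ} {ε : ℝ} (hε : 0 ≤ ε)
    (ha : ∀ i ∈ s, 0 ≤ a i) (he : ∀ i ∈ s, |e i| ≤ ε) :
    ∃ E : ℝ, |E| ≤ ε ∧ ∑ i ∈ s, a i * Real.exp (e i) = (∑ i ∈ s, a i) * Real.exp E := by
  rcases (Finset.sum_nonneg ha).eq_or_lt with h0 | h0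
  · refine ⟨0, by simpa using hε, ?_⟩
    rw [← h0, zero_mul]
    refine Finset.sum_eq_zero fun i hi => ?_
    rw [(Finset.sum_eq_zero_iff_of_nonneg ha).1 h0.symm i hi, zero_mul]
  · have hlow : (∑ i ∈ s, a i) * Real.exp (-ε) ≤ ∑ i ∈ s, a i * Real.exp (e i) := by
      rw [Finset.sum_mul]
      exact Finset.sum_le_sum fun i hi => mul_le_mul_of_nonneg_left
        (Real.exp_le_exp.2 (abs_le.1 (he i hi)).1) (ha i hi)
    have hup : ∑ i ∈ s, a i * Real.exp (e i) ≤ (∑ i ∈ s, a i) * Real.exp ε := by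
      rw [Finset.sum_mul]
      exact Finset.sum_le_sum fun i hi => mul_le_mul_of_nonneg_left
        (Real.exp_le_exp.2 (abs_le.1 (he i hi)).2) (ha i hi)
    have hpos : 0 < (∑ i ∈ s, a i * Real.exp (e i)) / ∑ i ∈ s, a i :=
      div_pos (lt_of_lt_of_le (by positivity) hlow) h0
    refine ⟨Real.log ((∑ i ∈ s, a i * Real.exp (e i)) / ∑ i ∈ s, a i), ?_, ?_⟩
    · rw [abs_le]
      constructor
      · rw [Real.le_log_iff_exp_le hpos, le_div_iff₀ h0]
        linarith
      · rw [Real.log_le_iff_le_exp hpos, div_le_iff₀ h0]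
        linarith
    · rw [Real.exp_log hpos, mul_div_cancel₀ _ h0.ne']

section TreesGraphs

variable {V : Type} [Fintype V]

lemma sum_mul_treeEdgeProb (n : ℕ) (g x : V → ℕ) (b : ℝ) :
    ∑ e : V × V, (g e.1 : ℝ) * g e.2 / (2 * b) * treeEdgeProb n x e
      = (∑ u, ∑ w, if u ≠ w then (g u : ℝ) * ((x u : ℝ) - 1) * g w else 0) / (b * n) := by
  have h1 : ∀ u w, (g u : ℝ) * g w / (2 * b) * treeEdgeProb n x (u, w)
      = ((if u ≠ w then (g u : ℝ) * ((x u : ℝ) - 1) * g w else 0)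
        + (if w ≠ u then (g w : ℝ) * ((x w : ℝ) - 1) * g u else 0)) / (2 * (b * n)) := by
    intro u w
    by_cases h : u = w
    · simp [treeEdgeProb, h]
    · rw [treeEdgeProb, if_neg h, if_pos h, if_pos (Ne.symm h), div_mul_div_comm]
      congr 1 <;> ring
  rw [Fintype.sum_prod_type]
  simp only [h1]
  simp only [← Finset.sum_div, Finset.sum_add_distrib]
  rw [Finset.sum_comm (f := fun u w => if w ≠ u then (g w : ℝ) * ((x w : ℝ) - 1) * g u else 0)]
  rw [← two_mul, mul_div_mul_left _ _ two_ne_zero]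

lemma exists_sum_graphCount_eq : ∃ C : ℝ, 0 < C ∧
    ∀ {V : Type} [Fintype V] {n : ℕ}, Fintype.card V = n + 2 → 0 < n →
      ∀ {x g : V → ℕ} {D m : ℕ}, (∀ v, 1 ≤ x v) → ∑ v, x v = 2 * (n + 1) →
      (∀ v, g v + x v ≤ D) → 3 ≤ D → ∑ v, g v = 2 * m → D ^ 4 + 2 ≤ 2 * m →
      ∃ E : ℝ, |E| ≤ C * (D : ℝ) ^ 4 / (2 * m : ℕ) ∧
        (∑ T ∈ treesWithDegrees x, (graphCount g T : ℝ))
            * ((∏ u, ((g u).factorial : ℝ)) * ∏ u, ((x u - 1).factorial : ℝ))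
          = ((2 * m).factorial : ℝ) / (2 ^ m * m.factorial) * n.factorial *
            Real.exp (-((∑ u, (g u : ℝ) * (g u - 1)) / (2 * (2 * m : ℕ)) +
              (∑ u, ∑ w, if u ≠ w then ((g u : ℝ) * (g u - 1)) * (g w * (g w - 1)) else 0)
                / (4 * ((2 * m : ℕ) : ℝ) ^ 2) +
              (∑ u, ∑ w, if u ≠ w then (g u : ℝ) * ((x u : ℝ) - 1) * g w else 0)
                / ((2 * m : ℕ) * n)) + E) := by
  obtain ⟨C, hC, hT⟩ := exists_sum_treesWithDegrees_exp_neg_eq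
  refine ⟨50 + C, by positivity, ?_⟩
  intro V _ n hn hn0 x g D m hx1 hx hgx hD3 hm hDm
  have hn0' : (0 : ℝ) < n := by exact_mod_cast hn0
  have hb : ((D : ℝ) ^ 4 + 2) ≤ (2 * m : ℕ) := by exact_mod_cast hDm
  set b : ℝ := ((2 * m : ℕ) : ℝ) with hbdef
  have hD3' : (3 : ℝ) ≤ D := by exact_mod_cast hD3
  have hD2 : (1 : ℝ) ≤ (D : ℝ) ^ 2 := by nlinarith
  have hb0 : 0 < b := by nlinarith [sq_nonneg ((D : ℝ) ^ 2)]
  have hx1' : ∀ v, (1 : ℝ) ≤ x v := fun v => by exact_mod_cast hx1 v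
  have hgD : ∀ v, (g v : ℝ) ≤ D := fun v => by
    have := hgx v
    exact_mod_cast (by omega : g v ≤ D)
  set Q : ℝ := (∑ u, (g u : ℝ) * (g u - 1)) / (2 * b) +
      (∑ u, ∑ w, if u ≠ w then ((g u : ℝ) * (g u - 1)) * (g w * (g w - 1)) else 0)
        / (4 * b ^ 2) with hQ
  set μ : ℝ := (∑ u, ∑ w, if u ≠ w then (g u : ℝ) * ((x u : ℝ) - 1) * g w else 0) / (b * n)
    with hμ
  have hG : ∀ T : SimpleGraph V, ∃ e : ℝ, T ∈ treesWithDegrees x → |e| ≤ 50 * (D : ℝ) ^ 4 / b ∧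
      (graphCount g T : ℝ) * ∏ u, ((g u).factorial : ℝ)
        = ((2 * m).factorial : ℝ) / (2 ^ m * m.factorial) * Real.exp (-Q) *
          (Real.exp (-∑ e : V × V, if T.Adj e.1 e.2 then (g e.1 : ℝ) * g e.2 / (2 * b) else 0)
            * Real.exp e) := by
    intro T
    by_cases hTx : T ∈ treesWithDegrees x
    · obtain ⟨e, he, h⟩ := exists_graphCount_eq (g := g) (X := T) (D := D) (m := m)
        (fun u => by rw [(mem_treesWithDegrees.1 hTx).2 u]; exact hgx u) hD3 hm hDm
      refine ⟨e, fun _ => ⟨he, ?_⟩⟩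
      rw [h, mul_assoc, ← Real.exp_add, ← Real.exp_add]
      congr 2
      have : ∑ e : V × V, (if T.Adj e.1 e.2 then (g e.1 : ℝ) * g e.2 / (2 * b) else 0)
          = (∑ u, ∑ w, if T.Adj u w then (g u : ℝ) * g w else 0) / (2 * b) := by
        rw [Fintype.sum_prod_type]
        simp only [Finset.sum_div]
        refine Finset.sum_congr rfl fun u _ => Finset.sum_congr rfl fun w _ => ?_
        split_ifs <;> simp
      rw [this, hQ, ← hbdef]
      ring
    · exact ⟨0, fun h => absurd h hTx⟩
  choose e he using hG
  obtain ⟨E₁, hE₁, h1⟩ := exists_sum_mul_exp_eq (treesWithDegrees x)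
    (a := fun T => Real.exp (-∑ e : V × V,
      if T.Adj e.1 e.2 then (g e.1 : ℝ) * g e.2 / (2 * b) else 0))
    (e := e) (ε := 50 * (D : ℝ) ^ 4 / b) (by positivity) (fun T _ => (Real.exp_pos _).le)
    (fun T hTx => (he T hTx).1)
  obtain ⟨E₂, hE₂, h2⟩ := hT hn hn0 hx1 hx (τ := fun e => (g e.1 : ℝ) * g e.2 / (2 * b))
    (t := (D : ℝ) ^ 2 / (2 * b)) (fun e => by positivity)
    (fun e => by
      rw [sq]
      gcongr
      · exact_mod_cast hgD _
      · exact_mod_cast hgD _)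
    (by
      rw [div_le_iff₀ (by positivity)]
      nlinarith)
  rw [sum_mul_treeEdgeProb] at hE₂ h2
  rw [← hμ] at hE₂ h2
  have hμ0 : μ ≤ D := by
    rw [hμ, div_le_iff₀ (by positivity)]
    calc (∑ u, ∑ w, if u ≠ w then (g u : ℝ) * ((x u : ℝ) - 1) * g w else 0)
        ≤ ∑ u, ∑ w, (D : ℝ) * ((x u : ℝ) - 1) * g w := by
          refine Finset.sum_le_sum fun u _ => Finset.sum_le_sum fun w _ => ?_
          have h3 : (0 : ℝ) ≤ x u - 1 := by linarith [hx1' u]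
          split_ifs
          · have := hgD u
            gcongr
          · positivity
      _ = D * (b * n) := by
          have h3 : ∑ v, ((x v : ℝ) - 1) = n := by
            rw [Finset.sum_sub_distrib, ← Nat.cast_sum, hx]
            simp [hn]
            ring
          simp only [← Finset.mul_sum, ← Finset.sum_mul, ← Nat.cast_sum, hm, h3, ← hbdef]
          ring
  refine ⟨E₁ + E₂, ?_, ?_⟩
  · have h3 : |E₂| ≤ C * (D : ℝ) ^ 4 / b := by
      refine hE₂.trans ?_
      rw [mul_div_assoc, mul_assoc]
      refine mul_le_mul_of_nonneg_left ?_ hC.le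
      calc (D : ℝ) ^ 2 / (2 * b) * μ ≤ (D : ℝ) ^ 2 / (2 * b) * D :=
            mul_le_mul_of_nonneg_left hμ0 (by positivity)
        _ = ((D : ℝ) ^ 3 / 2) / b := by
            field_simp
        _ ≤ (D : ℝ) ^ 4 / b := by
            gcongr
            nlinarith [pow_pos (by linarith : (0 : ℝ) < D) 3]
    calc |E₁ + E₂| ≤ |E₁| + |E₂| := abs_add_le _ _
      _ ≤ 50 * (D : ℝ) ^ 4 / b + C * (D : ℝ) ^ 4 / b := add_le_add hE₁ h3
      _ = _ := by ring
  · have hcard : ((treesWithDegrees x).card : ℝ) * ∏ u, ((x u - 1).factorial : ℝ)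
        = n.factorial := by
      exact_mod_cast card_treesWithDegrees hn hx1 hx
    rw [← mul_assoc, Finset.sum_mul, Finset.sum_congr rfl fun T hTx => (he T hTx).2,
      ← Finset.mul_sum, h1, h2, ← hcard]
    have : Real.exp (-(Q + μ) + (E₁ + E₂))
        = Real.exp (-Q) * (Real.exp (-μ + E₂) * Real.exp E₁) := by
      rw [← Real.exp_add, ← Real.exp_add]
      congr 1
      ring
    rw [this]
    ring

end TreesGraphs

section TreeSum

variable {V : Type} [Fintype V]

lemma degree_add_degree_eq {G H T : SimpleGraph V} (hG : ∀ u w, G.Adj u w ↔ H.Adj u w ∨ T.Adj u w)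
    (hH : ∀ u w, H.Adj u w → ¬ T.Adj u w) (v : V) : H.degree v + T.degree v = G.degree v := by
  have h1 : G.neighborFinset v = H.neighborFinset v ∪ T.neighborFinset v := by
    ext w
    simp only [SimpleGraph.mem_neighborFinset, Finset.mem_union, hG]
  have h2 : Disjoint (H.neighborFinset v) (T.neighborFinset v) := by
    rw [Finset.disjoint_left]
    intro w
    simp only [SimpleGraph.mem_neighborFinset]
    exact hH v w
  simp only [← SimpleGraph.card_neighborFinset_eq_degree]
  rw [h1, Finset.card_union_of_disjoint h2]

lemma card_degree_filter_le (d : V → ℕ) (T : SimpleGraph V) (hT : ∀ v, T.degree v ≤ d v) :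
    (Finset.univ.filter fun G : SimpleGraph V => (∀ v, G.degree v = d v) ∧ T ≤ G).card
      = graphCount (fun v => d v - T.degree v) T := by
  refine Finset.card_bij' (fun G _ => G \ T) (fun H _ => H ⊔ T) ?_ ?_ ?_ ?_
  · intro G hG
    obtain ⟨h1, h2⟩ := (Finset.mem_filter.1 hG).2
    have h4 : ∀ u w, (G \ T).Adj u w → ¬ T.Adj u w := fun u w h =>
      ((SimpleGraph.sdiff_adj _ _ _ _).1 h).2
    refine Finset.mem_filter.2 ⟨Finset.mem_univ _, fun v => ?_, h4⟩
    have h3 := degree_add_degree_eq (G := G) (H := G \ T) (T := T) (fun u w => by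
      have := @h2 u w
      rw [SimpleGraph.sdiff_adj]
      tauto) h4 v
    rw [h1 v] at h3
    exact Nat.eq_sub_of_add_eq h3
  · intro H hH
    obtain ⟨h1, h2⟩ := (Finset.mem_filter.1 hH).2
    refine Finset.mem_filter.2 ⟨Finset.mem_univ _, fun v => ?_, le_sup_right⟩
    have h4 := degree_add_degree_eq (G := H ⊔ T) (H := H) (T := T)
      (fun u w => SimpleGraph.sup_adj _ _ _ _) h2 v
    rw [h1 v, Nat.sub_add_cancel (hT v)] at h4
    exact h4.symm
  · intro G hG
    obtain ⟨h1, h2⟩ := (Finset.mem_filter.1 hG).2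
    exact sdiff_sup_cancel h2
  · intro H hH
    obtain ⟨h1, h2⟩ := (Finset.mem_filter.1 hH).2
    ext u w
    have := h2 u w
    simp only [SimpleGraph.sdiff_adj, SimpleGraph.sup_adj]
    tauto

lemma isTree_degree_pos {n : ℕ} (hn : Fintype.card V = n + 2) {T : SimpleGraph V}
    (hT : T.IsTree) (v : V) : 1 ≤ T.degree v := by
  have : Nontrivial V := Fintype.one_lt_card_iff_nontrivial.1 (by omega)
  exact hT.connected.preconnected.degree_pos_of_nontrivial v

lemma isTree_sum_degree {n : ℕ} (hn : Fintype.card V = n + 2) {T : SimpleGraph V}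
    (hT : T.IsTree) : ∑ v, T.degree v = 2 * (n + 1) := by
  have h1 := hT.card_edgeFinset
  have h2 := T.sum_degrees_eq_twice_card_edges
  have h3 : T.edgeFinset.card = n + 1 := by omega
  rw [← h3, ← h2]

/-- The degree sequences left over when a spanning tree is removed from a graph with degrees
`d`, where the remaining degree sum is `b`. -/
noncomputable def residualDegrees (d : V → ℕ) (b : ℕ) : Finset (V → ℕ) :=
  (Fintype.piFinset fun v => Finset.range (d v)).filter fun g => ∑ v, g v = b

lemma sum_card_spanningTrees {n b : ℕ} (hn : Fintype.card V = n + 2) (d : V → ℕ)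
    (hb : ∑ v, d v = b + 2 * (n + 1)) :
    ∑ G ∈ Finset.univ.filter (fun G : SimpleGraph V => ∀ v, G.degree v = d v),
        (Finset.univ.filter fun T : SimpleGraph V => T ≤ G ∧ T.IsTree).card
      = ∑ g ∈ residualDegrees d b,
        ∑ T ∈ treesWithDegrees (fun v => d v - g v), graphCount g T := by
  set S := Finset.univ.filter fun T : SimpleGraph V => T.IsTree ∧ ∀ v, T.degree v ≤ d v with hS
  have h1 : ∑ G ∈ Finset.univ.filter (fun G : SimpleGraph V => ∀ v, G.degree v = d v),
        (Finset.univ.filter fun T : SimpleGraph V => T ≤ G ∧ T.IsTree).card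
      = ∑ T ∈ S, (Finset.univ.filter fun G : SimpleGraph V =>
          (∀ v, G.degree v = d v) ∧ T ≤ G).card := by
    have h2 : ∀ G ∈ Finset.univ.filter (fun G : SimpleGraph V => ∀ v, G.degree v = d v),
        (Finset.univ.filter fun T : SimpleGraph V => T ≤ G ∧ T.IsTree)
          = S.filter fun T => T ≤ G := by
      intro G hG
      have hG' := (Finset.mem_filter.1 hG).2
      ext T
      refine ⟨fun h => ?_, fun h => ?_⟩
      · obtain ⟨h3, h4⟩ := (Finset.mem_filter.1 h).2
        refine Finset.mem_filter.2 ⟨Finset.mem_filter.2 ⟨Finset.mem_univ _, h4, fun v => ?_⟩, h3⟩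
        rw [← hG' v]
        exact SimpleGraph.degree_le_of_le h3
      · obtain ⟨h3, h4⟩ := Finset.mem_filter.1 h
        exact Finset.mem_filter.2 ⟨Finset.mem_univ _, h4, (Finset.mem_filter.1 h3).2.1⟩
    rw [Finset.sum_congr rfl fun G hG => congrArg Finset.card (h2 G hG)]
    refine (Finset.sum_card_bipartiteAbove_eq_sum_card_bipartiteBelow fun G T => T ≤ G).trans ?_
    refine Finset.sum_congr rfl fun T _ => ?_
    rw [Finset.bipartiteBelow, Finset.filter_filter]
  rw [h1]
  have hmaps : ∀ T ∈ S, (fun v => d v - T.degree v) ∈ residualDegrees d b := by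
    intro T hT
    obtain ⟨h2, h3⟩ := (Finset.mem_filter.1 hT).2
    refine Finset.mem_filter.2 ⟨Fintype.mem_piFinset.2 fun v => ?_, ?_⟩
    · have := h3 v
      have := isTree_degree_pos hn h2 v
      rw [Finset.mem_range]
      omega
    · have h4 := isTree_sum_degree hn h2
      have h5 : ∑ v, d v = ∑ v, (d v - T.degree v) + ∑ v, T.degree v := by
        rw [← Finset.sum_add_distrib]
        exact Finset.sum_congr rfl fun v _ => by have := h3 v; omega
      dsimp only
      omega
  rw [← Finset.sum_fiberwise_of_maps_to hmaps]
  refine Finset.sum_congr rfl fun g hg => ?_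
  obtain ⟨h2, h3⟩ := Finset.mem_filter.1 hg
  have h2' : ∀ v, g v < d v := fun v => Finset.mem_range.1 (Fintype.mem_piFinset.1 h2 v)
  have h4 : S.filter (fun T => (fun v => d v - T.degree v) = g)
      = treesWithDegrees fun v => d v - g v := by
    ext T
    rw [mem_treesWithDegrees]
    refine ⟨fun h => ?_, fun h => ?_⟩
    · obtain ⟨h5, h6⟩ := Finset.mem_filter.1 h
      obtain ⟨h7, h8⟩ := (Finset.mem_filter.1 h5).2
      refine ⟨h7, fun v => ?_⟩
      have := congrFun h6 v
      have := h8 v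
      omega
    · obtain ⟨h5, h6⟩ := h
      refine Finset.mem_filter.2 ⟨Finset.mem_filter.2 ⟨Finset.mem_univ _, h5, fun v => ?_⟩, ?_⟩
      · have := h6 v
        omega
      · funext v
        have := h6 v
        have := h2' v
        omega
  rw [h4]
  refine Finset.sum_congr rfl fun T hT => ?_
  have h5 := (mem_treesWithDegrees.1 hT).2
  have h6 : (fun v => d v - T.degree v) = g := by
    funext v
    have := h5 v
    have := h2' v
    omega
  rw [card_degree_filter_le d T fun v => by have := h5 v; omega, h6]

end TreeSum

section Profile

variable {V Y : Type}

/-- The number of points of `A` in each fibre of `v`. -/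
noncomputable def profile (v : Y → V) (A : Finset Y) (u : V) : ℕ :=
  (A.filter fun y => v y = u).card

lemma profile_le_profile_univ [Fintype Y] (v : Y → V) (A : Finset Y) (u : V) :
    profile v A u ≤ profile v Finset.univ u :=
  Finset.card_le_card (Finset.filter_subset_filter _ (Finset.subset_univ _))

variable [Fintype V]

lemma sum_profile (v : Y → V) (A : Finset Y) : ∑ u, profile v A u = A.card :=
  (Finset.card_eq_sum_card_fiberwise fun _ _ => Finset.mem_univ _).symm

lemma sum_comp_eq_sum_profile (v : Y → V) (A : Finset Y) (f : V → ℝ) :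
    ∑ y ∈ A, f (v y) = ∑ u, (profile v A u : ℝ) * f u := by
  rw [← Finset.sum_fiberwise_of_maps_to (g := v) (t := Finset.univ) fun _ _ => Finset.mem_univ _]
  refine Finset.sum_congr rfl fun u _ => ?_
  rw [Finset.sum_congr rfl fun y hy => by rw [(Finset.mem_filter.1 hy).2]]
  rw [Finset.sum_const, nsmul_eq_mul, profile]

variable [Fintype Y]

lemma card_profile_eq (v : Y → V) (g : V → ℕ) :
    (Finset.univ.filter fun B : Finset Y => profile v B = g).card
      = ∏ u, (profile v Finset.univ u).choose (g u) := by
  have h1 : ∏ u, (profile v Finset.univ u).choose (g u)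
      = (Fintype.piFinset fun u =>
          Finset.powersetCard (g u) (Finset.univ.filter fun y => v y = u)).card := by
    rw [Fintype.card_piFinset]
    exact Finset.prod_congr rfl fun u _ => (Finset.card_powersetCard _ _).symm
  rw [h1]
  refine Finset.card_bij' (fun B _ u => B.filter fun y => v y = u)
    (fun s _ => Finset.univ.filter fun y => y ∈ s (v y)) ?_ ?_ ?_ ?_
  · intro B hB
    have hB' := (Finset.mem_filter.1 hB).2
    rw [Fintype.mem_piFinset]
    intro u
    rw [Finset.mem_powersetCard]
    exact ⟨Finset.filter_subset_filter _ (Finset.subset_univ _), congrFun hB' u⟩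
  · intro s hs
    rw [Fintype.mem_piFinset] at hs
    refine Finset.mem_filter.2 ⟨Finset.mem_univ _, ?_⟩
    funext u
    obtain ⟨h2, h3⟩ := Finset.mem_powersetCard.1 (hs u)
    rw [profile, ← h3]
    congr 1
    ext y
    rw [Finset.mem_filter, Finset.mem_filter]
    constructor
    · rintro ⟨⟨_, h4⟩, rfl⟩
      exact h4
    · intro h4
      have h5 := (Finset.mem_filter.1 (h2 h4)).2
      subst h5
      exact ⟨⟨Finset.mem_univ _, h4⟩, rfl⟩
  · intro B _
    ext y
    simp
  · intro s hs
    rw [Fintype.mem_piFinset] at hs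
    funext u
    ext y
    rw [Finset.mem_filter, Finset.mem_filter]
    constructor
    · rintro ⟨⟨_, h4⟩, rfl⟩
      exact h4
    · intro h4
      have h5 := (Finset.mem_filter.1 ((Finset.mem_powersetCard.1 (hs u)).1 h4)).2
      subst h5
      exact ⟨⟨Finset.mem_univ _, h4⟩, rfl⟩

lemma sum_powersetCard_profile {v : Y → V} {d : V → ℕ} (hd : ∀ u, profile v Finset.univ u + 1 = d u)
    (b : ℕ) (f : (V → ℕ) → ℝ) :
    ∑ B ∈ Finset.powersetCard b (Finset.univ : Finset Y), f (profile v B)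
      = ∑ g ∈ residualDegrees d b, ((∏ u, (d u - 1).choose (g u) : ℕ) : ℝ) * f g := by
  have hmaps : ∀ B ∈ Finset.powersetCard b (Finset.univ : Finset Y),
      profile v B ∈ residualDegrees d b := by
    intro B hB
    refine Finset.mem_filter.2 ⟨Fintype.mem_piFinset.2 fun u => ?_, ?_⟩
    · rw [Finset.mem_range, ← hd u]
      exact Nat.lt_succ_of_le (profile_le_profile_univ v B u)
    · rw [sum_profile]
      exact (Finset.mem_powersetCard.1 hB).2
  rw [← Finset.sum_fiberwise_of_maps_to hmaps]
  refine Finset.sum_congr rfl fun g hg => ?_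
  have h1 : (Finset.powersetCard b (Finset.univ : Finset Y)).filter (fun B => profile v B = g)
      = Finset.univ.filter fun B : Finset Y => profile v B = g := by
    ext B
    rw [Finset.mem_filter, Finset.mem_filter]
    refine ⟨fun h => ⟨Finset.mem_univ _, h.2⟩, fun h => ⟨?_, h.2⟩⟩
    rw [Finset.mem_powersetCard, ← sum_profile v B, h.2]
    exact ⟨Finset.subset_univ _, (Finset.mem_filter.1 hg).2⟩
  rw [Finset.sum_congr rfl fun B hB => by rw [(Finset.mem_filter.1 hB).2], Finset.sum_const, h1,
    card_profile_eq, nsmul_eq_mul]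
  congr 3
  funext u
  rw [← hd u, Nat.add_sub_cancel]

end Profile

/-- The exponent controlling the number of pairs of a tree and an edge-disjoint graph with
degrees `g`, where the tree has degrees `a + 1 - g`. -/
noncomputable def residualExponent {V : Type} [Fintype V] (n b : ℕ) (a g : V → ℕ) : ℝ :=
  (∑ u, (g u : ℝ) * (g u - 1)) / (2 * b) +
    (∑ u, ∑ w, if u ≠ w then ((g u : ℝ) * (g u - 1)) * (g w * (g w - 1)) else 0) / (4 * (b : ℝ) ^ 2) +
    (∑ u, ∑ w, if u ≠ w then (g u : ℝ) * ((a u : ℝ) - g u) * g w else 0) / (b * n)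

lemma exists_sum_card_spanningTrees_eq : ∃ C : ℝ, 0 < C ∧
    ∀ {V Y : Type} [Fintype V] [Fintype Y] {n : ℕ}, Fintype.card V = n + 2 → 0 < n →
      ∀ {v : Y → V} {d : V → ℕ} {D m : ℕ}, (∀ u, profile v Finset.univ u + 1 = d u) →
      (∀ u, d u ≤ D) → 3 ≤ D → ∑ u, d u = 2 * m + 2 * (n + 1) → D ^ 4 + 2 ≤ 2 * m →
      ∃ E : ℝ, |E| ≤ C * (D : ℝ) ^ 4 / (2 * m : ℕ) ∧
        (∑ G ∈ Finset.univ.filter (fun G : SimpleGraph V => ∀ u, G.degree u = d u),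
            ((Finset.univ.filter fun T : SimpleGraph V => T ≤ G ∧ T.IsTree).card : ℝ))
            * ∏ u, ((d u - 1).factorial : ℝ)
          = ((2 * m).factorial : ℝ) / (2 ^ m * m.factorial) * n.factorial *
            ((∑ B ∈ Finset.powersetCard (2 * m) (Finset.univ : Finset Y),
              Real.exp (-residualExponent n (2 * m) (profile v Finset.univ) (profile v B)))
                * Real.exp E) := by
  obtain ⟨C, hC, hG⟩ := exists_sum_graphCount_eq
  refine ⟨C, hC, ?_⟩
  intro V Y _ _ n hn hn0 v d D m hd hD hD3 hm hDm
  set κ : ℝ := ((2 * m).factorial : ℝ) / (2 ^ m * m.factorial) * n.factorial with hκ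
  have h1 : ∀ g : V → ℕ, ∃ e : ℝ, g ∈ residualDegrees d (2 * m) →
      |e| ≤ C * (D : ℝ) ^ 4 / (2 * m : ℕ) ∧
      (∑ T ∈ treesWithDegrees (fun u => d u - g u), (graphCount g T : ℝ))
          * ∏ u, ((d u - 1).factorial : ℝ)
        = κ * ((((∏ u, (d u - 1).choose (g u) : ℕ) : ℝ) *
          Real.exp (-residualExponent n (2 * m) (profile v Finset.univ) g)) * Real.exp e) := by
    intro g
    by_cases hg : g ∈ residualDegrees d (2 * m)
    · obtain ⟨h2, h3⟩ := Finset.mem_filter.1 hg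
      have h2' : ∀ u, g u < d u := fun u => Finset.mem_range.1 (Fintype.mem_piFinset.1 h2 u)
      have hx : ∑ u, (d u - g u) = 2 * (n + 1) := by
        have h5 : ∑ u, d u = ∑ u, (d u - g u) + ∑ u, g u := by
          rw [← Finset.sum_add_distrib]
          exact Finset.sum_congr rfl fun u _ => by have := h2' u; omega
        omega
      obtain ⟨e, he, h⟩ := hG hn hn0 (x := fun u => d u - g u) (g := g) (D := D) (m := m)
        (fun u => by have := h2' u; omega) hx
        (fun u => by have := h2' u; have := hD u; omega) hD3 h3 hDm
      refine ⟨e, fun _ => ⟨he, ?_⟩⟩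
      have h4 : ((∏ u, (d u - 1).choose (g u) : ℕ) : ℝ) *
          ((∏ u, ((g u).factorial : ℝ)) * ∏ u, ((d u - g u - 1).factorial : ℝ))
          = ∏ u, ((d u - 1).factorial : ℝ) := by
        push_cast
        rw [← Finset.prod_mul_distrib, ← Finset.prod_mul_distrib]
        refine Finset.prod_congr rfl fun u _ => ?_
        have := h2' u
        rw [← mul_assoc]
        have h6 : d u - g u - 1 = d u - 1 - g u := by omega
        rw [h6]
        exact_mod_cast Nat.choose_mul_factorial_mul_factorial (by omega : g u ≤ d u - 1)
      have h5 : (∑ u, ∑ w, if u ≠ w then (g u : ℝ) * (((d u - g u : ℕ) : ℝ) - 1) * g w else 0)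
          = ∑ u, ∑ w, if u ≠ w then (g u : ℝ) * ((profile v Finset.univ u : ℝ) - g u) * g w
              else 0 := by
        refine Finset.sum_congr rfl fun u _ => Finset.sum_congr rfl fun w _ => ?_
        rw [Nat.cast_sub (h2' u).le, ← hd u]
        push_cast
        split_ifs
        · ring
        · rfl
      rw [h5] at h
      rw [← h4]
      rw [mul_comm ((∏ u, (d u - 1).choose (g u) : ℕ) : ℝ), ← mul_assoc, h, hκ, residualExponent,
        Real.exp_add]
      ring
    · exact ⟨0, fun h => absurd h hg⟩
  choose e he using h1
  obtain ⟨E, hE, h2⟩ := exists_sum_mul_exp_eq (residualDegrees d (2 * m))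
    (a := fun g => ((∏ u, (d u - 1).choose (g u) : ℕ) : ℝ) *
          Real.exp (-residualExponent n (2 * m) (profile v Finset.univ) g))
    (e := e) (ε := C * (D : ℝ) ^ 4 / (2 * m : ℕ)) (by positivity)
    (fun g _ => by positivity) (fun g hg => (he g hg).1)
  refine ⟨E, hE, ?_⟩
  rw [sum_powersetCard_profile hd (2 * m) fun g =>
    Real.exp (-residualExponent n (2 * m) (profile v Finset.univ) g), ← h2]
  have h3 := sum_card_spanningTrees hn d hm
  have h4 : (∑ G ∈ Finset.univ.filter (fun G : SimpleGraph V => ∀ u, G.degree u = d u),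
            ((Finset.univ.filter fun T : SimpleGraph V => T ≤ G ∧ T.IsTree).card : ℝ))
      = ∑ g ∈ residualDegrees d (2 * m),
        ∑ T ∈ treesWithDegrees (fun v => d v - g v), (graphCount g T : ℝ) := by
    exact_mod_cast h3
  rw [h4, Finset.sum_mul, Finset.sum_congr rfl fun g hg => (he g hg).2, ← Finset.mul_sum]

section FibrePairs

variable {V Y : Type}

/-- An ordered pair of distinct points in the same fibre of `v`. -/
def IsFibrePair (v : Y → V) (e : Y × Y) : Prop := v e.1 = v e.2 ∧ e.1 ≠ e.2

variable {v : Y → V}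

lemma card_filter_fibre_ne (A : Finset Y) {p : Y} (hp : p ∈ A) :
    ((A.filter fun z => v p = v z ∧ p ≠ z).card : ℝ) = (profile v A (v p) : ℝ) - 1 := by
  have h1 : (A.filter fun z => v p = v z ∧ p ≠ z) = (A.filter fun z => v z = v p).erase p := by
    ext z
    simp only [Finset.mem_filter, Finset.mem_erase]
    exact ⟨fun h => ⟨h.2.2.symm, h.1, h.2.1.symm⟩, fun h => ⟨h.2.1, h.2.2.symm, h.1.symm⟩⟩
  have h2 : p ∈ A.filter fun z => v z = v p := Finset.mem_filter.2 ⟨hp, rfl⟩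
  rw [h1, ← Nat.cast_one, Finset.card_erase_of_mem h2, Nat.cast_sub (Finset.card_pos.2 ⟨p, h2⟩),
    profile]

variable [Fintype Y]

lemma card_filter_fibre_compl (A : Finset Y) {p : Y} (hp : p ∈ A) :
    ((Aᶜ.filter fun z => v p = v z ∧ p ≠ z).card : ℝ)
      = (profile v Finset.univ (v p) : ℝ) - profile v A (v p) := by
  have h1 : (Finset.univ.filter fun z => v z = v p)
      = (A.filter fun z => v z = v p) ∪ Aᶜ.filter fun z => v p = v z ∧ p ≠ z := by
    ext z
    simp only [Finset.mem_filter, Finset.mem_union, Finset.mem_compl, Finset.mem_univ, true_and]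
    constructor
    · intro h
      by_cases hz : z ∈ A
      · exact Or.inl ⟨hz, h⟩
      · exact Or.inr ⟨hz, h.symm, fun h2 => hz (h2 ▸ hp)⟩
    · rintro (h | h)
      · exact h.2
      · exact h.2.1.symm
  have h2 : Disjoint (A.filter fun z => v z = v p) (Aᶜ.filter fun z => v p = v z ∧ p ≠ z) := by
    rw [Finset.disjoint_left]
    intro z hz hz2
    exact Finset.mem_compl.1 (Finset.mem_filter.1 hz2).1 (Finset.mem_filter.1 hz).1
  rw [profile, profile, h1, Finset.card_union_of_disjoint h2]
  push_cast
  ring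

lemma sum_fst_mem_isFibrePair_le {D : ℕ} (hD : ∀ u, profile v Finset.univ u ≤ D) (A : Finset Y) :
    ∑ e : Y × Y, (if e.1 ∈ A ∧ IsFibrePair v e then (1 : ℝ) else 0) ≤ D * A.card := by
  rw [Fintype.sum_prod_type]
  calc ∑ p, ∑ q, (if p ∈ A ∧ IsFibrePair v (p, q) then (1 : ℝ) else 0)
      ≤ ∑ p, (if p ∈ A then (D : ℝ) else 0) := by
        refine Finset.sum_le_sum fun p _ => ?_
        split_ifs with hp
        · calc ∑ q, (if p ∈ A ∧ IsFibrePair v (p, q) then (1 : ℝ) else 0)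
              ≤ ∑ q, (if v q = v p then (1 : ℝ) else 0) := by
                refine Finset.sum_le_sum fun q _ => ?_
                by_cases h : v q = v p
                · rw [if_pos h]
                  split_ifs <;> norm_num
                · rw [if_neg h, if_neg fun h2 => h h2.2.1.symm]
            _ = profile v Finset.univ (v p) := by
                rw [Finset.sum_boole, profile]
            _ ≤ D := by exact_mod_cast hD _
        · exact le_of_eq (Finset.sum_eq_zero fun q _ => if_neg fun h => hp h.1)
    _ = D * A.card := by
        rw [← Finset.sum_filter, Finset.sum_const, nsmul_eq_mul, mul_comm]
        congr 3
        ext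
        simp

lemma sum_snd_mem_isFibrePair_le {D : ℕ} (hD : ∀ u, profile v Finset.univ u ≤ D) (A : Finset Y) :
    ∑ e : Y × Y, (if e.2 ∈ A ∧ IsFibrePair v e then (1 : ℝ) else 0) ≤ D * A.card := by
  refine le_trans (le_of_eq ?_) (sum_fst_mem_isFibrePair_le hD A)
  refine Fintype.sum_equiv (Equiv.prodComm Y Y) _ _ fun e => ?_
  have h : IsFibrePair v e ↔ IsFibrePair v (Equiv.prodComm Y Y e) :=
    ⟨fun h => ⟨h.1.symm, h.2.symm⟩, fun h => ⟨h.1.symm, h.2.symm⟩⟩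
  rw [← h]
  rfl

variable [Fintype V]

lemma sum_isFibrePair_eq {A Z : Finset Y} {c : V → ℝ}
    (hc : ∀ p ∈ A, ((Z.filter fun z => v p = v z ∧ p ≠ z).card : ℝ) = c (v p)) (f : V → ℝ) :
    ∑ e : Y × Y, (if (e.1 ∈ A ∧ e.2 ∈ Z) ∧ IsFibrePair v e then f (v e.1) else 0)
      = ∑ u, (profile v A u : ℝ) * c u * f u := by
  rw [Fintype.sum_prod_type]
  have h1 : ∀ p, ∑ q, (if (p ∈ A ∧ q ∈ Z) ∧ IsFibrePair v (p, q) then f (v p) else 0)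
      = if p ∈ A then c (v p) * f (v p) else 0 := by
    intro p
    split_ifs with hp
    · rw [← hc p hp, ← Finset.sum_filter, Finset.sum_const, nsmul_eq_mul]
      congr 3
      ext z
      rw [Finset.mem_filter, Finset.mem_filter]
      simp only [hp, true_and, Finset.mem_univ]
      rfl
    · exact Finset.sum_eq_zero fun q _ => if_neg fun h => hp h.1.1
  have h2 : ∀ g : Y → ℝ, ∑ p, (if p ∈ A then g p else 0) = ∑ p ∈ A, g p := by
    intro g
    rw [← Finset.sum_filter]
    congr 1
    ext
    simp
  simp only [h1]
  rw [h2, sum_comp_eq_sum_profile v A fun u => c u * f u]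
  simp only [mul_assoc]

/-- Double sum over pairs of fibre pairs in distinct fibres. -/
lemma sum_isFibrePair_isFibrePair_eq (A : Finset Y) (w : ℝ) :
    ∑ i : (Y × Y) × (Y × Y), (if (i.1.1 ∈ A ∧ i.1.2 ∈ A) ∧ (i.2.1 ∈ A ∧ i.2.2 ∈ A) then
        (if (IsFibrePair v i.1 ∧ IsFibrePair v i.2) ∧ v i.1.1 ≠ v i.2.1 then w else 0) else 0)
      = (∑ u, ∑ u', if u ≠ u' then ((profile v A u : ℝ) * (profile v A u - 1)) *
          (profile v A u' * (profile v A u' - 1)) else 0) * w := by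
  rw [Fintype.sum_prod_type]
  have h1 : ∀ e : Y × Y, ∑ e' : Y × Y, (if (e.1 ∈ A ∧ e.2 ∈ A) ∧ (e'.1 ∈ A ∧ e'.2 ∈ A) then
        (if (IsFibrePair v e ∧ IsFibrePair v e') ∧ v e.1 ≠ v e'.1 then w else 0) else 0)
      = if (e.1 ∈ A ∧ e.2 ∈ A) ∧ IsFibrePair v e then
          (fun u => ∑ u', (profile v A u' : ℝ) * ((profile v A u' : ℝ) - 1) *
            if u ≠ u' then w else 0) (v e.1) else 0 := by
    intro e
    dsimp only
    rw [← sum_isFibrePair_eq (A := A) (Z := A) (c := fun u => (profile v A u : ℝ) - 1)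
      (fun p hp => card_filter_fibre_ne A hp) fun u' => if v e.1 ≠ u' then w else 0]
    split_ifs with h
    · refine Finset.sum_congr rfl fun e' _ => ?_
      split_ifs <;> tauto
    · refine Finset.sum_eq_zero fun e' _ => ?_
      split_ifs <;> tauto
  refine (Finset.sum_congr rfl fun e _ => h1 e).trans ((sum_isFibrePair_eq (A := A) (Z := A)
    (c := fun u => (profile v A u : ℝ) - 1) (fun p hp => card_filter_fibre_ne A hp)
    fun u => ∑ u', (profile v A u' : ℝ) * ((profile v A u' : ℝ) - 1) *
      if u ≠ u' then w else 0).trans ?_)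
  simp only [Finset.mul_sum, Finset.sum_mul]
  refine Finset.sum_congr rfl fun u _ => Finset.sum_congr rfl fun u' _ => ?_
  split_ifs <;> ring

lemma sum_isFibrePair_point_eq {A Z : Finset Y} {c : V → ℝ}
    (hc : ∀ p ∈ A, ((Z.filter fun z => v p = v z ∧ p ≠ z).card : ℝ) = c (v p)) (w : ℝ) :
    ∑ i : (Y × Y) × Y, (if (i.1.1 ∈ A ∧ i.1.2 ∈ Z) ∧ i.2 ∈ A then
        (if IsFibrePair v i.1 ∧ v i.1.1 ≠ v i.2 then w else 0) else 0)
      = (∑ u, ∑ u', if u ≠ u' then (profile v A u : ℝ) * c u * profile v A u' else 0) * w := by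
  rw [Fintype.sum_prod_type]
  have h1 : ∀ e : Y × Y, ∑ q : Y, (if (e.1 ∈ A ∧ e.2 ∈ Z) ∧ q ∈ A then
        (if IsFibrePair v e ∧ v e.1 ≠ v q then w else 0) else 0)
      = if (e.1 ∈ A ∧ e.2 ∈ Z) ∧ IsFibrePair v e then
          (fun u => ∑ u', (profile v A u' : ℝ) * if u ≠ u' then w else 0) (v e.1) else 0 := by
    intro e
    dsimp only
    rw [← sum_comp_eq_sum_profile v A fun u' => if v e.1 ≠ u' then w else 0]
    have h2 : A = Finset.univ.filter fun q => q ∈ A := by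
      ext
      simp
    rw [h2, Finset.sum_filter, ← h2]
    split_ifs with h
    · refine Finset.sum_congr rfl fun e' _ => ?_
      split_ifs <;> tauto
    · refine Finset.sum_eq_zero fun e' _ => ?_
      split_ifs <;> tauto
  refine (Finset.sum_congr rfl fun e _ => h1 e).trans ((sum_isFibrePair_eq hc
    fun u => ∑ u', (profile v A u' : ℝ) * if u ≠ u' then w else 0).trans ?_)
  simp only [Finset.mul_sum, Finset.sum_mul]
  refine Finset.sum_congr rfl fun u _ => Finset.sum_congr rfl fun u' _ => ?_
  split_ifs <;> ring

end FibrePairs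

lemma cast_descFactorial_three {b : ℕ} (hb : 3 ≤ b) :
    (b.descFactorial 3 : ℝ) = b * (b - 1) * (b - 2) := by
  obtain ⟨c, rfl⟩ := Nat.exists_eq_add_of_le hb
  simp only [Nat.descFactorial_succ, Nat.descFactorial_zero]
  rw [show 3 + c - 2 = c + 1 by omega, show 3 + c - 1 = c + 2 by omega, show 3 + c - 0 = c + 3 by omega]
  push_cast
  ring

lemma cast_descFactorial_four {b : ℕ} (hb : 4 ≤ b) :
    (b.descFactorial 4 : ℝ) = b * (b - 1) * (b - 2) * (b - 3) := by
  obtain ⟨c, rfl⟩ := Nat.exists_eq_add_of_le hb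
  simp only [Nat.descFactorial_succ, Nat.descFactorial_zero]
  rw [show 4 + c - 3 = c + 1 by omega, show 4 + c - 2 = c + 2 by omega,
    show 4 + c - 1 = c + 3 by omega, show 4 + c - 0 = c + 4 by omega]
  push_cast
  ring

section ResidualIndex

variable {V Y : Type}

/-- Index set of the monomials of `residualExponent` as a function of a random set of points. -/
abbrev ResidualIndex (Y : Type) : Type := (Y × Y) ⊕ (((Y × Y) × (Y × Y)) ⊕ ((Y × Y) × Y))

/-- The points a monomial requires to be chosen. -/
noncomputable def chosenPoints : ResidualIndex Y → Finset Y :=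
  Sum.elim (fun e => {e.1, e.2})
    (Sum.elim (fun i => {i.1.1, i.1.2, i.2.1, i.2.2}) fun i => {i.1.1, i.2})

/-- The points a monomial requires not to be chosen. -/
noncomputable def avoidedPoints : ResidualIndex Y → Finset Y :=
  Sum.elim (fun _ => ∅) (Sum.elim (fun _ => ∅) fun i => {i.1.2} \ {i.1.1, i.2})

/-- The coefficient of a monomial. -/
noncomputable def monomialWeight (v : Y → V) (n b : ℕ) : ResidualIndex Y → ℝ :=
  Sum.elim (fun e => if IsFibrePair v e then 1 / (2 * (b : ℝ)) else 0)
    (Sum.elim (fun i => if (IsFibrePair v i.1 ∧ IsFibrePair v i.2) ∧ v i.1.1 ≠ v i.2.1 then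
        1 / (4 * (b : ℝ) ^ 2) else 0)
      fun i => if IsFibrePair v i.1 ∧ v i.1.1 ≠ v i.2 then 1 / ((b : ℝ) * n) else 0)

lemma disjoint_chosenPoints_avoidedPoints (i : ResidualIndex Y) :
    Disjoint (chosenPoints i) (avoidedPoints i) := by
  rcases i with e | i | i
  · simp [chosenPoints, avoidedPoints]
  · simp [chosenPoints, avoidedPoints]
  · exact Finset.disjoint_sdiff

lemma card_chosenPoints_add_card_avoidedPoints_le (i : ResidualIndex Y) :
    (chosenPoints i).card + (avoidedPoints i).card ≤ 4 := by
  rcases i with e | i | i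
  · have : ({e.1, e.2} : Finset Y).card ≤ 2 := Finset.card_le_two
    simp only [chosenPoints, avoidedPoints, Sum.elim_inl, Finset.card_empty]
    omega
  · exact Finset.card_le_four
  · have h1 : ({i.1.1, i.2} : Finset Y).card ≤ 2 := Finset.card_le_two
    have h2 : (({i.1.2} : Finset Y) \ {i.1.1, i.2}).card ≤ 1 := by
      refine (Finset.card_le_card Finset.sdiff_subset).trans ?_
      simp
    simp only [chosenPoints, avoidedPoints, Sum.elim_inr]
    omega

lemma monomialWeight_nonneg (v : Y → V) (n b : ℕ) (i : ResidualIndex Y) :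
    0 ≤ monomialWeight v n b i := by
  rcases i with e | i | i <;> simp only [monomialWeight, Sum.elim_inl, Sum.elim_inr] <;>
    split_ifs <;> positivity

lemma monomialWeight_le (v : Y → V) {n b : ℕ} (hn : 0 < n) (hb : 0 < b) (i : ResidualIndex Y) :
    monomialWeight v n b i ≤ 1 / b := by
  have hn' : (1 : ℝ) ≤ n := by exact_mod_cast hn
  have hb' : (1 : ℝ) ≤ b := by exact_mod_cast hb
  rcases i with e | i | i <;> simp only [monomialWeight, Sum.elim_inl, Sum.elim_inr] <;>
    split_ifs
  · exact one_div_le_one_div_of_le (by positivity) (by linarith)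
  · positivity
  · exact one_div_le_one_div_of_le (by positivity) (by nlinarith)
  · positivity
  · exact one_div_le_one_div_of_le (by positivity) (by nlinarith)
  · positivity

variable [Fintype V] [Fintype Y] {v : Y → V}

lemma sum_monomialWeight_eq_residualExponent (n b : ℕ) (B : Finset Y) :
    ∑ i, (if chosenPoints i ⊆ B ∧ Disjoint (avoidedPoints i) B then monomialWeight v n b i else 0)
      = residualExponent n b (profile v Finset.univ) (profile v B) := by
  rw [Fintype.sum_sum_type, Fintype.sum_sum_type, ← add_assoc]
  have h1 : ∑ e : Y × Y, (if chosenPoints (Sum.inl e) ⊆ B ∧ Disjoint (avoidedPoints (Sum.inl e)) B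
        then monomialWeight v n b (Sum.inl e) else 0)
      = (∑ u, (profile v B u : ℝ) * (profile v B u - 1)) / (2 * b) := by
    rw [div_eq_mul_one_div, Finset.sum_mul]
    refine Eq.trans ?_ (sum_isFibrePair_eq (A := B) (Z := B) (c := fun u => (profile v B u : ℝ) - 1)
      (fun p hp => card_filter_fibre_ne B hp) fun _ => 1 / (2 * (b : ℝ)))
    refine Finset.sum_congr rfl fun e _ => ?_
    simp only [chosenPoints, avoidedPoints, monomialWeight, Sum.elim_inl, Finset.insert_subset_iff,
      Finset.singleton_subset_iff, Finset.disjoint_empty_left, and_true]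
    by_cases h : e.1 ∈ B ∧ e.2 ∈ B <;> by_cases h2 : IsFibrePair v e <;> simp [h, h2]
  have h2 : ∑ i : (Y × Y) × (Y × Y), (if chosenPoints (Sum.inr (Sum.inl i)) ⊆ B ∧
        Disjoint (avoidedPoints (Sum.inr (Sum.inl i))) B
        then monomialWeight v n b (Sum.inr (Sum.inl i)) else 0)
      = (∑ u, ∑ w, if u ≠ w then ((profile v B u : ℝ) * (profile v B u - 1)) *
          (profile v B w * (profile v B w - 1)) else 0) / (4 * (b : ℝ) ^ 2) := by
    rw [div_eq_mul_one_div]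
    refine Eq.trans ?_ (sum_isFibrePair_isFibrePair_eq B (1 / (4 * (b : ℝ) ^ 2)))
    refine Finset.sum_congr rfl fun i _ => ?_
    simp only [chosenPoints, avoidedPoints, monomialWeight, Sum.elim_inl, Sum.elim_inr,
      Finset.insert_subset_iff, Finset.singleton_subset_iff, Finset.disjoint_empty_left, and_true]
    congr 1
    rw [← and_assoc]
  have h3 : ∑ i : (Y × Y) × Y, (if chosenPoints (Sum.inr (Sum.inr i)) ⊆ B ∧
        Disjoint (avoidedPoints (Sum.inr (Sum.inr i))) B
        then monomialWeight v n b (Sum.inr (Sum.inr i)) else 0)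
      = (∑ u, ∑ w, if u ≠ w then (profile v B u : ℝ) *
          ((profile v Finset.univ u : ℝ) - profile v B u) * profile v B w else 0) / (b * n) := by
    rw [div_eq_mul_one_div]
    refine Eq.trans ?_ (sum_isFibrePair_point_eq (A := B) (Z := Bᶜ)
      (c := fun u => (profile v Finset.univ u : ℝ) - profile v B u)
      (fun p hp => card_filter_fibre_compl B hp) (1 / ((b : ℝ) * n)))
    refine Finset.sum_congr rfl fun i _ => ?_
    simp only [chosenPoints, avoidedPoints, monomialWeight, Sum.elim_inr,
      Finset.insert_subset_iff, Finset.singleton_subset_iff]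
    by_cases h : IsFibrePair v i.1 ∧ v i.1.1 ≠ v i.2
    · rw [if_pos h]
      have h4 : ({i.1.2} : Finset Y) \ {i.1.1, i.2} = {i.1.2} := by
        rw [Finset.sdiff_eq_self_iff_disjoint, Finset.disjoint_singleton_left, Finset.mem_insert,
          Finset.mem_singleton, not_or]
        exact ⟨h.1.2.symm, fun h5 => h.2 (by rw [h.1.1, h5])⟩
      rw [h4]
      refine if_congr ?_ rfl rfl
      rw [Finset.disjoint_singleton_left, Finset.mem_compl]
      tauto
    · simp [h]
  rw [h1, h2, h3, residualExponent]

/-- The mean of `residualExponent` over a uniform random set of `b` out of `M` points, where the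
fibres have sizes `a`. -/
noncomputable def meanExponent (n b : ℕ) (M : ℝ) (a : V → ℕ) : ℝ :=
  (∑ u, (a u : ℝ) * (a u - 1)) * (1 / (2 * b) * (b * (b - 1) / (M * (M - 1)))) +
    (∑ u, ∑ w, if u ≠ w then ((a u : ℝ) * (a u - 1)) * (a w * (a w - 1)) else 0) *
      (1 / (4 * (b : ℝ) ^ 2) *
        (b * (b - 1) * (b - 2) * (b - 3) / (M * (M - 1) * (M - 2) * (M - 3)))) +
    (∑ u, ∑ w, if u ≠ w then (a u : ℝ) * ((a u : ℝ) - 1) * a w else 0) *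
      (1 / (b * n) * (b * (b - 1) * n / (M * (M - 1) * (M - 2))))

set_option maxHeartbeats 2000000 in
lemma sum_monomialWeight_mul_eq_meanExponent {n b : ℕ} (hb : 4 ≤ b)
    (hY : Fintype.card Y = b + n) :
    ∑ i, monomialWeight v n b i * (b.descFactorial (chosenPoints i).card
            * (Fintype.card Y - b).descFactorial (avoidedPoints i).card
            / (Fintype.card Y).descFactorial ((chosenPoints i).card + (avoidedPoints i).card))
      = meanExponent n b (Fintype.card Y : ℝ) (profile v Finset.univ) := by
  rw [Fintype.sum_sum_type, Fintype.sum_sum_type, ← add_assoc]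
  have hM : 4 ≤ Fintype.card Y := by omega
  have hn : Fintype.card Y - b = n := by omega
  have h1 : ∑ e : Y × Y, monomialWeight v n b (Sum.inl e) *
        (b.descFactorial (chosenPoints (Sum.inl e)).card
            * (Fintype.card Y - b).descFactorial (avoidedPoints (Sum.inl e)).card
            / (Fintype.card Y).descFactorial
              ((chosenPoints (Sum.inl e)).card + (avoidedPoints (Sum.inl e)).card))
      = (∑ u, (profile v Finset.univ u : ℝ) * (profile v Finset.univ u - 1)) *
        (1 / (2 * b) * (b * (b - 1) / (Fintype.card Y * (Fintype.card Y - 1)))) := by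
    rw [Finset.sum_mul]
    refine Eq.trans ?_ (sum_isFibrePair_eq (A := Finset.univ) (Z := Finset.univ)
      (c := fun u => (profile v Finset.univ u : ℝ) - 1)
      (fun p hp => card_filter_fibre_ne Finset.univ hp) fun _ => 1 / (2 * (b : ℝ)) *
        (b * (b - 1) / (Fintype.card Y * (Fintype.card Y - 1))))
    refine Finset.sum_congr rfl fun e _ => ?_
    simp only [chosenPoints, avoidedPoints, monomialWeight, Sum.elim_inl, Finset.mem_univ,
      true_and, Finset.card_empty, Nat.descFactorial_zero, Nat.cast_one, mul_one, add_zero]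
    by_cases h : IsFibrePair v e
    · rw [if_pos h, if_pos h, Finset.card_pair h.2, Nat.cast_descFactorial_two,
        Nat.cast_descFactorial_two]
    · rw [if_neg h, if_neg h, zero_mul]
  have h2 : ∑ i : (Y × Y) × (Y × Y), monomialWeight v n b (Sum.inr (Sum.inl i)) *
        (b.descFactorial (chosenPoints (Sum.inr (Sum.inl i))).card
            * (Fintype.card Y - b).descFactorial (avoidedPoints (Sum.inr (Sum.inl i))).card
            / (Fintype.card Y).descFactorial ((chosenPoints (Sum.inr (Sum.inl i))).card
              + (avoidedPoints (Sum.inr (Sum.inl i))).card))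
      = (∑ u, ∑ w, if u ≠ w then ((profile v Finset.univ u : ℝ) * (profile v Finset.univ u - 1)) *
          (profile v Finset.univ w * (profile v Finset.univ w - 1)) else 0) *
        (1 / (4 * (b : ℝ) ^ 2) *
        (b * (b - 1) * (b - 2) * (b - 3) / (Fintype.card Y * (Fintype.card Y - 1) *
          (Fintype.card Y - 2) * (Fintype.card Y - 3)))) := by
    generalize hw : 1 / (4 * (b : ℝ) ^ 2) * (b * (b - 1) * (b - 2) * (b - 3) /
      ((Fintype.card Y : ℝ) * (Fintype.card Y - 1) * (Fintype.card Y - 2) *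
        (Fintype.card Y - 3))) = w
    refine Eq.trans ?_ (sum_isFibrePair_isFibrePair_eq Finset.univ w)
    refine Finset.sum_congr rfl fun i _ => ?_
    simp only [chosenPoints, avoidedPoints, monomialWeight, Sum.elim_inl, Sum.elim_inr,
      Finset.mem_univ, true_and, Finset.card_empty, Nat.descFactorial_zero, Nat.cast_one, mul_one,
      add_zero, if_true]
    by_cases h : (IsFibrePair v i.1 ∧ IsFibrePair v i.2) ∧ v i.1.1 ≠ v i.2.1
    · have h4 : ({i.1.1, i.1.2, i.2.1, i.2.2} : Finset Y).card = 4 := by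
        have e1 := h.1.1.1
        have e2 := h.1.2.1
        have e3 := h.2
        rw [Finset.card_insert_of_notMem, Finset.card_insert_of_notMem, Finset.card_pair h.1.2.2]
        · simp only [Finset.mem_insert, Finset.mem_singleton, not_or]
          exact ⟨fun h5 => e3 (by rw [e1, h5]), fun h5 => e3 (by rw [e1, h5, e2])⟩
        · simp only [Finset.mem_insert, Finset.mem_singleton, not_or]
          exact ⟨h.1.1.2, fun h5 => e3 (by rw [h5]), fun h5 => e3 (by rw [h5, e2])⟩
      simp only [if_pos h, h4]
      rw [cast_descFactorial_four hb, cast_descFactorial_four hM, hw]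
    · simp only [if_neg h, zero_mul]
  have h3 : ∑ i : (Y × Y) × Y, monomialWeight v n b (Sum.inr (Sum.inr i)) *
        (b.descFactorial (chosenPoints (Sum.inr (Sum.inr i))).card
            * (Fintype.card Y - b).descFactorial (avoidedPoints (Sum.inr (Sum.inr i))).card
            / (Fintype.card Y).descFactorial ((chosenPoints (Sum.inr (Sum.inr i))).card
              + (avoidedPoints (Sum.inr (Sum.inr i))).card))
      = (∑ u, ∑ w, if u ≠ w then (profile v Finset.univ u : ℝ) *
          ((profile v Finset.univ u : ℝ) - 1) * profile v Finset.univ w else 0) *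
      (1 / (b * n) * (b * (b - 1) * n / (Fintype.card Y * (Fintype.card Y - 1) *
        (Fintype.card Y - 2)))) := by
    generalize hw : 1 / ((b : ℝ) * n) * (b * (b - 1) * n / ((Fintype.card Y : ℝ) *
      (Fintype.card Y - 1) * (Fintype.card Y - 2))) = w
    refine Eq.trans ?_ (sum_isFibrePair_point_eq (A := Finset.univ) (Z := Finset.univ)
      (c := fun u => (profile v Finset.univ u : ℝ) - 1)
      (fun p hp => card_filter_fibre_ne Finset.univ hp) w)
    refine Finset.sum_congr rfl fun i _ => ?_
    simp only [chosenPoints, avoidedPoints, monomialWeight, Sum.elim_inr,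
      Finset.mem_univ, true_and, if_true, hn]
    by_cases h : IsFibrePair v i.1 ∧ v i.1.1 ≠ v i.2
    · have h4 : ({i.1.2} : Finset Y) \ {i.1.1, i.2} = {i.1.2} := by
        rw [Finset.sdiff_eq_self_iff_disjoint, Finset.disjoint_singleton_left, Finset.mem_insert,
          Finset.mem_singleton, not_or]
        exact ⟨h.1.2.symm, fun h5 => h.2 (by rw [h.1.1, h5])⟩
      have h5 : i.1.1 ≠ i.2 := fun h5 => h.2 (by rw [h5])
      simp only [if_pos h, h4, Finset.card_pair h5, Finset.card_singleton]
      rw [Nat.cast_descFactorial_two, Nat.descFactorial_one, cast_descFactorial_three (by omega),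
        hw]
    · simp only [if_neg h, zero_mul]
  rw [h1, h2, h3, meanExponent]

end ResidualIndex

section LocalBound

variable {V Y : Type} [Fintype Y] {v : Y → V}

lemma sum_mul_sum_le_of_nonneg {ι κ : Type*} [Fintype ι] [Fintype κ] {f : ι → ℝ} {g : κ → ℝ}
    {a c : ℝ} (hf : ∑ i, f i ≤ a) (hg : ∑ k, g k ≤ c) (hg0 : ∀ k, 0 ≤ g k) (ha : 0 ≤ a) :
    ∑ i : ι × κ, f i.1 * g i.2 ≤ a * c := by
  rw [Fintype.sum_prod_type, ← Finset.sum_mul_sum]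
  exact mul_le_mul hf hg (Finset.sum_nonneg fun k _ => hg0 k) ha

lemma sum_indicator_mem (A : Finset Y) : ∑ q, (if q ∈ A then (1 : ℝ) else 0) = A.card := by
  rw [Finset.sum_boole]
  congr 2
  ext
  simp

set_option maxHeartbeats 2000000 in
lemma sum_monomialWeight_mem_le {n b D : ℕ} (hD : ∀ u, profile v Finset.univ u ≤ D) (hn : 0 < n)
    (hb : 0 < b) (hY : Fintype.card Y = b + n) (hbn : b ≤ D * n) {B : Finset Y} (hB : B.card = b)
    (y : Y) :
    ∑ i, (if (chosenPoints i ⊆ B ∧ Disjoint (avoidedPoints i) B) ∧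
        y ∈ chosenPoints i ∪ avoidedPoints i then monomialWeight v n b i else 0)
      ≤ 5 * (D : ℝ) ^ 2 / b := by
  have hn' : (0 : ℝ) < n := by exact_mod_cast hn
  have hb' : (0 : ℝ) < b := by exact_mod_cast hb
  have hbn' : (b : ℝ) ≤ D * n := by exact_mod_cast hbn
  have hD1 : (1 : ℝ) ≤ D := by
    rcases Nat.eq_zero_or_pos D with h | h
    · subst h
      simp at hbn
      omega
    · exact_mod_cast h
  set f : Finset Y → Y × Y → ℝ := fun A e => if e.1 ∈ A ∧ IsFibrePair v e then (1 : ℝ) else 0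
    with hf
  set s : Finset Y → Y × Y → ℝ := fun A e => if e.2 ∈ A ∧ IsFibrePair v e then (1 : ℝ) else 0
    with hs
  set χ : Finset Y → Y → ℝ := fun A q => if q ∈ A then (1 : ℝ) else 0 with hχ
  have hfs : ∀ A, ∑ e, f A e ≤ D * A.card := sum_fst_mem_isFibrePair_le hD
  have hss : ∀ A, ∑ e, s A e ≤ D * A.card := sum_snd_mem_isFibrePair_le hD
  have hχs : ∀ A, ∑ q, χ A q ≤ A.card := fun A => (sum_indicator_mem A).le
  have hf0 : ∀ A e, 0 ≤ f A e := fun A e => by simp only [hf]; split_ifs <;> norm_num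
  have hs0 : ∀ A e, 0 ≤ s A e := fun A e => by simp only [hs]; split_ifs <;> norm_num
  have hχ0 : ∀ A q, 0 ≤ χ A q := fun A e => by simp only [hχ]; split_ifs <;> norm_num
  have hf1 : ∀ {A : Finset Y} {e : Y × Y}, e.1 ∈ A → IsFibrePair v e → f A e = 1 :=
    fun h1 h2 => if_pos ⟨h1, h2⟩
  have hs1 : ∀ {A : Finset Y} {e : Y × Y}, e.2 ∈ A → IsFibrePair v e → s A e = 1 :=
    fun h1 h2 => if_pos ⟨h1, h2⟩
  have hχ1 : ∀ {A : Finset Y} {q : Y}, q ∈ A → χ A q = 1 := fun h1 => if_pos h1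
  have hBc : (Bᶜ.card : ℝ) = n := by
    rw [Finset.card_compl, hY, hB, Nat.add_sub_cancel_left]
  have hB' : (B.card : ℝ) = b := by rw [hB]
  have hy : (({y} : Finset Y).card : ℝ) = 1 := by simp
  have hfy : ∑ e, (f {y} e + s {y} e) ≤ 2 * D := by
    rw [Finset.sum_add_distrib]
    have h1 := hfs {y}
    have h2 := hss {y}
    rw [hy] at h1 h2
    linarith
  have hfB : ∑ e, f B e ≤ D * b := by
    have := hfs B
    rwa [hB'] at this
  rw [Fintype.sum_sum_type, Fintype.sum_sum_type]
  have h1 : ∑ e : Y × Y, (if (chosenPoints (Sum.inl e) ⊆ B ∧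
        Disjoint (avoidedPoints (Sum.inl e)) B) ∧
        y ∈ chosenPoints (Sum.inl e) ∪ avoidedPoints (Sum.inl e)
        then monomialWeight v n b (Sum.inl e) else 0) ≤ 2 * D * (1 / (2 * b)) := by
    refine le_trans (Finset.sum_le_sum (g := fun e => (f {y} e + s {y} e) * (1 / (2 * (b : ℝ))))
      fun e _ => ?_) ?_
    · split_ifs with h
      · obtain ⟨-, h2⟩ := h
        simp only [chosenPoints, avoidedPoints, monomialWeight, Sum.elim_inl, Finset.union_empty,
          Finset.mem_insert, Finset.mem_singleton] at h2 ⊢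
        have h5 := hf0 {y} e
        have h6 := hs0 {y} e
        split_ifs with h3
        · have h4 : 1 ≤ f {y} e + s {y} e := by
            rcases h2 with h2 | h2
            · rw [hf1 (Finset.mem_singleton.2 h2.symm) h3]
              linarith
            · rw [hs1 (Finset.mem_singleton.2 h2.symm) h3]
              linarith
          exact le_mul_of_one_le_left (by positivity) h4
        · positivity
      · have h5 := hf0 {y} e
        have h6 := hs0 {y} e
        positivity
    · rw [← Finset.sum_mul]
      exact mul_le_mul_of_nonneg_right hfy (by positivity)
  have h2 : ∑ i : (Y × Y) × (Y × Y), (if (chosenPoints (Sum.inr (Sum.inl i)) ⊆ B ∧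
        Disjoint (avoidedPoints (Sum.inr (Sum.inl i))) B) ∧
        y ∈ chosenPoints (Sum.inr (Sum.inl i)) ∪ avoidedPoints (Sum.inr (Sum.inl i))
        then monomialWeight v n b (Sum.inr (Sum.inl i)) else 0)
      ≤ (2 * D * (D * b) + D * b * (2 * D)) * (1 / (4 * (b : ℝ) ^ 2)) := by
    refine le_trans (Finset.sum_le_sum (g := fun i =>
      ((f {y} i.1 + s {y} i.1) * f B i.2 + f B i.1 * (f {y} i.2 + s {y} i.2)) *
        (1 / (4 * (b : ℝ) ^ 2))) fun i _ => ?_) ?_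
    · have h5 := hf0 {y} i.1
      have h6 := hs0 {y} i.1
      have h7 := hf0 {y} i.2
      have h8 := hs0 {y} i.2
      have h9 := hf0 B i.1
      have h10 := hf0 B i.2
      split_ifs with h
      · obtain ⟨⟨h1, -⟩, h2⟩ := h
        simp only [chosenPoints, avoidedPoints, monomialWeight, Sum.elim_inl, Sum.elim_inr,
          Finset.union_empty, Finset.mem_insert, Finset.mem_singleton, Finset.insert_subset_iff,
          Finset.singleton_subset_iff] at h1 h2 ⊢
        split_ifs with h3
        · refine le_mul_of_one_le_left (by positivity) ?_
          rw [hf1 h1.1 h3.1.1, hf1 h1.2.2.1 h3.1.2]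
          rcases h2 with h2 | h2 | h2 | h2
          · rw [hf1 (Finset.mem_singleton.2 h2.symm) h3.1.1]
            linarith
          · rw [hs1 (Finset.mem_singleton.2 h2.symm) h3.1.1]
            linarith
          · rw [hf1 (Finset.mem_singleton.2 h2.symm) h3.1.2]
            linarith
          · rw [hs1 (Finset.mem_singleton.2 h2.symm) h3.1.2]
            linarith
        · positivity
      · positivity
    · rw [← Finset.sum_mul, Finset.sum_add_distrib]
      refine mul_le_mul_of_nonneg_right (add_le_add ?_ ?_) (by positivity)
      · exact sum_mul_sum_le_of_nonneg hfy hfB (hf0 B) (by positivity)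
      · exact sum_mul_sum_le_of_nonneg hfB hfy (fun e => add_nonneg (hf0 _ e) (hs0 _ e))
          (by positivity)
  have h3 : ∑ i : (Y × Y) × Y, (if (chosenPoints (Sum.inr (Sum.inr i)) ⊆ B ∧
        Disjoint (avoidedPoints (Sum.inr (Sum.inr i))) B) ∧
        y ∈ chosenPoints (Sum.inr (Sum.inr i)) ∪ avoidedPoints (Sum.inr (Sum.inr i))
        then monomialWeight v n b (Sum.inr (Sum.inr i)) else 0)
      ≤ (2 * D * b + D * n * 1) * (1 / ((b : ℝ) * n)) := by
    refine le_trans (Finset.sum_le_sum (g := fun i =>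
      ((f {y} i.1 + s {y} i.1) * χ B i.2 + s Bᶜ i.1 * χ {y} i.2) *
        (1 / ((b : ℝ) * n))) fun i _ => ?_) ?_
    · have h5 := hf0 {y} i.1
      have h6 := hs0 {y} i.1
      have h7 := hχ0 B i.2
      have h8 := hχ0 {y} i.2
      have h9 := hs0 Bᶜ i.1
      split_ifs with h
      · obtain ⟨⟨h1, h0⟩, h2⟩ := h
        simp only [chosenPoints, avoidedPoints, monomialWeight, Sum.elim_inr, Finset.mem_union,
          Finset.mem_sdiff, Finset.mem_insert, Finset.mem_singleton, Finset.insert_subset_iff,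
          Finset.singleton_subset_iff] at h0 h1 h2 ⊢
        split_ifs with h3
        · refine le_mul_of_one_le_left (by positivity) ?_
          rw [hχ1 h1.2]
          rcases h2 with (h2 | h2) | h2
          · rw [hf1 (Finset.mem_singleton.2 h2.symm) h3.1]
            nlinarith [mul_nonneg h9 h8]
          · have h4 : i.1.2 ∉ B := by
              have h4 : ({i.1.2} : Finset Y) \ {i.1.1, i.2} = {i.1.2} := by
                rw [Finset.sdiff_eq_self_iff_disjoint, Finset.disjoint_singleton_left,
                  Finset.mem_insert, Finset.mem_singleton, not_or]
                exact ⟨h3.1.2.symm, fun h5 => h3.2 (by rw [h3.1.1, h5])⟩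
              rwa [h4, Finset.disjoint_singleton_left] at h0
            rw [hs1 (Finset.mem_compl.2 h4) h3.1, hχ1 (Finset.mem_singleton.2 h2.symm)]
            nlinarith
          · rw [hs1 (Finset.mem_singleton.2 h2.1.symm) h3.1]
            nlinarith [mul_nonneg h9 h8]
        · positivity
      · positivity
    · rw [← Finset.sum_mul, Finset.sum_add_distrib]
      refine mul_le_mul_of_nonneg_right (add_le_add ?_ ?_) (by positivity)
      · have := hχs B
        rw [hB'] at this
        exact sum_mul_sum_le_of_nonneg hfy this (hχ0 B) (by positivity)
      · have h4 := hss Bᶜ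
        have h5 := hχs {y}
        rw [hBc] at h4
        rw [hy] at h5
        exact sum_mul_sum_le_of_nonneg h4 h5 (hχ0 _) (by positivity)
  refine (add_le_add h1 (add_le_add h2 h3)).trans ?_
  have e1 : 2 * (D : ℝ) * (1 / (2 * b)) = D / b := by field_simp
  have e2 : (2 * (D : ℝ) * (D * b) + D * b * (2 * D)) * (1 / (4 * (b : ℝ) ^ 2)) = D ^ 2 / b := by
    field_simp
    ring
  have e3 : (2 * (D : ℝ) * b + D * n * 1) * (1 / ((b : ℝ) * n)) = 2 * D / n + D / b := by
    field_simp
  have e4 : 2 * (D : ℝ) / n ≤ 2 * D ^ 2 / b := by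
    rw [div_le_div_iff₀ hn' hb']
    nlinarith
  have e5 : (D : ℝ) / b ≤ D ^ 2 / b := by
    gcongr
    nlinarith
  rw [e1, e2, e3]
  calc _ ≤ (D : ℝ) ^ 2 / b + (D ^ 2 / b + (2 * D ^ 2 / b + D ^ 2 / b)) := by linarith
    _ = _ := by ring

end LocalBound

lemma natCast_mul_sub_one_nonneg (a : ℕ) : (0 : ℝ) ≤ a * (a - 1) := by
  rcases Nat.eq_zero_or_pos a with h | h
  · simp [h]
  · have : (1 : ℝ) ≤ a := by exact_mod_cast h
    exact mul_nonneg (by positivity) (by linarith)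

lemma sum_mul_sub_one_le {V : Type} [Fintype V] {a : V → ℕ} {D : ℕ} (hD : ∀ u, a u ≤ D) :
    ∑ u, (a u : ℝ) * (a u - 1) ≤ D * ∑ u, (a u : ℝ) := by
  rw [Finset.mul_sum]
  refine Finset.sum_le_sum fun u _ => ?_
  have h1 : (a u : ℝ) ≤ D := by exact_mod_cast hD u
  nlinarith [Nat.cast_nonneg (α := ℝ) (a u)]

lemma sum_sum_ne_mul_le {V : Type} [Fintype V] {f g : V → ℝ} (hf : ∀ u, 0 ≤ f u)
    (hg : ∀ u, 0 ≤ g u) :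
    ∑ u, ∑ w, (if u ≠ w then f u * g w else 0) ≤ (∑ u, f u) * ∑ w, g w := by
  rw [Finset.sum_mul_sum]
  refine Finset.sum_le_sum fun u _ => Finset.sum_le_sum fun w _ => ?_
  split_ifs
  · exact le_rfl
  · exact mul_nonneg (hf u) (hg w)

lemma meanExponent_le {V : Type} [Fintype V] {n b D : ℕ} {a : V → ℕ} (hD : ∀ u, a u ≤ D)
    (hD3 : 3 ≤ D) (hn : 0 < n) (hb : 4 ≤ b) (ha : ∑ u, a u = b + n) :
    meanExponent n b ((b + n : ℕ) : ℝ) a ≤ 2 * (D : ℝ) ^ 2 := by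
  have hn' : (1 : ℝ) ≤ n := by exact_mod_cast hn
  have hb' : (4 : ℝ) ≤ b := by exact_mod_cast hb
  have hD' : (3 : ℝ) ≤ D := by exact_mod_cast hD3
  have hsum : ∑ u, (a u : ℝ) = ((b + n : ℕ) : ℝ) := by
    rw [← ha]
    push_cast
    rfl
  have hM : ((b + n : ℕ) : ℝ) = b + n := by push_cast; rfl
  set M : ℝ := ((b + n : ℕ) : ℝ)
  have hS := sum_mul_sub_one_le hD
  rw [hsum] at hS
  have hS0 : 0 ≤ ∑ u, (a u : ℝ) * (a u - 1) :=
    Finset.sum_nonneg fun u _ => natCast_mul_sub_one_nonneg _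
  have hQ := sum_sum_ne_mul_le (fun u => natCast_mul_sub_one_nonneg (a u))
    fun u => natCast_mul_sub_one_nonneg (a u)
  have hT := sum_sum_ne_mul_le (g := fun u => (a u : ℝ)) (fun u => natCast_mul_sub_one_nonneg (a u))
    fun u => Nat.cast_nonneg (a u)
  rw [hsum] at hT
  set S := ∑ u, (a u : ℝ) * (a u - 1)
  have hM0 : 0 < M := by linarith
  have hM1 : 0 < M - 1 := by linarith
  have hM2 : 0 < M - 2 := by linarith
  have hM3 : 0 < M - 3 := by linarith
  have f1 : 1 / (2 * (b : ℝ)) * (b * (b - 1) / (M * (M - 1))) ≤ 1 / (2 * M) := by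
    rw [div_mul_div_comm, div_le_div_iff₀ (by positivity) (by positivity)]
    have : (0 : ℝ) ≤ 2 * b * M * ((M - 1) - (b - 1)) := by
      apply mul_nonneg (by positivity)
      linarith
    nlinarith
  have f2 : 1 / (4 * (b : ℝ) ^ 2) *
      (b * (b - 1) * (b - 2) * (b - 3) / (M * (M - 1) * (M - 2) * (M - 3))) ≤ 1 / (4 * M ^ 2) := by
    rw [div_mul_div_comm, div_le_div_iff₀ (by positivity) (by positivity)]
    have g1 : M * ((b : ℝ) - 1) ≤ b * (M - 1) := by nlinarith
    have g2 : M * ((b : ℝ) - 1) * (b - 2) ≤ b * (M - 1) * (M - 2) :=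
      mul_le_mul g1 (by linarith) (by linarith) (by positivity)
    have g3 : M * ((b : ℝ) - 1) * (b - 2) * (b - 3) ≤ b * (M - 1) * (M - 2) * (M - 3) :=
      mul_le_mul g2 (by linarith) (by linarith) (by positivity)
    have g4 : 4 * b * M * (M * ((b : ℝ) - 1) * (b - 2) * (b - 3))
        ≤ 4 * b * M * (b * (M - 1) * (M - 2) * (M - 3)) :=
      mul_le_mul_of_nonneg_left g3 (by positivity)
    nlinarith
  have f3 : 1 / ((b : ℝ) * n) * (b * (b - 1) * n / (M * (M - 1) * (M - 2))) ≤ 2 / M ^ 2 := by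
    rw [div_mul_div_comm, div_le_div_iff₀ (by positivity) (by positivity)]
    have g1 : M * ((b : ℝ) - 1) ≤ 2 * ((M - 1) * (M - 2)) := by nlinarith
    have g2 := mul_le_mul_of_nonneg_left g1 (by positivity : (0 : ℝ) ≤ b * n * M)
    nlinarith
  have k1 : S * (1 / (2 * (b : ℝ)) * (b * (b - 1) / (M * (M - 1)))) ≤ D / 2 := by
    calc _ ≤ (D * M) * (1 / (2 * M)) := mul_le_mul hS f1 (by
          have : (0 : ℝ) ≤ b - 1 := by linarith
          positivity) (by positivity)
      _ = _ := by field_simp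
  have k2 : (S * S) * (1 / (4 * (b : ℝ) ^ 2) *
      (b * (b - 1) * (b - 2) * (b - 3) / (M * (M - 1) * (M - 2) * (M - 3)))) ≤ D ^ 2 / 4 := by
    calc _ ≤ ((D * M) * (D * M)) * (1 / (4 * M ^ 2)) :=
          mul_le_mul (mul_le_mul hS hS hS0 (by positivity)) f2 (by
            have g1 : (0 : ℝ) ≤ b - 1 := by linarith
            have g2 : (0 : ℝ) ≤ b - 2 := by linarith
            have g3 : (0 : ℝ) ≤ b - 3 := by linarith
            positivity) (by positivity)
      _ = _ := by field_simp
  have k3 : (S * M) * (1 / ((b : ℝ) * n) * (b * (b - 1) * n / (M * (M - 1) * (M - 2))))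
      ≤ 2 * D := by
    calc _ ≤ ((D * M) * M) * (2 / M ^ 2) :=
          mul_le_mul (mul_le_mul_of_nonneg_right hS hM0.le) f3 (by
            have g1 : (0 : ℝ) ≤ b - 1 := by linarith
            positivity) (by positivity)
      _ = _ := by field_simp
  have k2' := mul_le_mul_of_nonneg_right hQ (by
      have g1 : (0 : ℝ) ≤ b - 1 := by linarith
      have g2 : (0 : ℝ) ≤ b - 2 := by linarith
      have g3 : (0 : ℝ) ≤ b - 3 := by linarith
      positivity : 0 ≤ 1 / (4 * (b : ℝ) ^ 2) *
      (b * (b - 1) * (b - 2) * (b - 3) / (M * (M - 1) * (M - 2) * (M - 3))))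
  have k3' := mul_le_mul_of_nonneg_right hT (by
      have g1 : (0 : ℝ) ≤ b - 1 := by linarith
      positivity : 0 ≤ 1 / ((b : ℝ) * n) * (b * (b - 1) * n / (M * (M - 1) * (M - 2))))
  rw [meanExponent]
  nlinarith

lemma exists_sum_exp_neg_residualExponent_eq : ∃ C : ℝ, 0 < C ∧
    ∀ {V Y : Type} [Fintype V] [Fintype Y] {v : Y → V} {n b D : ℕ},
      (∀ u, profile v Finset.univ u ≤ D) → 3 ≤ D → 0 < n → Fintype.card Y = b + n →
      D ^ 4 + 2 ≤ b → b ≤ D * n →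
      ∃ E : ℝ, |E| ≤ C * (D : ℝ) ^ 4 / b ∧
        ∑ B ∈ Finset.powersetCard b (Finset.univ : Finset Y),
            Real.exp (-residualExponent n b (profile v Finset.univ) (profile v B))
          = (b + n).choose b *
            Real.exp (-meanExponent n b ((b + n : ℕ) : ℝ) (profile v Finset.univ) + E) := by
  obtain ⟨C, hC, h⟩ := exists_sum_powersetCard_exp_neg_eq 1
  refine ⟨C * 10, by positivity, ?_⟩
  intro V Y _ _ v n b D hD hD3 hn hY hDb hbn
  have hD' : (3 : ℝ) ≤ D := by exact_mod_cast hD3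
  have hDb' : (D : ℝ) ^ 4 + 2 ≤ b := by exact_mod_cast hDb
  have hD2 : (9 : ℝ) ≤ (D : ℝ) ^ 2 := by nlinarith
  have hb0 : (81 : ℝ) ≤ b := by nlinarith
  have hb4 : 4 ≤ b := by
    have : (4 : ℝ) ≤ b := by linarith
    exact_mod_cast this
  have hτ := monomialWeight_le v hn (show 0 < b by omega)
  obtain ⟨E, hE, hsum⟩ := h (ι := ResidualIndex Y) b chosenPoints avoidedPoints
    (monomialWeight v n b) (5 * (D : ℝ) ^ 2 / b) (by omega) disjoint_chosenPoints_avoidedPoints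
    card_chosenPoints_add_card_avoidedPoints_le (monomialWeight_nonneg v n b)
    (fun i => (hτ i).trans (one_div_le_one_div_of_le (by norm_num) (by linarith)))
    (fun i => (hτ i).trans (by gcongr; linarith))
    (by positivity)
    (by
      rw [div_le_one (by positivity)]
      nlinarith)
    (fun B y hB => sum_monomialWeight_mem_le hD hn (by omega) hY hbn hB y)
  simp only [sum_monomialWeight_eq_residualExponent] at hsum
  rw [sum_monomialWeight_mul_eq_meanExponent hb4 hY, hY] at hsum hE
  refine ⟨E, hE.trans ?_, hsum⟩
  have hmean := meanExponent_le hD hD3 hn hb4 (by rw [sum_profile, Finset.card_univ, hY])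
  calc C * (5 * (D : ℝ) ^ 2 / b) * meanExponent n b ((b + n : ℕ) : ℝ) (profile v Finset.univ)
      ≤ C * (5 * (D : ℝ) ^ 2 / b) * (2 * (D : ℝ) ^ 2) :=
        mul_le_mul_of_nonneg_left hmean (by positivity)
    _ = _ := by ring

lemma profile_sigma_fst {V : Type} [Fintype V] (a : V → ℕ) (u : V) :
    profile (fun p : Σ u, Fin (a u) => p.1) Finset.univ u = a u := by
  rw [profile, ← Fintype.card_subtype, Fintype.card_congr (Equiv.sigmaSubtype u),
    Fintype.card_fin]

lemma graphCount_bot {V : Type} [Fintype V] (d : V → ℕ) :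
    graphCount d ⊥ =
      (Finset.univ.filter fun G : SimpleGraph V => ∀ u, G.degree u = d u).card := by
  rw [graphCount]
  congr 1
  ext G
  simp

/-- The exponent of the correction factor in the number of graphs with degrees `d`. -/
noncomputable def simpleExponent {V : Type} [Fintype V] (b : ℕ) (d : V → ℕ) : ℝ :=
  (∑ u, (d u : ℝ) * (d u - 1)) / (2 * b) +
    (∑ u, ∑ w, if u ≠ w then ((d u : ℝ) * (d u - 1)) * (d w * (d w - 1)) else 0) /
      (4 * (b : ℝ) ^ 2)

lemma exists_average_spanningTrees_eq : ∃ C : ℝ, 0 < C ∧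
    ∀ {V : Type} [Fintype V] {n : ℕ}, Fintype.card V = n + 2 → 0 < n →
      ∀ {d : V → ℕ} {D k m : ℕ}, (∀ u, 1 ≤ d u) → (∀ u, d u ≤ D) → 3 ≤ D →
      ∑ u, d u = 2 * k → k = m + (n + 1) → D ^ 4 + 2 ≤ 2 * m → 2 * m ≤ D * n →
      0 < (Finset.univ.filter fun G : SimpleGraph V => ∀ u, G.degree u = d u).card ∧
      ∃ E : ℝ, |E| ≤ C * (D : ℝ) ^ 4 / (2 * m : ℕ) ∧
        (∑ G ∈ Finset.univ.filter (fun G : SimpleGraph V => ∀ u, G.degree u = d u),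
            ((Finset.univ.filter fun T : SimpleGraph V => T ≤ G ∧ T.IsTree).card : ℝ)) /
          ((Finset.univ.filter fun G : SimpleGraph V => ∀ u, G.degree u = d u).card : ℝ)
        = (∏ u, (d u : ℝ)) *
          ((2 * m + n).factorial * 2 ^ (n + 1) * k.factorial /
            ((2 * k).factorial * m.factorial)) *
          Real.exp (simpleExponent (2 * k) d -
            meanExponent n (2 * m) ((2 * m + n : ℕ) : ℝ) (fun u => d u - 1) + E) := by
  obtain ⟨C₁, hC₁, h₁⟩ := exists_sum_card_spanningTrees_eq
  obtain ⟨C₂, hC₂, h₂⟩ := exists_sum_exp_neg_residualExponent_eq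
  refine ⟨C₁ + C₂ + 50, by positivity, ?_⟩
  intro V _ n hV hn d D k m hd1 hdD hD3 hk hkm hDm hmn
  set v : (Σ u, Fin (d u - 1)) → V := fun p => p.1 with hv
  have hprof : profile v Finset.univ = fun u => d u - 1 :=
    funext fun u => profile_sigma_fst (fun u => d u - 1) u
  have hY : Fintype.card (Σ u, Fin (d u - 1)) = 2 * m + n := by
    have h : ∑ u, (d u - 1) + Fintype.card V = ∑ u, d u := by
      rw [Fintype.card, Finset.card_eq_sum_ones, ← Finset.sum_add_distrib]
      exact Finset.sum_congr rfl fun u _ => Nat.sub_add_cancel (hd1 u)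
    rw [Fintype.card_sigma]
    simp only [Fintype.card_fin]
    omega
  obtain ⟨E₁, hE₁, e₁⟩ := h₁ hV hn (v := v) (d := d) (D := D) (m := m)
    (fun u => by rw [hprof]; exact Nat.sub_add_cancel (hd1 u)) hdD hD3 (by omega) hDm
  obtain ⟨E₂, hE₂, e₂⟩ := h₂ (v := v) (n := n) (b := 2 * m) (D := D)
    (fun u => by rw [hprof]; exact (Nat.sub_le _ _).trans (hdD u)) hD3 hn hY hDm hmn
  obtain ⟨E₃, hE₃, e₃⟩ := exists_graphCount_eq (g := d) (X := (⊥ : SimpleGraph V)) (D := D)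
    (m := k) (fun u => by simpa using hdD u) hD3 hk (by omega)
  rw [graphCount_bot] at e₃
  set Γ := Finset.univ.filter fun G : SimpleGraph V => ∀ u, G.degree u = d u with hΓ
  have hfac : (0 : ℝ) < ∏ u, ((d u).factorial : ℝ) :=
    Finset.prod_pos fun u _ => by exact_mod_cast Nat.factorial_pos _
  have hfac' : (0 : ℝ) < ∏ u, ((d u - 1).factorial : ℝ) :=
    Finset.prod_pos fun u _ => by exact_mod_cast Nat.factorial_pos _
  have hprod : ∏ u, ((d u).factorial : ℝ) = (∏ u, (d u : ℝ)) * ∏ u, ((d u - 1).factorial : ℝ) := by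
    rw [← Finset.prod_mul_distrib]
    refine Finset.prod_congr rfl fun u _ => ?_
    rw [← Nat.mul_factorial_pred (by have := hd1 u; omega : d u ≠ 0)]
    push_cast
    ring
  have hΓpos : 0 < Γ.card := by
    rcases Nat.eq_zero_or_pos Γ.card with h | h
    · rw [h] at e₃
      exact absurd e₃ (ne_of_lt (by
        rw [Nat.cast_zero, zero_mul]
        positivity))
    · exact h
  refine ⟨hΓpos, E₁ + E₂ - E₃, ?_, ?_⟩
  · have hmk : 50 * (D : ℝ) ^ 4 / (2 * k : ℕ) ≤ 50 * (D : ℝ) ^ 4 / (2 * m : ℕ) := by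
      have : 0 < m := by
        have : 0 < D ^ 4 := by positivity
        omega
      gcongr
      omega
    calc |E₁ + E₂ - E₃| ≤ |E₁| + |E₂| + |E₃| := by
          rw [sub_eq_add_neg, ← abs_neg E₃]
          exact abs_add_three _ _ _
      _ ≤ C₁ * (D : ℝ) ^ 4 / (2 * m : ℕ) + C₂ * (D : ℝ) ^ 4 / (2 * m : ℕ)
          + 50 * (D : ℝ) ^ 4 / (2 * m : ℕ) := by linarith
      _ = _ := by ring
  · have hΓ' : (0 : ℝ) < Γ.card := by exact_mod_cast hΓpos
    rw [e₂, hprof] at e₁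
    simp only [SimpleGraph.bot_adj, if_false, Finset.sum_const_zero, zero_div, add_zero] at e₃
    rw [hprod, ← simpleExponent] at e₃
    have hchoose : ((2 * m + n).choose (2 * m) : ℝ) * (2 * m).factorial * n.factorial
        = (2 * m + n).factorial := by
      have := Nat.choose_mul_factorial_mul_factorial (Nat.le_add_right (2 * m) n)
      rw [Nat.add_sub_cancel_left] at this
      exact_mod_cast this
    have hpow : (2 : ℝ) ^ k = 2 ^ m * 2 ^ (n + 1) := by rw [hkm, pow_add]
    rw [div_eq_iff hΓ'.ne']
    refine mul_right_cancel₀ hfac'.ne' (e₁.trans ?_)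
    have key : ∀ X : ℝ, (∏ u, (d u : ℝ)) * X *
        Real.exp (simpleExponent (2 * k) d -
            meanExponent n (2 * m) ((2 * m + n : ℕ) : ℝ) (fun u => d u - 1) + (E₁ + E₂ - E₃))
        * (Γ.card : ℝ) * ∏ u, ((d u - 1).factorial : ℝ)
        = X * (((2 * k).factorial : ℝ) / (2 ^ k * k.factorial)) *
          Real.exp (-meanExponent n (2 * m) ((2 * m + n : ℕ) : ℝ) (fun u => d u - 1)
            + (E₁ + E₂)) := by
      intro X
      calc _ = X * Real.exp (simpleExponent (2 * k) d -
            meanExponent n (2 * m) ((2 * m + n : ℕ) : ℝ) (fun u => d u - 1) + (E₁ + E₂ - E₃)) *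
            ((Γ.card : ℝ) * ((∏ u, (d u : ℝ)) * ∏ u, ((d u - 1).factorial : ℝ))) := by ring
        _ = X * (((2 * k).factorial : ℝ) / (2 ^ k * k.factorial)) *
            (Real.exp (simpleExponent (2 * k) d -
            meanExponent n (2 * m) ((2 * m + n : ℕ) : ℝ) (fun u => d u - 1) + (E₁ + E₂ - E₃)) *
            Real.exp (-simpleExponent (2 * k) d + E₃)) := by rw [e₃]; ring
        _ = _ := by
            rw [← Real.exp_add]
            congr 2
            ring
    rw [key, hpow, ← hchoose, mul_assoc (Nat.cast _) (Real.exp _), ← Real.exp_add]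
    have f1 : ((2 * k).factorial : ℝ) ≠ 0 := by exact_mod_cast Nat.factorial_ne_zero _
    have f2 : (k.factorial : ℝ) ≠ 0 := by exact_mod_cast Nat.factorial_ne_zero _
    have f3 : (m.factorial : ℝ) ≠ 0 := by exact_mod_cast Nat.factorial_ne_zero _
    rw [show -meanExponent n (2 * m) ((2 * m + n : ℕ) : ℝ) (fun u => d u - 1) + E₂ + E₁ =
      -meanExponent n (2 * m) ((2 * m + n : ℕ) : ℝ) (fun u => d u - 1) + (E₁ + E₂) by ring]
    field_simp

lemma sum_sum_ne_mul_eq {V : Type} [Fintype V] (f g : V → ℝ) :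
    ∑ u, ∑ w, (if u ≠ w then f u * g w else 0) = (∑ u, f u) * (∑ w, g w) - ∑ u, f u * g u := by
  rw [Finset.sum_mul_sum, ← Finset.sum_sub_distrib]
  refine Finset.sum_congr rfl fun u _ => ?_
  rw [eq_sub_iff_add_eq, ← Finset.sum_erase_add _ _ (Finset.mem_univ u),
    ← Finset.sum_erase_add _ _ (Finset.mem_univ u)]
  simp only [ne_eq, not_true_eq_false, if_false, add_zero]
  congr 1
  refine Finset.sum_congr rfl fun w hw => ?_
  rw [if_pos (Finset.ne_of_mem_erase hw).symm]

lemma abs_linear_term_sub_le {S B M D : ℝ} (hM : 4 ≤ M) (hB0 : 1 ≤ B) (hBM : B ≤ M)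
    (hS0 : 0 ≤ S) (hS : S ≤ D * M) :
    |S * (1 / (2 * (B + 2)) * ((B + 2) * (B + 2 - 1) / (M * (M - 1)))) - B * S / (2 * M ^ 2)|
      ≤ 2 * D / M := by
  have h1 : 0 < M - 1 := by linarith
  have h0 : 0 < M := by linarith
  have hD : 0 ≤ D := by nlinarith
  have e : S * (1 / (2 * (B + 2)) * ((B + 2) * (B + 2 - 1) / (M * (M - 1))))
      - B * S / (2 * M ^ 2) = S * ((M + B) / (2 * M ^ 2 * (M - 1))) := by
    field_simp
    ring
  rw [e, abs_of_nonneg (by positivity)]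
  calc _ ≤ (D * M) * ((M + M) / (2 * M ^ 2 * (M / 2))) := by
        gcongr
        linarith
    _ = _ := by field_simp; ring

lemma abs_mixed_term_sub_le {S B M D T : ℝ} {n : ℕ} (hn : 0 < n) (hM : 4 ≤ M) (hB0 : 1 ≤ B)
    (hBM : B ≤ M) (hS0 : 0 ≤ S) (hS : S ≤ D * M) (hT0 : 0 ≤ T) (hT : T ≤ D ^ 2 * M) :
    |(S * M - T) * (1 / ((B + 2) * n) * ((B + 2) * (B + 2 - 1) * n / (M * (M - 1) * (M - 2))))
        - B * S / M ^ 2| ≤ 16 * D / M + 8 * D ^ 2 / M := by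
  have hn' : (0 : ℝ) < n := by exact_mod_cast hn
  have h1 : 0 < M - 1 := by linarith
  have h2 : 0 < M - 2 := by linarith
  have h0 : 0 < M := by linarith
  have hD : 0 ≤ D := by nlinarith
  have e : (S * M - T) *
      (1 / ((B + 2) * n) * ((B + 2) * (B + 2 - 1) * n / (M * (M - 1) * (M - 2))))
      - B * S / M ^ 2 = S * ((M ^ 2 + 3 * B * M - 2 * B) / (M ^ 2 * ((M - 1) * (M - 2))))
        - T * ((B + 1) / (M * ((M - 1) * (M - 2)))) := by
    field_simp
    ring
  have hq : M ^ 2 / 4 ≤ (M - 1) * (M - 2) := by nlinarith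
  have hnum : 0 ≤ M ^ 2 + 3 * B * M - 2 * B := by nlinarith
  have k1 : S * ((M ^ 2 + 3 * B * M - 2 * B) / (M ^ 2 * ((M - 1) * (M - 2)))) ≤ 16 * D / M := by
    calc _ ≤ (D * M) * ((4 * M ^ 2) / (M ^ 2 * (M ^ 2 / 4))) := by
          gcongr
          nlinarith
      _ = _ := by field_simp; ring
  have k2 : T * ((B + 1) / (M * ((M - 1) * (M - 2)))) ≤ 8 * D ^ 2 / M := by
    calc _ ≤ (D ^ 2 * M) * ((2 * M) / (M * (M ^ 2 / 4))) := by
          gcongr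
          linarith
      _ = _ := by field_simp; ring
  have k1' : 0 ≤ S * ((M ^ 2 + 3 * B * M - 2 * B) / (M ^ 2 * ((M - 1) * (M - 2)))) := by
    positivity
  have k2' : 0 ≤ T * ((B + 1) / (M * ((M - 1) * (M - 2)))) := by positivity
  rw [e, abs_le]
  constructor
  · have : 0 ≤ 16 * D / M := by positivity
    linarith
  · have : 0 ≤ 8 * D ^ 2 / M := by positivity
    linarith

lemma abs_quartic_ratio_sub_le {B M : ℝ} (hM : 8 ≤ M) (hB0 : 1 ≤ B) (hBM : B ≤ M) :
    |(B + 1) * B * (B - 1) / ((B + 2) * (M * (M - 1) * (M - 2) * (M - 3))) - B ^ 2 / M ^ 4|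
      ≤ 50 / M ^ 3 := by
  have h1 : 0 < M - 1 := by linarith
  have h2 : 0 < M - 2 := by linarith
  have h3 : 0 < M - 3 := by linarith
  have h0 : 0 < M := by linarith
  have hB2 : 0 < B + 2 := by linarith
  have hq : M ^ 3 / 4 ≤ (M - 1) * (M - 2) * (M - 3) := by
    nlinarith [mul_nonneg h0.le (sub_nonneg.2 hM), mul_nonneg (mul_nonneg h0.le h0.le)
      (sub_nonneg.2 hM)]
  have e : (B + 1) * B * (B - 1) / ((B + 2) * (M * (M - 1) * (M - 2) * (M - 3))) - B ^ 2 / M ^ 4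
      = (B ^ 2 * (6 * M ^ 2 - 11 * M + 6) - M ^ 3 * (B * (2 * B + 1) / (B + 2))) /
        (M ^ 4 * ((M - 1) * (M - 2) * (M - 3))) := by
    field_simp
    ring
  have hf : B * (2 * B + 1) / (B + 2) ≤ 2 * M := by
    rw [div_le_iff₀ hB2]
    nlinarith
  have hf0 : 0 ≤ B * (2 * B + 1) / (B + 2) := by positivity
  have hB2M : B ^ 2 ≤ M ^ 2 := by nlinarith
  have hp : 0 ≤ 6 * M ^ 2 - 11 * M + 6 := by nlinarith
  have hp' : 6 * M ^ 2 - 11 * M + 6 ≤ 6 * M ^ 2 := by nlinarith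
  rw [e, abs_div, abs_of_pos (by positivity : 0 < M ^ 4 * ((M - 1) * (M - 2) * (M - 3)))]
  have hnum : |B ^ 2 * (6 * M ^ 2 - 11 * M + 6) - M ^ 3 * (B * (2 * B + 1) / (B + 2))|
      ≤ 12 * M ^ 4 := by
    have u1 : B ^ 2 * (6 * M ^ 2 - 11 * M + 6) ≤ M ^ 2 * (6 * M ^ 2) :=
      mul_le_mul hB2M hp' hp (by positivity)
    have u2 : M ^ 3 * (B * (2 * B + 1) / (B + 2)) ≤ M ^ 3 * (2 * M) :=
      mul_le_mul_of_nonneg_left hf (by positivity)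
    have u3 : 0 ≤ B ^ 2 * (6 * M ^ 2 - 11 * M + 6) := by positivity
    have u4 : 0 ≤ M ^ 3 * (B * (2 * B + 1) / (B + 2)) := by positivity
    rw [abs_le]
    constructor <;> nlinarith [pow_pos h0 4]
  calc _ ≤ 12 * M ^ 4 / (M ^ 4 * (M ^ 3 / 4)) := by gcongr
    _ = 48 / M ^ 3 := by field_simp; ring
    _ ≤ _ := by gcongr; norm_num

lemma abs_quadratic_term_sub_le {S B M D T : ℝ} (hM : 8 ≤ M) (hB0 : 1 ≤ B)
    (hBM : B ≤ M) (hS0 : 0 ≤ S) (hS : S ≤ D * M) (hT0 : 0 ≤ T) (hT : T ≤ D ^ 3 * M) :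
    |(S ^ 2 - T) * (1 / (4 * (B + 2) ^ 2) * ((B + 2) * (B + 2 - 1) * (B + 2 - 2) * (B + 2 - 3) /
          (M * (M - 1) * (M - 2) * (M - 3)))) - (B * S / (2 * M ^ 2)) ^ 2|
      ≤ 13 * D ^ 2 / M + D ^ 3 / M := by
  have h0 : 0 < M := by linarith
  have h1 : 0 < M - 1 := by linarith
  have h2 : 0 < M - 2 := by linarith
  have h3 : 0 < M - 3 := by linarith
  have hB1 : 0 ≤ B - 1 := by linarith
  have hD : 0 ≤ D := by nlinarith
  have hρ := abs_quartic_ratio_sub_le hM hB0 hBM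
  set ρ := (B + 1) * B * (B - 1) / ((B + 2) * (M * (M - 1) * (M - 2) * (M - 3))) with hρd
  have hρ0 : 0 ≤ ρ := by positivity
  have hρ1 : ρ ≤ 4 / M ^ 2 := by
    have hq : M ^ 3 / 4 ≤ (M - 1) * (M - 2) * (M - 3) := by
      nlinarith [mul_nonneg h0.le (sub_nonneg.2 hM), mul_nonneg (mul_nonneg h0.le h0.le)
        (sub_nonneg.2 hM)]
    calc ρ = ((B + 1) * (B - 1)) * (B / (B + 2)) / (M * ((M - 1) * (M - 2) * (M - 3))) := by
          rw [hρd]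
          field_simp
      _ ≤ M ^ 2 * 1 / (M * (M ^ 3 / 4)) := by
          gcongr
          · nlinarith
          · rw [div_le_one (by linarith)]
            linarith
      _ = _ := by field_simp
  have e : (S ^ 2 - T) * (1 / (4 * (B + 2) ^ 2) *
      ((B + 2) * (B + 2 - 1) * (B + 2 - 2) * (B + 2 - 3) /
          (M * (M - 1) * (M - 2) * (M - 3)))) - (B * S / (2 * M ^ 2)) ^ 2
      = S ^ 2 / 4 * (ρ - B ^ 2 / M ^ 4) - T / 4 * ρ := by
    rw [hρd]
    field_simp
    ring
  have k1 : |S ^ 2 / 4 * (ρ - B ^ 2 / M ^ 4)| ≤ 13 * D ^ 2 / M := by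
    rw [abs_mul, abs_of_nonneg (by positivity : 0 ≤ S ^ 2 / 4)]
    calc _ ≤ (D * M) ^ 2 / 4 * (50 / M ^ 3) := by gcongr
      _ = 25 / 2 * D ^ 2 / M := by field_simp; ring
      _ ≤ _ := by gcongr; norm_num
  have k2 : |T / 4 * ρ| ≤ D ^ 3 / M := by
    rw [abs_of_nonneg (by positivity)]
    calc _ ≤ (D ^ 3 * M) / 4 * (4 / M ^ 2) := by gcongr
      _ = _ := by field_simp
  rw [e]
  exact (abs_sub _ _).trans (add_le_add k1 k2)

lemma exponent_identity {d R N : ℝ} (hd : 2 < d) (hN : 0 < N) :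
    N * (R + d ^ 2 - d) / (2 * (d * N)) + (N * (R + d ^ 2 - d)) ^ 2 / (4 * (d * N) ^ 2)
      - 3 * ((d - 2) * N * (N * (R + (d - 1) * (d - 2))) / (2 * ((d - 1) * N) ^ 2))
      - ((d - 2) * N * (N * (R + (d - 1) * (d - 2))) / (2 * ((d - 1) * N) ^ 2)) ^ 2
      = (6 * d ^ 2 - 14 * d + 7) / (4 * (d - 1) ^ 2) + R / (2 * (d - 1) ^ 3)
        + (2 * d ^ 2 - 4 * d + 1) * R ^ 2 / (4 * (d - 1) ^ 4 * d ^ 2) := by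
  have h1 : d - 1 ≠ 0 := by linarith
  have h0 : d ≠ 0 := by linarith
  field_simp
  ring

set_option maxHeartbeats 2000000 in
lemma abs_simpleExponent_sub_meanExponent_sub_le {V : Type} [Fintype V] {n : ℕ}
    (hV : Fintype.card V = n + 2) (hn : 0 < n) {d : V → ℕ} {D k m : ℕ} (hd1 : ∀ u, 1 ≤ d u)
    (hdD : ∀ u, d u ≤ D) (hD3 : 3 ≤ D) (hk : ∑ u, d u = 2 * k) (hkm : k = m + (n + 1))
    (hDm : D ^ 4 + 2 ≤ 2 * m) {dbar R : ℝ} (hdbar : dbar = (∑ u, (d u : ℝ)) / (n + 2 : ℕ))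
    (hR : R = (∑ u, ((d u : ℝ) - dbar) ^ 2) / (n + 2 : ℕ)) :
    |simpleExponent (2 * k) d -
        meanExponent n (2 * m) ((2 * m + n : ℕ) : ℝ) (fun u => d u - 1) -
        ((6 * dbar ^ 2 - 14 * dbar + 7) / (4 * (dbar - 1) ^ 2) + R / (2 * (dbar - 1) ^ 3)
          + (2 * dbar ^ 2 - 4 * dbar + 1) * R ^ 2 / (4 * (dbar - 1) ^ 4 * dbar ^ 2))|
      ≤ 50 * (D : ℝ) ^ 4 / ((dbar - 2) * (n + 2 : ℕ)) := by
  set N : ℝ := ((n + 2 : ℕ) : ℝ) with hN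
  have hN0 : 0 < N := by rw [hN]; positivity
  have hNn : N = n + 2 := by rw [hN]; push_cast; ring
  have hD3' : (3 : ℝ) ≤ D := by exact_mod_cast hD3
  have hDm' : (D : ℝ) ^ 4 + 2 ≤ 2 * m := by exact_mod_cast hDm
  have hD4 : (81 : ℝ) ≤ (D : ℝ) ^ 4 := by
    calc (81 : ℝ) = 3 ^ 4 := by norm_num
      _ ≤ _ := by gcongr
  have hs1 : ∑ u, (d u : ℝ) = dbar * N := by rw [hdbar]; field_simp
  have hk' : dbar * N = 2 * k := by rw [← hs1]; exact_mod_cast hk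
  have hkm' : (k : ℝ) = m + (n + 1) := by exact_mod_cast hkm
  have hB : (2 * m : ℝ) = (dbar - 2) * N + 2 := by
    have : (dbar - 2) * N = 2 * k - 2 * N := by rw [← hk']; ring
    rw [this, hkm', hNn]
    ring
  have hM : ((2 * m + n : ℕ) : ℝ) = (dbar - 1) * N := by
    push_cast
    have : (dbar - 1) * N = (dbar - 2) * N + N := by ring
    rw [this]
    linarith
  set B := (dbar - 2) * N with hBd
  have hB81 : 81 ≤ B := by linarith
  have hd2 : 2 < dbar := by
    have : 0 < dbar - 2 := pos_of_mul_pos_left (by linarith : 0 < (dbar - 2) * N) hN0.le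
    linarith
  set M := (dbar - 1) * N with hMd
  have hBM : B ≤ M := mul_le_mul_of_nonneg_right (by linarith) hN0.le
  have hM0 : 0 < M := by linarith
  have hdev : ∑ u, (d u : ℝ) ^ 2 = N * (R + dbar ^ 2) := by
    have h : ∑ u, ((d u : ℝ) - dbar) ^ 2
        = ∑ u, (d u : ℝ) ^ 2 - 2 * dbar * ∑ u, (d u : ℝ) + N * dbar ^ 2 := by
      rw [Finset.mul_sum, ← Finset.sum_sub_distrib, hN, ← hV, ← Finset.card_univ, ← nsmul_eq_mul,
        ← Finset.sum_const, ← Finset.sum_add_distrib]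
      exact Finset.sum_congr rfl fun u _ => by ring
    have h' : ∑ u, ((d u : ℝ) - dbar) ^ 2 = N * R := by rw [hR]; field_simp
    rw [h', hs1] at h
    linarith
  have hx : ∑ u, (d u : ℝ) * (d u - 1) = N * (R + dbar ^ 2 - dbar) := by
    have : ∑ u, (d u : ℝ) * (d u - 1) = ∑ u, (d u : ℝ) ^ 2 - ∑ u, (d u : ℝ) := by
      rw [← Finset.sum_sub_distrib]
      exact Finset.sum_congr rfl fun u _ => by ring
    rw [this, hdev, hs1]
    ring
  have ha : ∀ u, ((d u - 1 : ℕ) : ℝ) = (d u : ℝ) - 1 := fun u => by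
    rw [Nat.cast_sub (hd1 u), Nat.cast_one]
  have hd1' : ∀ u, (1 : ℝ) ≤ d u := fun u => by exact_mod_cast hd1 u
  have hdD' : ∀ u, (d u : ℝ) ≤ D := fun u => by exact_mod_cast hdD u
  have hsa : ∑ u, ((d u - 1 : ℕ) : ℝ) = M := by
    simp only [ha]
    rw [Finset.sum_sub_distrib, hs1, Finset.sum_const, Finset.card_univ, hV, nsmul_eq_mul, mul_one,
      ← hN, hMd]
    ring
  set S := ∑ u, ((d u - 1 : ℕ) : ℝ) * (((d u - 1 : ℕ) : ℝ) - 1) with hS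
  have hSe : S = N * (R + (dbar - 1) * (dbar - 2)) := by
    have : S = ∑ u, (d u : ℝ) ^ 2 - 3 * ∑ u, (d u : ℝ) + N * 2 := by
      rw [hS, Finset.mul_sum, ← Finset.sum_sub_distrib, hN, ← hV, ← Finset.card_univ,
        ← nsmul_eq_mul, ← Finset.sum_const, ← Finset.sum_add_distrib]
      exact Finset.sum_congr rfl fun u _ => by rw [ha]; ring
    rw [this, hdev, hs1]
    ring
  have haD : ∀ u, ((d u - 1 : ℕ) : ℝ) ≤ D := fun u => by
    rw [ha]
    linarith [hdD' u]
  have ha0 : ∀ u, (0 : ℝ) ≤ ((d u - 1 : ℕ) : ℝ) := fun u => Nat.cast_nonneg _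
  have haa0 : ∀ u, (0 : ℝ) ≤ ((d u - 1 : ℕ) : ℝ) * (((d u - 1 : ℕ) : ℝ) - 1) := fun u =>
    natCast_mul_sub_one_nonneg _
  have haaD : ∀ u, ((d u - 1 : ℕ) : ℝ) * (((d u - 1 : ℕ) : ℝ) - 1) ≤ D * ((d u - 1 : ℕ) : ℝ) :=
    fun u => by
      rw [mul_comm (D : ℝ)]
      exact mul_le_mul_of_nonneg_left (by linarith [haD u]) (ha0 u)
  have hS0 : 0 ≤ S := Finset.sum_nonneg fun u _ => haa0 u
  have hSD : S ≤ D * M := by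
    rw [← hsa, Finset.mul_sum]
    exact Finset.sum_le_sum fun u _ => haaD u
  set T₃ := ∑ u, ((d u - 1 : ℕ) : ℝ) * (((d u - 1 : ℕ) : ℝ) - 1) * ((d u - 1 : ℕ) : ℝ) with hT₃
  set T₂ := ∑ u, (((d u - 1 : ℕ) : ℝ) * (((d u - 1 : ℕ) : ℝ) - 1)) *
    (((d u - 1 : ℕ) : ℝ) * (((d u - 1 : ℕ) : ℝ) - 1)) with hT₂
  have hT₃0 : 0 ≤ T₃ := Finset.sum_nonneg fun u _ => mul_nonneg (haa0 u) (ha0 u)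
  have hT₂0 : 0 ≤ T₂ := Finset.sum_nonneg fun u _ => mul_nonneg (haa0 u) (haa0 u)
  have hD0 : (0 : ℝ) ≤ D := by linarith
  have hT₃D : T₃ ≤ (D : ℝ) ^ 2 * M := by
    rw [← hsa, Finset.mul_sum]
    refine Finset.sum_le_sum fun u _ => ?_
    calc _ ≤ D * ((d u - 1 : ℕ) : ℝ) * D :=
          mul_le_mul (haaD u) (haD u) (ha0 u) (mul_nonneg hD0 (ha0 u))
      _ = _ := by ring
  have hT₂D : T₂ ≤ (D : ℝ) ^ 3 * M := by
    rw [← hsa, Finset.mul_sum]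
    refine Finset.sum_le_sum fun u _ => ?_
    calc _ ≤ (D * ((d u - 1 : ℕ) : ℝ)) * (D * D) :=
          mul_le_mul (haaD u) ((haaD u).trans (mul_le_mul_of_nonneg_left (haD u) hD0)) (haa0 u)
            (mul_nonneg hD0 (ha0 u))
      _ = _ := by ring
  set X := ∑ u, ((d u : ℝ) * (d u - 1)) * (d u * (d u - 1)) with hX
  have hx0 : ∀ u, (0 : ℝ) ≤ (d u : ℝ) * (d u - 1) := fun u => natCast_mul_sub_one_nonneg _
  have hX0 : 0 ≤ X := Finset.sum_nonneg fun u _ => mul_nonneg (hx0 u) (hx0 u)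
  have hXD : X ≤ (D : ℝ) ^ 3 * (dbar * N) := by
    rw [← hs1, hX, Finset.mul_sum]
    refine Finset.sum_le_sum fun u _ => ?_
    have h1 : (d u : ℝ) * (d u - 1) ≤ D * d u := by
      rw [mul_comm (D : ℝ)]
      exact mul_le_mul_of_nonneg_left (by linarith [hdD' u]) (Nat.cast_nonneg _)
    calc _ ≤ (D * (d u : ℝ)) * (D * D) :=
          mul_le_mul h1 (h1.trans (mul_le_mul_of_nonneg_left (hdD' u) hD0)) (hx0 u)
            (mul_nonneg hD0 (Nat.cast_nonneg _))
      _ = _ := by ring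
  have hsimple : simpleExponent (2 * k) d
      = N * (R + dbar ^ 2 - dbar) / (2 * (dbar * N))
        + (N * (R + dbar ^ 2 - dbar)) ^ 2 / (4 * (dbar * N) ^ 2) - X / (4 * (dbar * N) ^ 2) := by
    rw [simpleExponent, sum_sum_ne_mul_eq (fun u => (d u : ℝ) * (d u - 1))
      (fun u => (d u : ℝ) * (d u - 1)), hx, hk']
    push_cast
    ring
  have hmean : meanExponent n (2 * m) ((2 * m + n : ℕ) : ℝ) (fun u => d u - 1)
      = S * (1 / (2 * (B + 2)) * ((B + 2) * (B + 2 - 1) / (M * (M - 1))))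
        + (S ^ 2 - T₂) * (1 / (4 * (B + 2) ^ 2) *
          ((B + 2) * (B + 2 - 1) * (B + 2 - 2) * (B + 2 - 3) /
          (M * (M - 1) * (M - 2) * (M - 3))))
        + (S * M - T₃) *
          (1 / ((B + 2) * n) * ((B + 2) * (B + 2 - 1) * n / (M * (M - 1) * (M - 2)))) := by
    rw [meanExponent, sum_sum_ne_mul_eq
      (fun u => ((d u - 1 : ℕ) : ℝ) * (((d u - 1 : ℕ) : ℝ) - 1))
      (fun u => ((d u - 1 : ℕ) : ℝ) * (((d u - 1 : ℕ) : ℝ) - 1)),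
      sum_sum_ne_mul_eq (fun u => ((d u - 1 : ℕ) : ℝ) * (((d u - 1 : ℕ) : ℝ) - 1))
      (fun u => ((d u - 1 : ℕ) : ℝ)), hM, hsa, ← hS, ← hT₂, ← hT₃, Nat.cast_mul, Nat.cast_ofNat,
      hB, sq S]
  have b1 := abs_linear_term_sub_le (by linarith : 4 ≤ M) (by linarith) hBM hS0 hSD
  have b2 := abs_quadratic_term_sub_le (by linarith : 8 ≤ M) (by linarith) hBM hS0 hSD hT₂0 hT₂D
  have b3 := abs_mixed_term_sub_le hn (by linarith : 4 ≤ M) (by linarith) hBM hS0 hSD hT₃0 hT₃D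
  have hXq0 : 0 ≤ X / (4 * (dbar * N) ^ 2) := by positivity
  have hXq : X / (4 * (dbar * N) ^ 2) ≤ (D : ℝ) ^ 3 / M := by
    calc X / (4 * (dbar * N) ^ 2) ≤ (D : ℝ) ^ 3 * (dbar * N) / (4 * (dbar * N) ^ 2) := by gcongr
      _ = (D : ℝ) ^ 3 / (4 * (dbar * N)) := by field_simp
      _ ≤ _ := by
          gcongr
          rw [hMd, ← mul_assoc]
          exact mul_le_mul_of_nonneg_right (by linarith) hN0.le
  have hid := exponent_identity (R := R) hd2 hN0
  rw [← hSe, ← hMd, ← hBd] at hid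
  rw [hsimple, hmean, ← hid]
  have hL : B * S / M ^ 2 = 2 * (B * S / (2 * M ^ 2)) := by field_simp
  rw [hL] at b3
  have hfin : 2 * D / M + (13 * (D : ℝ) ^ 2 / M + (D : ℝ) ^ 3 / M)
      + (16 * D / M + 8 * (D : ℝ) ^ 2 / M) + (D : ℝ) ^ 3 / M ≤ 50 * (D : ℝ) ^ 4 / B := by
    calc _ = (18 * D + 21 * (D : ℝ) ^ 2 + 2 * (D : ℝ) ^ 3) / M := by ring
      _ ≤ 50 * (D : ℝ) ^ 4 / M := by
          gcongr
          have hD1 : (1 : ℝ) ≤ D := by linarith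
          have p₁ : (D : ℝ) ≤ (D : ℝ) ^ 4 := le_self_pow₀ hD1 (by norm_num)
          have p₂ : (D : ℝ) ^ 2 ≤ (D : ℝ) ^ 4 := pow_le_pow_right₀ hD1 (by norm_num)
          have p₃ : (D : ℝ) ^ 3 ≤ (D : ℝ) ^ 4 := pow_le_pow_right₀ hD1 (by norm_num)
          linarith
      _ ≤ _ := by
          gcongr
  refine le_trans ?_ hfin
  have htri : ∀ {s₁ s₂ x t₁ t₂ t₃ l e₁ e₂ e₃ e₄ : ℝ}, |t₁ - l| ≤ e₁ → |t₂ - l ^ 2| ≤ e₂ →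
      |t₃ - 2 * l| ≤ e₃ → 0 ≤ x → x ≤ e₄ →
      |s₁ + s₂ - x - (t₁ + t₂ + t₃) - (s₁ + s₂ - 3 * l - l ^ 2)| ≤ e₁ + e₂ + e₃ + e₄ := by
    intro s₁ s₂ x t₁ t₂ t₃ l e₁ e₂ e₃ e₄ h₁ h₂ h₃ h₄ h₅
    rw [abs_le] at *
    constructor <;> linarith
  exact htri b1 b2 b3 hXq0 hXq

lemma log_stirlingSeq_le {n : ℕ} (hn : n ≠ 0) :
    Real.log (Stirling.stirlingSeq n) ≤ Real.log (√Real.pi) + 1 / (12 * n) := by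
  obtain ⟨n, rfl⟩ := Nat.exists_eq_succ_of_ne_zero hn
  have hmono : Monotone fun j : ℕ =>
      Real.log (Stirling.stirlingSeq (j + 1)) - 1 / (12 * ((j + 1 : ℕ) : ℝ)) := by
    refine monotone_nat_of_le_succ fun j => ?_
    have h := Stirling.log_stirlingSeq_sdiff_le (j + 1)
    have e : 1 / (12 * ((j + 1 : ℕ) : ℝ) * ((j + 1 : ℕ) + 1))
        = 1 / (12 * ((j + 1 : ℕ) : ℝ)) - 1 / (12 * ((j + 1 + 1 : ℕ) : ℝ)) := by
      push_cast
      field_simp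
      ring
    rw [e] at h
    linarith
  have hlim : Filter.Tendsto (fun j : ℕ =>
      Real.log (Stirling.stirlingSeq (j + 1)) - 1 / (12 * ((j + 1 : ℕ) : ℝ))) Filter.atTop
      (nhds (Real.log (√Real.pi) - 0)) := by
    refine Filter.Tendsto.sub ?_ ?_
    · exact ((Real.continuousAt_log (by positivity)).tendsto.comp
        Stirling.tendsto_stirlingSeq_sqrt_pi).comp (Filter.tendsto_add_atTop_nat 1)
    · have h := (tendsto_one_div_add_atTop_nhds_zero_nat (𝕜 := ℝ)).const_mul (1 / 12)
      rw [mul_zero] at h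
      refine h.congr fun j => ?_
      push_cast
      field_simp
  have := hmono.ge_of_tendsto hlim n
  simp only [sub_zero] at this
  simp only [Nat.succ_eq_add_one]
  linarith

lemma abs_log_factorial_sub_le {n : ℕ} (hn : n ≠ 0) :
    |Real.log (n.factorial : ℝ) -
      (n * Real.log n - n + Real.log n / 2 + Real.log (2 * Real.pi) / 2)| ≤ 1 / (12 * n) := by
  have h1 := Stirling.le_log_factorial_stirling hn
  have h2 := log_stirlingSeq_le hn
  have hn' : (n : ℝ) ≠ 0 := by exact_mod_cast hn
  rw [Stirling.log_stirlingSeq_formula, Real.log_sqrt Real.pi_pos.le,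
    Real.log_mul two_ne_zero hn', Real.log_div hn' (Real.exp_ne_zero 1), Real.log_exp] at h2
  rw [Real.log_mul two_ne_zero Real.pi_ne_zero] at h1 ⊢
  have : 0 ≤ 1 / (12 * (n : ℝ)) := by positivity
  rw [abs_le]
  constructor <;> linarith

lemma abs_mul_log_add_one_sub_le {x : ℝ} (hx : 0 < x) :
    |(x + 1 + 1 / 2) * Real.log (x + 1) - ((x + 1 + 1 / 2) * Real.log x + 1)| ≤ 3 / (2 * x) := by
  have e : Real.log (x + 1) = Real.log x + Real.log (1 + 1 / x) := by
    rw [← Real.log_mul hx.ne' (by positivity)]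
    congr 1
    field_simp
  have h1 : Real.log (1 + 1 / x) ≤ 1 / x := by
    have := Real.log_le_sub_one_of_pos (by positivity : 0 < 1 + 1 / x)
    linarith
  have h2 : 1 / (x + 1) ≤ Real.log (1 + 1 / x) := by
    have := Real.one_sub_inv_le_log_of_pos (by positivity : 0 < 1 + 1 / x)
    refine le_trans (le_of_eq ?_) this
    field_simp
    ring
  have g1 : (x + 1 + 1 / 2) * Real.log (1 + 1 / x) ≤ 1 + 3 / (2 * x) := by
    calc _ ≤ (x + 1 + 1 / 2) * (1 / x) := by gcongr
      _ = _ := by field_simp; ring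
  have g2 : 1 ≤ (x + 1 + 1 / 2) * Real.log (1 + 1 / x) := by
    calc 1 ≤ (x + 1 + 1 / 2) * (1 / (x + 1)) := by
          rw [mul_one_div, le_div_iff₀ (by positivity)]
          linarith
      _ ≤ _ := by gcongr
  have g3 : 0 ≤ 3 / (2 * x) := by positivity
  rw [e, abs_le]
  constructor <;> linarith

set_option maxHeartbeats 1000000 in
lemma abs_log_factorial_ratio_sub_le {n k m : ℕ} {d N : ℝ} (hN : N = n + 2)
    (hk : (k : ℝ) = d * N / 2) (hm : (m : ℝ) = (d - 2) * N / 2 + 1)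
    (hM : ((2 * m + n : ℕ) : ℝ) = (d - 1) * N) (hd : 2 < d) :
    |Real.log ((2 * m + n).factorial * 2 ^ (n + 1) * k.factorial /
          ((2 * k).factorial * m.factorial)) -
        (N * ((d - 1) * Real.log (d - 1) - d / 2 * Real.log d
          - (d / 2 - 1) * Real.log (d - 2)) + Real.log (d - 1) / 2
          - 3 / 2 * Real.log (d - 2) - Real.log N)| ≤ 4 / ((d - 2) * N) := by
  have hN0 : 0 < N := by rw [hN]; positivity
  have hδ : 0 < d - 2 := by linarith
  have hd1 : 0 < d - 1 := by linarith
  have hd0 : 0 < d := by linarith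
  have hBpos : 0 < (d - 2) * N := by positivity
  have hM0 : 2 * m + n ≠ 0 := by
    intro h
    rw [h, Nat.cast_zero] at hM
    exact absurd hM (by positivity)
  have hk0 : k ≠ 0 := by
    rintro rfl
    rw [Nat.cast_zero] at hk
    exact absurd hk (by positivity)
  have hm0 : m ≠ 0 := by
    rintro rfl
    rw [Nat.cast_zero] at hm
    exact absurd hm (by positivity)
  have s1 := abs_log_factorial_sub_le hM0
  have s2 := abs_log_factorial_sub_le hk0
  have s3 := abs_log_factorial_sub_le (show 2 * k ≠ 0 by omega)
  have s4 := abs_log_factorial_sub_le hm0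
  have hlogM : Real.log ((d - 1) * N) = Real.log (d - 1) + Real.log N :=
    Real.log_mul hd1.ne' hN0.ne'
  have hlogk : Real.log (d * N / 2) = Real.log d + Real.log N - Real.log 2 := by
    rw [Real.log_div (by positivity) two_ne_zero, Real.log_mul hd0.ne' hN0.ne']
  have hlog2k : Real.log (2 * (d * N / 2)) = Real.log d + Real.log N := by
    rw [mul_div_cancel₀ _ (two_ne_zero), Real.log_mul hd0.ne' hN0.ne']
  have hlogB : Real.log ((d - 2) * N / 2) = Real.log (d - 2) + Real.log N - Real.log 2 := by
    rw [Real.log_div (by positivity) two_ne_zero, Real.log_mul hδ.ne' hN0.ne']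
  have s5 := abs_mul_log_add_one_sub_le (by positivity : 0 < (d - 2) * N / 2)
  rw [hM, hlogM] at s1
  rw [hk, hlogk] at s2
  rw [Nat.cast_mul, Nat.cast_ofNat, hk, hlog2k] at s3
  rw [hm] at s4
  rw [hlogB] at s5
  have i1 : 1 / (12 * ((d - 1) * N)) ≤ 1 / (12 * ((d - 2) * N)) := by
    gcongr
    linarith
  have i2 : 1 / (12 * (d * N / 2)) ≤ 2 / (12 * ((d - 2) * N)) := by
    calc _ = 2 / (12 * (d * N)) := by field_simp
      _ ≤ _ := by gcongr; linarith
  have i3 : 1 / (12 * (2 * (d * N / 2))) ≤ 1 / (12 * ((d - 2) * N)) := by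
    rw [mul_div_cancel₀ _ (two_ne_zero' ℝ)]
    gcongr
    linarith
  have i4 : 1 / (12 * ((d - 2) * N / 2 + 1)) ≤ 2 / (12 * ((d - 2) * N)) := by
    calc _ ≤ 1 / (12 * ((d - 2) * N / 2)) := by gcongr; linarith
      _ = _ := by field_simp
  have i5 : 3 / (2 * ((d - 2) * N / 2)) = 3 / ((d - 2) * N) := by
    rw [mul_div_cancel₀ _ (two_ne_zero' ℝ)]
  have i6 : 4 / ((d - 2) * N) = 3 / ((d - 2) * N) + 12 * (1 / (12 * ((d - 2) * N))) := by
    field_simp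
    norm_num
  have i7 : 2 / (12 * ((d - 2) * N)) = 2 * (1 / (12 * ((d - 2) * N))) := by ring
  have i8 : 0 ≤ 1 / (12 * ((d - 2) * N)) := by positivity
  have f : ∀ j : ℕ, (j.factorial : ℝ) ≠ 0 := fun j => by exact_mod_cast Nat.factorial_ne_zero j
  have hn : ((n + 1 : ℕ) : ℝ) = N - 1 := by rw [hN]; push_cast; ring
  rw [Real.log_div (mul_ne_zero (mul_ne_zero (f _) (by positivity)) (f _))
    (mul_ne_zero (f _) (f _)), Real.log_mul (mul_ne_zero (f _) (by positivity)) (f _),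
    Real.log_mul (f _) (by positivity), Real.log_mul (f _) (f _), Real.log_pow, hn]
  rw [i5] at s5
  rw [i6]
  rw [i7] at i2 i4
  generalize 1 / (12 * ((d - 1) * N)) = ε₁ at *
  generalize 1 / (12 * (2 * (d * N / 2))) = ε₃ at *
  generalize 1 / (12 * (d * N / 2)) = ε₂ at *
  generalize 1 / (12 * ((d - 2) * N / 2 + 1)) = ε₄ at *
  generalize 1 / (12 * ((d - 2) * N)) = ε at *
  generalize 3 / ((d - 2) * N) = ε₅ at *
  generalize Real.log ((2 * m + n).factorial : ℝ) = F₁ at *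
  generalize Real.log (k.factorial : ℝ) = F₂ at *
  generalize Real.log ((2 * k).factorial : ℝ) = F₃ at *
  generalize Real.log (m.factorial : ℝ) = F₄ at *
  generalize Real.log ((d - 2) * N / 2 + 1) = lm at *
  generalize Real.log (d - 2) = l₂ at *
  generalize Real.log (d - 1) = l₁ at *
  generalize Real.log d = l₀ at *
  generalize Real.log N = lN at *
  generalize Real.log 2 = lt at *
  generalize Real.log (2 * Real.pi) = lp at *
  rw [abs_le] at s1 s2 s3 s4 s5 ⊢
  obtain ⟨s1, s1'⟩ := s1
  obtain ⟨s2, s2'⟩ := s2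
  obtain ⟨s3, s3'⟩ := s3
  obtain ⟨s4, s4'⟩ := s4
  obtain ⟨s5, s5'⟩ := s5
  constructor <;> linarith

lemma leading_term_eq_exp {P d N : ℝ} (hP : 0 < P) (hd : 2 < d) (hN : 0 < N) :
    Real.sqrt (d - 1) / ((d - 2) ^ ((3 : ℝ) / 2) * N) *
        (P ^ ((1 : ℝ) / N) * (d - 1) ^ (d - 1) /
          (d ^ (d / 2) * (d - 2) ^ (d / 2 - 1))) ^ N
      = P * Real.exp (N * ((d - 1) * Real.log (d - 1) - d / 2 * Real.log d
          - (d / 2 - 1) * Real.log (d - 2)) + Real.log (d - 1) / 2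
          - 3 / 2 * Real.log (d - 2) - Real.log N) := by
  have h2 : 0 < d - 2 := by linarith
  have h1 : 0 < d - 1 := by linarith
  have h0 : 0 < d := by linarith
  rw [← Real.exp_log (show 0 < Real.sqrt (d - 1) / ((d - 2) ^ ((3 : ℝ) / 2) * N) *
        (P ^ ((1 : ℝ) / N) * (d - 1) ^ (d - 1) /
          (d ^ (d / 2) * (d - 2) ^ (d / 2 - 1))) ^ N by positivity)]
  nth_rewrite 2 [← Real.exp_log hP]
  rw [← Real.exp_add, Real.log_mul (by positivity) (by positivity),
    Real.log_div (by positivity) (by positivity), Real.log_sqrt h1.le,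
    Real.log_mul (by positivity) hN.ne', Real.log_rpow h2, Real.log_rpow (by positivity),
    Real.log_div (by positivity) (by positivity), Real.log_mul (by positivity) (by positivity),
    Real.log_mul (by positivity) (by positivity), Real.log_rpow hP, Real.log_rpow h1,
    Real.log_rpow h0, Real.log_rpow h2]
  congr 1
  field_simp
  ring

lemma exists_average_spanningTrees_eq_leading_term : ∃ C : ℝ, 0 < C ∧
    ∀ {V : Type} [Fintype V] {n : ℕ}, Fintype.card V = n + 2 → 0 < n →
      ∀ {d : V → ℕ} {D k m : ℕ}, (∀ u, 1 ≤ d u) → (∀ u, d u ≤ D) → 3 ≤ D →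
      ∑ u, d u = 2 * k → k = m + (n + 1) → D ^ 4 + 2 ≤ 2 * m → 2 * m ≤ D * n →
      ∀ {dbar R : ℝ}, dbar = (∑ u, (d u : ℝ)) / (n + 2 : ℕ) →
      R = (∑ u, ((d u : ℝ) - dbar) ^ 2) / (n + 2 : ℕ) →
      0 < (Finset.univ.filter fun G : SimpleGraph V => ∀ u, G.degree u = d u).card ∧
      ∃ E : ℝ, |E| ≤ C * ((D : ℝ) ^ 4 / ((dbar - 2) * (n + 2 : ℕ))) ∧
        (∑ G ∈ Finset.univ.filter (fun G : SimpleGraph V => ∀ u, G.degree u = d u),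
            ((Finset.univ.filter fun T : SimpleGraph V => T ≤ G ∧ T.IsTree).card : ℝ)) /
          ((Finset.univ.filter fun G : SimpleGraph V => ∀ u, G.degree u = d u).card : ℝ)
        = Real.sqrt (dbar - 1) / ((dbar - 2) ^ ((3 : ℝ) / 2) * (n + 2 : ℕ)) *
          ((∏ u, (d u : ℝ)) ^ ((1 : ℝ) / (n + 2 : ℕ)) * (dbar - 1) ^ (dbar - 1) /
            (dbar ^ (dbar / 2) * (dbar - 2) ^ (dbar / 2 - 1))) ^ ((n + 2 : ℕ) : ℝ) *
          Real.exp ((6 * dbar ^ 2 - 14 * dbar + 7) / (4 * (dbar - 1) ^ 2)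
            + R / (2 * (dbar - 1) ^ 3)
            + (2 * dbar ^ 2 - 4 * dbar + 1) * R ^ 2 / (4 * (dbar - 1) ^ 4 * dbar ^ 2)
            + E) := by
  obtain ⟨C, hC, h⟩ := exists_average_spanningTrees_eq
  refine ⟨C + 54, by positivity, ?_⟩
  intro V _ n hV hn d D k m hd1 hdD hD3 hk hkm hDm hmn dbar R hdbar hR
  obtain ⟨hpos, E, hE, heq⟩ := h hV hn hd1 hdD hD3 hk hkm hDm hmn
  refine ⟨hpos, ?_⟩
  have hexp := abs_simpleExponent_sub_meanExponent_sub_le hV hn hd1 hdD hD3 hk hkm hDm hdbar hR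
  set N : ℝ := ((n + 2 : ℕ) : ℝ) with hN
  have hN0 : 0 < N := by rw [hN]; positivity
  have hNn : N = n + 2 := by rw [hN]; push_cast; ring
  have hk' : (k : ℝ) = dbar * N / 2 := by
    have h1 : ∑ u, (d u : ℝ) = 2 * k := by exact_mod_cast hk
    rw [hdbar, h1]
    field_simp
  have hkm' : (k : ℝ) = m + (n + 1) := by exact_mod_cast hkm
  have hm' : (m : ℝ) = (dbar - 2) * N / 2 + 1 := by linarith
  have hM : ((2 * m + n : ℕ) : ℝ) = (dbar - 1) * N := by
    push_cast
    linarith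
  have hDm' : (D : ℝ) ^ 4 + 2 ≤ 2 * m := by exact_mod_cast hDm
  have hD4 : (1 : ℝ) ≤ (D : ℝ) ^ 4 := one_le_pow₀ (by exact_mod_cast (by omega : 1 ≤ D))
  have hB0 : 0 < (dbar - 2) * N := by linarith
  have hd2 : 2 < dbar := by
    have : 0 < dbar - 2 := pos_of_mul_pos_left hB0 hN0.le
    linarith
  have hP : (0 : ℝ) < ∏ u, (d u : ℝ) :=
    Finset.prod_pos fun u _ => by exact_mod_cast hd1 u
  have hfact := abs_log_factorial_ratio_sub_le hNn hk' hm' hM hd2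
  rw [leading_term_eq_exp hP hd2 hN0]
  set L := N * ((dbar - 1) * Real.log (dbar - 1) - dbar / 2 * Real.log dbar
          - (dbar / 2 - 1) * Real.log (dbar - 2)) + Real.log (dbar - 1) / 2
          - 3 / 2 * Real.log (dbar - 2) - Real.log N with hL
  set Z := (6 * dbar ^ 2 - 14 * dbar + 7) / (4 * (dbar - 1) ^ 2)
            + R / (2 * (dbar - 1) ^ 3)
            + (2 * dbar ^ 2 - 4 * dbar + 1) * R ^ 2 / (4 * (dbar - 1) ^ 4 * dbar ^ 2) with hZ
  set W := simpleExponent (2 * k) d -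
        meanExponent n (2 * m) ((2 * m + n : ℕ) : ℝ) (fun u => d u - 1) with hW
  set F : ℝ := (2 * m + n).factorial * 2 ^ (n + 1) * k.factorial /
          ((2 * k).factorial * m.factorial) with hF
  have hF0 : 0 < F := by rw [hF]; positivity
  refine ⟨E + (W - Z) + (Real.log F - L), ?_, ?_⟩
  · have g1 : C * (D : ℝ) ^ 4 / (2 * m : ℕ) ≤ C * ((D : ℝ) ^ 4 / ((dbar - 2) * N)) := by
      rw [← mul_div_assoc]
      gcongr
      push_cast
      linarith
    have g2 : 4 / ((dbar - 2) * N) ≤ 4 * ((D : ℝ) ^ 4 / ((dbar - 2) * N)) := by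
      rw [← mul_div_assoc]
      gcongr
      linarith
    have g3 : 50 * (D : ℝ) ^ 4 / ((dbar - 2) * N) = 50 * ((D : ℝ) ^ 4 / ((dbar - 2) * N)) := by
      rw [mul_div_assoc]
    refine (abs_add_three _ _ _).trans ?_
    linarith
  · rw [heq, mul_assoc, mul_assoc, ← Real.exp_add]
    nth_rewrite 1 [← Real.exp_log hF0]
    rw [← Real.exp_add]
    congr 2
    ring

theorem expected_spanning_trees_sparse :
    ∃ C : ℝ, 0 < C ∧ ∃ N₀ : ℕ, ∀ n : ℕ, N₀ ≤ n → ∀ dseq : Fin n → ℕ,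
      (∀ j, 1 ≤ dseq j) → Even (∑ j, dseq j) →
      ∀ dmax davg dhat R Hd : ℝ,
      dmax = (Finset.univ.sup dseq : ℕ) →
      davg = (∑ j, (dseq j : ℝ)) / n →
      dhat = (∏ j, (dseq j : ℝ)) ^ ((1 : ℝ) / n) →
      R = (∑ j, ((dseq j : ℝ) - davg) ^ 2) / n →
      Hd = Real.sqrt (davg - 1) / ((davg - 2) ^ ((3 : ℝ) / 2) * n) *
        (dhat * (davg - 1) ^ (davg - 1) /
          (davg ^ (davg / 2) * (davg - 2) ^ (davg / 2 - 1))) ^ (n : ℝ) →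
      dmax ^ 4 ≤ (davg - 2) * n →
      (Finset.univ.filter
          (fun G : SimpleGraph (Fin n) => ∀ j, G.degree j = dseq j)).Nonempty ∧
      ∃ E : ℝ,
        |E| ≤ C * (dmax ^ 4 / ((davg - 2) * n) +
            min (dmax ^ 4 / ((davg - 2) ^ 2 * n))
              (min (dmax ^ 3 * Real.log n / ((davg - 2) * n)) (dmax * (davg - 2)))) ∧
        (∑ G ∈ Finset.univ.filter
              (fun G : SimpleGraph (Fin n) => ∀ j, G.degree j = dseq j),
            (spanningTreeCount G : ℝ)) /
          ((Finset.univ.filter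
              (fun G : SimpleGraph (Fin n) => ∀ j, G.degree j = dseq j)).card : ℝ)
        = Hd * Real.exp ((6 * davg ^ 2 - 14 * davg + 7) / (4 * (davg - 1) ^ 2)
            + R / (2 * (davg - 1) ^ 3)
            + (2 * davg ^ 2 - 4 * davg + 1) * R ^ 2 / (4 * (davg - 1) ^ 4 * davg ^ 2)
            + E) := by
  obtain ⟨C, hC, h⟩ := exists_average_spanningTrees_eq_leading_term
  refine ⟨C, hC, 3, ?_⟩
  intro N hN dseq hd1 heven dmax davg dhat R Hd hdmax hdavg hdhat hR hHd hmax
  obtain ⟨n, rfl⟩ := Nat.exists_eq_add_of_le' (show 2 ≤ N by omega)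
  have hn : 0 < n := by omega
  obtain ⟨k, hk⟩ := heven
  rw [← two_mul] at hk
  set D := Finset.univ.sup dseq with hD
  have hdD : ∀ u, dseq u ≤ D := fun u => Finset.le_sup (Finset.mem_univ u)
  have hN0 : (0 : ℝ) < ((n + 2 : ℕ) : ℝ) := by positivity
  have hsum : ∑ j, (dseq j : ℝ) = 2 * k := by exact_mod_cast hk
  have hB : (davg - 2) * ((n + 2 : ℕ) : ℝ) = 2 * k - 2 * ((n + 2 : ℕ) : ℝ) := by
    rw [hdavg, hsum]
    field_simp
  have hDk : D ^ 4 + 2 * (n + 2) ≤ 2 * k := by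
    rw [hB, hdmax] at hmax
    have : (D : ℝ) ^ 4 + 2 * ((n + 2 : ℕ) : ℝ) ≤ 2 * k := by linarith
    exact_mod_cast this
  have hkD : 2 * k ≤ (n + 2) * D := by
    rw [← hk]
    calc ∑ j, dseq j ≤ ∑ _j : Fin (n + 2), D := Finset.sum_le_sum fun j _ => hdD j
      _ = _ := by simp
  have hD1 : 1 ≤ D := (hd1 0).trans (hdD 0)
  have hD4 : 1 ≤ D ^ 4 := Nat.one_le_pow _ _ hD1
  have hD3 : 3 ≤ D := by
    by_contra hcon
    have : (n + 2) * D ≤ (n + 2) * 2 := Nat.mul_le_mul_left _ (by omega)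
    omega
  have hDn : D ≤ n := by
    have h1 : D ^ 3 * D ≤ (n + 2) * D := by
      calc D ^ 3 * D = D ^ 4 := (pow_succ D 3).symm
        _ ≤ _ := by omega
    have h2 : D ^ 3 ≤ n + 2 := Nat.le_of_mul_le_mul_right h1 (by omega)
    have h3 : D * 9 ≤ D ^ 3 := by
      rw [pow_succ' D 2]
      exact Nat.mul_le_mul_left _ (by nlinarith)
    omega
  obtain ⟨m, hm⟩ := Nat.exists_eq_add_of_le (show n + 1 ≤ k by omega)
  have hmn : 2 * m ≤ D * n := by
    have : (n + 2) * D = D * n + 2 * D := by ring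
    omega
  obtain ⟨hpos, E, hE, heq⟩ := h (V := Fin (n + 2)) (n := n) (by simp) hn hd1 hdD hD3 hk
    (show k = m + (n + 1) by omega) (by omega) hmn hdavg hR
  have hd2 : 0 < davg - 2 := by
    refine pos_of_mul_pos_left (a := davg - 2) ?_ hN0.le
    rw [hdmax] at hmax
    exact lt_of_lt_of_le (by positivity) hmax
  refine ⟨?_, E, hE.trans ?_, ?_⟩
  · rw [← Finset.card_pos]
    convert hpos
  · rw [hdmax]
    refine mul_le_mul_of_nonneg_left (le_add_of_nonneg_right ?_) hC.le
    have hlog : 0 ≤ Real.log ((n + 2 : ℕ) : ℝ) := Real.log_natCast_nonneg _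
    exact le_min (by positivity) (le_min (by positivity) (by positivity))
  · rw [hHd, hdhat]
    simp only [spanningTreeCount]
    convert heq
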